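/- arXiv:2310.19101 — 8 statements merged into one kernel-verified Lean document; each statement's English description precedes it below -/
import Mathlib

section
/- Let d ≥ 3 and V ∈ L_{∞,loc}(ℝ^d). Let G ⊂ ℝ^d be an open bounded set with diam(G) = 2 that contains a ball B_ρ₀(0) (ρ₀ > 0) and is star-shaped with respect to every point of B_ρ₀(0), and set G_r(y) = {x ∈ ℝ^d : x/r ∈ G} + y. Let r₀ > 0 and suppose limsup_{|y|→∞} ( ∫_{G_{r₀}(y)} (V₋(x))^{d/2} dx )^{2/d} < K(d), where V₋(x) = max(−V(x), 0). Then the Schrödinger operator H = −Δ + V is bounded below: there exists C ∈ ℝ such that ∫_{ℝ^d}(|∇u|² + V|u|²) dx ≥ −C ∫_{ℝ^d}|u|² dx for all u ∈ C₀^∞(ℝ^d). -/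
open MeasureTheory Metric Filter

/-- `G_r(y) = {x : x/r ∈ G} + y`. -/
def Gr {d : ℕ} (G : Set (EuclideanSpace ℝ (Fin d))) (r : ℝ)
    (y : EuclideanSpace ℝ (Fin d)) : Set (EuclideanSpace ℝ (Fin d)) :=
  {x | r⁻¹ • (x - y) ∈ G}

/-- The Sobolev constant `C(d) = (π d (d-2))^{-1/2} (Γ(d)/Γ(d/2))^{1/d}`. -/
noncomputable def Cd (d : ℕ) : ℝ :=
  Real.sqrt (1 / (Real.pi * (d : ℝ) * ((d : ℝ) - 2))) *
    (Real.Gamma (d : ℝ) / Real.Gamma ((d : ℝ) / 2)) ^ ((1 : ℝ) / (d : ℝ))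

/-- `K(d) = 1 / C(d)²`. -/
noncomputable def Kd (d : ℕ) : ℝ := 1 / (Cd d) ^ 2

theorem cdf_facts (p : ℝ → ℝ) (hp : Continuous p) (hpos : ∀ x, 0 < p x) (hi : Integrable p) :
    ∃ P : ℝ → ℝ, (∀ x, HasDerivAt P (p x) x) ∧ StrictMono P ∧
      (∀ x, P x ∈ Set.Ioo 0 (∫ x, p x)) ∧ ∀ v ∈ Set.Ioo 0 (∫ x, p x), ∃ x, P x = v := by
  have hd : ∀ x, HasDerivAt (fun x => ∫ t in Set.Iic x, p t) (p x) x := by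
    intro x
    have h1 : HasDerivAt (fun x => (∫ t in Set.Iic (0:ℝ), p t) + ∫ t in (0:ℝ)..x, p t) (p x) x := by
      have := intervalIntegral.integral_hasDerivAt_right (a := 0) (b := x) (f := p)
        (hp.intervalIntegrable _ _) (hp.stronglyMeasurableAtFilter _ _) hp.continuousAt
      exact this.const_add _
    convert h1 using 1
    ext y
    rw [← intervalIntegral.integral_Iic_sub_Iic hi.integrableOn hi.integrableOn]
    ring
  have hm : StrictMono (fun x => ∫ t in Set.Iic x, p t) := by
    apply strictMono_of_deriv_pos
    intro x
    rw [(hd x).deriv]; exact hpos x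
  have hbot : Tendsto (fun x => ∫ t in Set.Iic x, p t) atBot (nhds 0) :=
    tendsto_integral_Iic_zero tendsto_id
  have htop : Tendsto (fun x => ∫ t in Set.Iic x, p t) atTop (nhds (∫ x, p x)) :=
    (aecover_Iic tendsto_id).integral_tendsto_of_countably_generated hi
  refine ⟨_, hd, hm, ?_, ?_⟩
  · intro x
    constructor
    · exact lt_of_le_of_lt (hm.monotone.le_of_tendsto hbot (x - 1)) (hm (by linarith))
    · exact lt_of_lt_of_le (hm (show x < x + 1 by linarith)) (hm.monotone.ge_of_tendsto htop (x + 1))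
  · intro v hv
    have hc : Continuous (fun x => ∫ t in Set.Iic x, p t) :=
      continuous_iff_continuousAt.2 fun x => (hd x).continuousAt
    exact mem_range_of_exists_le_of_exists_ge hc
      ((hbot.eventually (eventually_le_nhds hv.1)).exists)
      ((htop.eventually (eventually_ge_nhds hv.2)).exists)

theorem transport1D (p q : ℝ → ℝ) (hp : Continuous p) (hq : Continuous q) (hp0 : ∀ x, 0 < p x)
    (hq0 : ∀ x, 0 < q x) (hpi : Integrable p) (hqi : Integrable q)
    (hpq : ∫ x, p x = ∫ x, q x) :
    ∃ T : ℝ → ℝ, StrictMono T ∧ Function.Surjective T ∧ Continuous T ∧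
      ∀ x, HasDerivAt T (p x / q (T x)) x := by
  obtain ⟨P, hPd, hPm, hPr, hPs⟩ := cdf_facts p hp hp0 hpi
  obtain ⟨Q, hQd, hQm, hQr, hQs⟩ := cdf_facts q hq hq0 hqi
  rw [hpq] at hPr hPs
  choose T hT using fun x => hQs _ (hPr x)
  have hTm : StrictMono T := by
    intro x y hxy
    apply hQm.lt_iff_lt.1
    rw [hT, hT]; exact hPm hxy
  have hTs : Function.Surjective T := by
    intro y
    obtain ⟨x, hx⟩ := hPs _ (hQr y)
    exact ⟨x, hQm.injective (by rw [hT, hx])⟩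
  have hTc := hTm.monotone.continuous_of_surjective hTs
  refine ⟨T, hTm, hTs, hTc, fun x => ?_⟩
  have h1 := hasDerivAt_iff_tendsto_slope.1 (hPd x)
  have h2 := hasDerivAt_iff_tendsto_slope.1 (hQd (T x))
  have h3 : Tendsto T (nhdsWithin x {x}ᶜ) (nhdsWithin (T x) {T x}ᶜ) := by
    apply tendsto_nhdsWithin_of_tendsto_nhds_of_eventually_within
    · exact hTc.continuousAt.tendsto.mono_left nhdsWithin_le_nhds
    · filter_upwards [self_mem_nhdsWithin] with y hy
      exact fun h => hy (hTm.injective h)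
  rw [hasDerivAt_iff_tendsto_slope]
  refine (h1.div (h2.comp h3) (hq0 _).ne').congr' ?_
  filter_upwards [self_mem_nhdsWithin] with y hy
  have hy' : y - x ≠ 0 := sub_ne_zero.2 hy
  have hTy : T y - T x ≠ 0 := sub_ne_zero.2 fun h => hy (hTm.injective h)
  have hPy : P y - P x ≠ 0 := sub_ne_zero.2 fun h => hy (hPm.injective h)
  change slope P x y / slope Q (T x) (T y) = slope T x y
  simp only [slope_def_field, hT]
  field_simp

theorem cov1D (T T' : ℝ → ℝ) (hm : StrictMono T) (hs : Function.Surjective T)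
    (hd : ∀ x, HasDerivAt T (T' x) x) (h0 : ∀ x, 0 ≤ T' x) (g : ℝ → ENNReal) :
    ∫⁻ y, g y = ∫⁻ x, ENNReal.ofReal (T' x) * g (T x) := by
  have := lintegral_image_eq_lintegral_abs_deriv_mul (s := Set.univ) (f := T) (f' := T')
    MeasurableSet.univ (fun x _ => (hd x).hasDerivWithinAt) hm.injective.injOn g
  simpa [hs.range_eq, abs_of_nonneg (h0 _)] using this

theorem exists_small_of_integrable (g : ℝ → ℝ) (hg : Integrable g) (N : ℝ) :
    ∃ x, N ≤ x ∧ |g x| ≤ 1 := by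
  by_contra! h
  have h2 : IntegrableOn (fun _ : ℝ => (1:ℝ)) (Set.Ioi N) := by
    refine Integrable.mono' hg.integrableOn.norm (by fun_prop) ?_
    refine (ae_restrict_iff' measurableSet_Ioi).2 (Eventually.of_forall fun x hx => ?_)
    simpa using (h x (le_of_lt hx)).le
  rw [integrableOn_const_iff] at h2
  simp at h2

theorem exists_small_of_integrable' (g : ℝ → ℝ) (hg : Integrable g) (N : ℝ) :
    ∃ x, x ≤ -N ∧ |g x| ≤ 1 := by
  obtain ⟨x, hx, h⟩ := exists_small_of_integrable (fun x => g (-x)) hg.comp_neg N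
  exact ⟨-x, by linarith, h⟩

theorem ibp_abs (h h' T T' : ℝ → ℝ) (hd : ∀ x, HasDerivAt h (h' x) x)
    (hTd : ∀ x, HasDerivAt T (T' x) x) (hc' : Continuous h') (hTc' : Continuous T')
    (h0 : ∀ x, 0 ≤ h x) (hT0 : ∀ x, 0 ≤ T' x)
    (i1 : Integrable (fun x => h x * T x)) (i2 : Integrable (fun x => h' x * T x)) :
    Integrable (fun x => h x * T' x) ∧ ∫ x, h x * T' x = - ∫ x, h' x * T x := by
  have hc : Continuous h := continuous_iff_continuousAt.2 fun x => (hd x).continuousAt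
  have hTc : Continuous T := continuous_iff_continuousAt.2 fun x => (hTd x).continuousAt
  have hprod : ∀ x, HasDerivAt (fun x => h x * T x) (h' x * T x + h x * T' x) x :=
    fun x => (hd x).mul (hTd x)
  have hi : Integrable (fun x => h x * T' x) := by
    choose b hb1 hb2 using fun i : ℕ => exists_small_of_integrable _ i1 i
    choose a ha1 ha2 using fun i : ℕ => exists_small_of_integrable' _ i1 i
    have hab : ∀ i, a i ≤ b i := fun i => by
      have := hb1 i; have := ha1 i
      have : (0:ℝ) ≤ i := Nat.cast_nonneg i
      linarith
    refine integrable_of_intervalIntegral_norm_bounded (l := atTop) (a := a) (b := b)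
      (2 + ∫ x, |h' x * T x|) ?_ ?_ ?_ ?_
    · intro i
      exact ((hc.mul hTc').integrableOn_Icc).mono_set Set.Ioc_subset_Icc_self
    · refine tendsto_atBot_mono ha1 ?_
      exact tendsto_neg_atTop_atBot.comp tendsto_natCast_atTop_atTop
    · exact tendsto_atTop_mono hb1 tendsto_natCast_atTop_atTop
    · refine Eventually.of_forall fun i => ?_
      have e1 : ∀ x, ‖h x * T' x‖ = (h' x * T x + h x * T' x) - h' x * T x := fun x => by
        rw [Real.norm_of_nonneg (mul_nonneg (h0 x) (hT0 x))]; ring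
      simp only [e1]
      rw [intervalIntegral.integral_sub (Continuous.intervalIntegrable (by fun_prop) _ _)
        (Continuous.intervalIntegrable (by fun_prop) _ _),
        intervalIntegral.integral_eq_sub_of_hasDerivAt (fun x _ => hprod x)
        (Continuous.intervalIntegrable (by fun_prop) _ _)]
      have e2 : |∫ x in a i..b i, h' x * T x| ≤ ∫ x, |h' x * T x| := by
        refine (intervalIntegral.abs_integral_le_integral_abs (hab i)).trans ?_
        rw [intervalIntegral.integral_of_le (hab i)]
        exact setIntegral_le_integral i2.norm (Eventually.of_forall fun x => abs_nonneg _)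
      have := abs_le.1 e2
      have := abs_le.1 (hb2 i)
      have := abs_le.1 (ha2 i)
      linarith
  refine ⟨hi, ?_⟩
  have := integral_eq_zero_of_hasDerivAt_of_integrable hprod (i2.add hi) i1
  rw [integral_add i2 hi] at this
  linarith

theorem inv_pow_le_aux {c w f : ℝ} (hc : 0 < c) (hw : 0 < w) (h : c * w ≤ f) (n : ℕ) :
    (f⁻¹) ^ n ≤ (c⁻¹) ^ n * (w⁻¹) ^ n := by
  rw [← mul_pow, ← mul_inv]
  have : 0 < c * w := mul_pos hc hw
  have hf : 0 < f := this.trans_le h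
  gcongr

theorem ibp_main (n : ℕ) (hn : 3 ≤ n) (φ φ' p T T' : ℝ → ℝ) (c C c1 A B : ℝ)
    (hc : 0 < c) (hc1 : 0 < c1) (hA : 0 < A) (hB : 0 < B)
    (hAB : 4 * A * B = ((n:ℝ) - 1) ^ 2)
    (hd : ∀ x, HasDerivAt φ (φ' x) x) (hφc : Continuous φ') (hTc' : Continuous T')
    (hTd : ∀ x, HasDerivAt T (T' x) x) (hT0 : ∀ x, 0 ≤ T' x)
    (hlow : ∀ x, c * (1 + x ^ 2) ≤ φ x) (hD : ∀ x, (φ' x) ^ 2 ≤ C * (1 + x ^ 2))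
    (hp : ∀ x, c1 * ((1 + x ^ 2)⁻¹) ^ n ≤ p x)
    (hpT : Integrable (fun x => p x * T x ^ 2)) :
    ∫⁻ x, ENNReal.ofReal (T' x * ((φ x)⁻¹) ^ (n - 1)) ≤
      ∫⁻ x, ENNReal.ofReal (A * ((φ x)⁻¹) ^ n * (φ' x) ^ 2 + B * (((φ x)⁻¹) ^ n * T x ^ 2)) := by
  have hcφ : Continuous φ := continuous_iff_continuousAt.2 fun x => (hd x).continuousAt
  have hcT : Continuous T := continuous_iff_continuousAt.2 fun x => (hTd x).continuousAt
  have hw : ∀ x : ℝ, 0 < 1 + x ^ 2 := fun x => by positivity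
  have hφ0 : ∀ x, 0 < φ x := fun x => lt_of_lt_of_le (mul_pos hc (hw x)) (hlow x)
  have hinvc : Continuous (fun x => (φ x)⁻¹) := hcφ.inv₀ fun x => (hφ0 x).ne'
  have hC : 0 ≤ C := by have := hD 0; have := sq_nonneg (φ' 0); norm_num at *; linarith
  have hup : ∀ (k : ℕ) x, ((φ x)⁻¹) ^ k ≤ (c⁻¹) ^ k * ((1 + x ^ 2)⁻¹) ^ k :=
    fun k x => inv_pow_le_aux hc (hw x) (hlow x) k
  have hw1 : ∀ x : ℝ, (1 + x ^ 2)⁻¹ ≤ 1 := fun x => inv_le_one_of_one_le₀ (by nlinarith [sq_nonneg x])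
  have hwi : ∀ x : ℝ, 0 < (1 + x ^ 2)⁻¹ := fun x => inv_pos.2 (hw x)
  have hpow : ∀ (x : ℝ) (k : ℕ), 1 ≤ k → ((1 + x ^ 2)⁻¹) ^ k ≤ (1 + x ^ 2)⁻¹ := fun x k hk =>
    pow_le_of_le_one (hwi x).le (hw1 x) (by omega)
  -- derivative of h
  have hhd : ∀ x, HasDerivAt (fun x => ((φ x)⁻¹) ^ (n - 1))
      (-(((n:ℝ) - 1) * ((φ x)⁻¹) ^ n * φ' x)) x := by
    intro x
    have := ((hd x).inv (hφ0 x).ne').pow (n - 1)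
    refine this.congr_deriv ?_
    obtain ⟨k, rfl⟩ : ∃ k, n = k + 2 := ⟨n - 2, by omega⟩
    have := (hφ0 x).ne'
    simp
    field_simp
    ring
  -- integrability
  have iF1 : Integrable (fun x => ((φ x)⁻¹) ^ n * (φ' x) ^ 2) := by
    refine Integrable.mono' (integrable_inv_one_add_sq.const_mul ((c⁻¹) ^ n * C))
      (by fun_prop) (Eventually.of_forall fun x => ?_)
    rw [Real.norm_of_nonneg (by have := hφ0 x; positivity)]
    calc ((φ x)⁻¹) ^ n * (φ' x) ^ 2 ≤ ((c⁻¹) ^ n * ((1 + x ^ 2)⁻¹) ^ n) * (C * (1 + x ^ 2)) := by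
          gcongr
          · exact hup n x
          · exact hD x
      _ = (c⁻¹) ^ n * C * ((1 + x ^ 2)⁻¹) ^ (n - 1) := by
          obtain ⟨k, rfl⟩ : ∃ k, n = k + 1 := ⟨n - 1, by omega⟩
          have := (hw x).ne'
          simp
          field_simp
          ring
      _ ≤ _ := by
          gcongr
          exact hpow x _ (by omega)
  have iF2 : Integrable (fun x => ((φ x)⁻¹) ^ n * T x ^ 2) := by
    refine Integrable.mono' (hpT.const_mul ((c⁻¹) ^ n * c1⁻¹))
      (by fun_prop) (Eventually.of_forall fun x => ?_)
    rw [Real.norm_of_nonneg (by have := hφ0 x; positivity)]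
    calc ((φ x)⁻¹) ^ n * (T x) ^ 2 ≤ ((c⁻¹) ^ n * ((1 + x ^ 2)⁻¹) ^ n) * (T x ^ 2) := by
          gcongr
          exact hup n x
      _ = (c⁻¹) ^ n * c1⁻¹ * ((c1 * ((1 + x ^ 2)⁻¹) ^ n) * (T x) ^ 2) := by
          field_simp
      _ ≤ _ := by
          gcongr
          exact hp x
  have i2 : Integrable (fun x => -(((n:ℝ) - 1) * ((φ x)⁻¹) ^ n * φ' x) * T x) := by
    refine Integrable.mono' ((iF1.const_mul A).add (iF2.const_mul B))
      (by fun_prop) (Eventually.of_forall fun x => ?_)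
    have h1 : |((n:ℝ) - 1) * φ' x * T x| ≤ A * φ' x ^ 2 + B * T x ^ 2 := by
      rw [← sq_le_sq₀ (abs_nonneg _) (by positivity), sq_abs, mul_pow, mul_pow, ← hAB]
      nlinarith [sq_nonneg (A * φ' x ^ 2 - B * T x ^ 2)]
    have h2 : 0 < ((φ x)⁻¹) ^ n := by have := hφ0 x; positivity
    rw [Real.norm_eq_abs]
    calc _ = ((φ x)⁻¹) ^ n * |((n:ℝ) - 1) * φ' x * T x| := by
          rw [← abs_of_pos h2, ← abs_mul, abs_of_pos h2, ← abs_neg]; congr 1; ring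
      _ ≤ ((φ x)⁻¹) ^ n * (A * φ' x ^ 2 + B * T x ^ 2) := by gcongr
      _ = _ := by simp only [Pi.add_apply]; ring
  have i1 : Integrable (fun x => ((φ x)⁻¹) ^ (n - 1) * T x) := by
    refine Integrable.mono' (hpT.add (integrable_inv_one_add_sq.const_mul (((c⁻¹) ^ (n - 1)) ^ 2 * c1⁻¹)))
      (by fun_prop) (Eventually.of_forall fun x => ?_)
    have hp0 : 0 < p x := lt_of_lt_of_le (by have := hw x; positivity) (hp x)
    have h2 : 0 < ((φ x)⁻¹) ^ (n - 1) := by have := hφ0 x; positivity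
    have h3 : (((φ x)⁻¹) ^ (n - 1)) ^ 2 / p x ≤ ((c⁻¹) ^ (n - 1)) ^ 2 * c1⁻¹ * (1 + x ^ 2)⁻¹ := by
      have hq : 0 < c1 * ((1 + x ^ 2)⁻¹) ^ n := by have := hw x; positivity
      calc _ ≤ ((c⁻¹) ^ (n - 1) * ((1 + x ^ 2)⁻¹) ^ (n - 1)) ^ 2 / (c1 * ((1 + x ^ 2)⁻¹) ^ n) := by
            gcongr
            · exact hup _ x
            · exact hp x
        _ = ((c⁻¹) ^ (n - 1)) ^ 2 * c1⁻¹ * ((1 + x ^ 2)⁻¹) ^ (n - 2) := by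
            obtain ⟨k, rfl⟩ : ∃ k, n = k + 2 := ⟨n - 2, by omega⟩
            have := hw x
            have e : k + 2 - 1 = k + 1 := by omega
            have e2 : k + 2 - 2 = k := by omega
            rw [e, e2]
            field_simp
            ring
        _ ≤ _ := by
            gcongr
            exact hpow x _ (by omega)
    simp only [Pi.add_apply]
    refine le_trans ?_ (add_le_add_right h3 _)
    rw [norm_mul, Real.norm_of_nonneg h2.le, Real.norm_eq_abs, ← sq_abs (T x)]
    set a := ((φ x)⁻¹) ^ (n - 1)
    have : p x * |T x| ^ 2 + a ^ 2 / p x - a * |T x| =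
      ((p x * |T x| - a) ^ 2 + p x * |T x| * a) / p x := by field_simp; ring
    have h4 : 0 ≤ ((p x * |T x| - a) ^ 2 + p x * |T x| * a) / p x := by positivity
    linarith
  obtain ⟨j1, j2⟩ := ibp_abs (fun x => ((φ x)⁻¹) ^ (n - 1)) _ T T' hhd hTd (by fun_prop) hTc'
    (fun x => by have := hφ0 x; positivity) hT0 i1 i2
  simp only [mul_comm (T' _)]
  rw [← ofReal_integral_eq_lintegral_ofReal j1
      (Eventually.of_forall fun x => mul_nonneg (by have := hφ0 x; positivity) (hT0 x)), j2,
    ← ofReal_integral_eq_lintegral_ofReal]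
  · apply ENNReal.ofReal_le_ofReal
    rw [← integral_neg]
    refine integral_mono i2.neg ?_ ?_
    · simp only [mul_assoc A]
      exact (iF1.const_mul A).add (iF2.const_mul B)
    intro x
    have h2 : 0 < ((φ x)⁻¹) ^ n := by have := hφ0 x; positivity
    have h1 : ((n:ℝ) - 1) * φ' x * T x ≤ A * φ' x ^ 2 + B * T x ^ 2 := by
      apply le_of_abs_le
      rw [← sq_le_sq₀ (abs_nonneg _) (by positivity), sq_abs, mul_pow, mul_pow, ← hAB]
      nlinarith [sq_nonneg (A * φ' x ^ 2 - B * T x ^ 2)]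
    have := mul_le_mul_of_nonneg_left h1 h2.le
    simp only
    linarith
  · simp only [mul_assoc A]
    exact (iF1.const_mul A).add (iF2.const_mul B)
  · refine Eventually.of_forall fun x => ?_
    have := hφ0 x
    simp only [Pi.zero_apply]
    positivity

/-- The weight `1 + |x|²`. -/
def ww {m : ℕ} (x : Fin m → ℝ) : ℝ := 1 + ∑ i, x i ^ 2

theorem ww_ge {m : ℕ} (x : Fin m → ℝ) : 1 ≤ ww x := by
  have : 0 ≤ ∑ i, x i ^ 2 := Finset.sum_nonneg fun i _ => sq_nonneg _
  unfold ww; linarith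

theorem ww_pos {m : ℕ} (x : Fin m → ℝ) : 0 < ww x := lt_of_lt_of_le one_pos (ww_ge x)

theorem ww_cont {m : ℕ} : Continuous (ww : (Fin m → ℝ) → ℝ) := by unfold ww; fun_prop

theorem ww_cons {m : ℕ} (a : ℝ) (z : Fin m → ℝ) :
    ww (Fin.cons a z : Fin (m + 1) → ℝ) = a ^ 2 + ww z := by
  simp [ww, Fin.sum_univ_succ]; ring

theorem ww_norm {m : ℕ} (x : Fin m → ℝ) : 1 + ‖x‖ ^ 2 ≤ ww x := by
  unfold ww
  gcongr
  have h0 : 0 ≤ ∑ i, x i ^ 2 := Finset.sum_nonneg fun i _ => sq_nonneg _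
  rw [← Real.sqrt_le_sqrt_iff h0, Real.sqrt_sq (norm_nonneg _)]
  refine (pi_norm_le_iff_of_nonneg (Real.sqrt_nonneg _)).2 fun i => ?_
  rw [Real.norm_eq_abs]
  apply Real.abs_le_sqrt
  exact Finset.single_le_sum (f := fun i => x i ^ 2) (fun i _ => sq_nonneg _) (Finset.mem_univ i)

theorem ww_integrable {m : ℕ} (j : ℕ) (hj : m < 2 * j) :
    Integrable (fun x : Fin m → ℝ => ((ww x)⁻¹) ^ j) := by
  have h := integrable_rpow_neg_one_add_norm_sq (E := Fin m → ℝ) (μ := volume) (r := (2 * j : ℕ))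
    (by rw [Module.finrank_fin_fun]; exact_mod_cast hj)
  have hc : Continuous (fun x : Fin m → ℝ => ((ww x)⁻¹) ^ j) :=
    (ww_cont.inv₀ fun x => (ww_pos x).ne').pow j
  refine Integrable.mono' h hc.aestronglyMeasurable (Eventually.of_forall fun x => ?_)
  have h1 := ww_pos x
  rw [Real.norm_of_nonneg (by positivity)]
  have e : (-((2 * j : ℕ) : ℝ) / 2) = -(j : ℝ) := by push_cast; ring
  rw [e, Real.rpow_neg (by positivity), Real.rpow_natCast, inv_pow]
  have := ww_norm x
  gcongr

theorem cons_cont {m : ℕ} :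
    Continuous (fun q : ℝ × (Fin m → ℝ) => (Fin.cons q.1 q.2 : Fin (m + 1) → ℝ)) := by
  refine continuous_pi fun i => ?_
  refine Fin.cases ?_ (fun j => ?_) i
  · simpa using continuous_fst
  · simp only [Fin.cons_succ]; fun_prop

theorem cons_cont_right {m : ℕ} (a : ℝ) :
    Continuous (fun z : Fin m → ℝ => (Fin.cons a z : Fin (m + 1) → ℝ)) :=
  cons_cont.comp (Continuous.prodMk_right a)

theorem cons_cont_left {m : ℕ} (z : Fin m → ℝ) :
    Continuous (fun a : ℝ => (Fin.cons a z : Fin (m + 1) → ℝ)) :=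
  cons_cont.comp (Continuous.prodMk_left z)

theorem cons_mp {m : ℕ} : MeasurePreserving
    (fun q : ℝ × (Fin m → ℝ) => (Fin.cons q.1 q.2 : Fin (m + 1) → ℝ)) := by
  have := (volume_preserving_piFinSuccAbove (fun _ : Fin (m + 1) => ℝ) 0).symm
  convert this using 1
  funext q
  simp [MeasurableEquiv.piFinSuccAbove, Fin.insertNthEquiv]

theorem cons_emb {m : ℕ} : MeasurableEmbedding
    (fun q : ℝ × (Fin m → ℝ) => (Fin.cons q.1 q.2 : Fin (m + 1) → ℝ)) := by
  have := (MeasurableEquiv.piFinSuccAbove (fun _ : Fin (m + 1) => ℝ) 0).symm.measurableEmbedding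
  convert this using 1
  funext q
  simp [MeasurableEquiv.piFinSuccAbove, Fin.insertNthEquiv]

theorem lintegral_cons {m : ℕ} (F : (Fin (m + 1) → ℝ) → ENNReal) (hF : Measurable F) :
    ∫⁻ x, F x = ∫⁻ a : ℝ, ∫⁻ z : Fin m → ℝ, F (Fin.cons a z) := by
  rw [← cons_mp.lintegral_comp_emb cons_emb, Measure.volume_eq_prod, lintegral_prod]
  exact (hF.comp cons_cont.measurable).aemeasurable

theorem integral_cons {m : ℕ} (F : (Fin (m + 1) → ℝ) → ℝ) (hF : Integrable F) :
    Integrable (fun a : ℝ => ∫ z : Fin m → ℝ, F (Fin.cons a z)) ∧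
    ∫ x, F x = ∫ a : ℝ, ∫ z : Fin m → ℝ, F (Fin.cons a z) := by
  have h1 : Integrable (fun q : ℝ × (Fin m → ℝ) => F (Fin.cons q.1 q.2)) (volume.prod volume) :=
    (cons_mp.integrable_comp_emb cons_emb).2 hF
  refine ⟨h1.integral_prod_left, ?_⟩
  rw [← cons_mp.integral_comp cons_emb, Measure.volume_eq_prod, integral_prod _ h1]

structure NPhi (m : ℕ) (φ : (Fin m → ℝ) → ℝ) (D : Fin m → (Fin m → ℝ) → ℝ) : Prop where
  cont : Continuous φ
  contD : ∀ i, Continuous (D i)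
  deriv : ∀ i x, HasDerivAt (fun t => φ (Function.update x i t)) (D i x) (x i)
  bd : ∃ c > 0, ∃ C > 0, ∀ x, c * ww x ≤ φ x ∧ φ x ≤ C * ww x ∧ ∀ i, D i x ^ 2 ≤ C * ww x

structure NPsi (m : ℕ) (ψ : (Fin m → ℝ) → ℝ) : Prop where
  cont : Continuous ψ
  bd : ∃ c > 0, ∃ C > 0, ∀ x, c * ww x ≤ ψ x ∧ ψ x ≤ C * ww x

theorem NPhi.toPsi {m : ℕ} {φ : (Fin m → ℝ) → ℝ} {D} (h : NPhi m φ D) : NPsi m φ := by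
  obtain ⟨c, hc, C, hC, hb⟩ := h.bd
  exact ⟨h.cont, c, hc, C, hC, fun x => ⟨(hb x).1, (hb x).2.1⟩⟩

theorem NPsi.pos {m : ℕ} {ψ : (Fin m → ℝ) → ℝ} (h : NPsi m ψ) (x) : 0 < ψ x := by
  obtain ⟨c, hc, C, hC, hb⟩ := h.bd
  exact lt_of_lt_of_le (mul_pos hc (ww_pos x)) (hb x).1

theorem NPsi.inv_cont {m : ℕ} {ψ : (Fin m → ℝ) → ℝ} (h : NPsi m ψ) :
    Continuous (fun x => (ψ x)⁻¹) := h.cont.inv₀ fun x => (h.pos x).ne'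

theorem NPsi.integrable {m : ℕ} {ψ : (Fin m → ℝ) → ℝ} (h : NPsi m ψ) (j : ℕ) (hj : m < 2 * j) :
    Integrable (fun x => ((ψ x)⁻¹) ^ j) := by
  obtain ⟨c, hc, C, hC, hb⟩ := h.bd
  refine Integrable.mono' ((ww_integrable j hj).const_mul ((c⁻¹) ^ j))
    (h.inv_cont.pow j).aestronglyMeasurable (Eventually.of_forall fun x => ?_)
  have := h.pos x
  rw [Real.norm_of_nonneg (by positivity)]
  exact inv_pow_le_aux hc (ww_pos x) (hb x).1 j

theorem ww_cons_le {m : ℕ} (a : ℝ) (z : Fin m → ℝ) :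
    ww (Fin.cons a z : Fin (m + 1) → ℝ) ≤ (1 + a ^ 2) * ww z := by
  rw [ww_cons]; nlinarith [ww_ge z, sq_nonneg a]

theorem ww_cons_ge {m : ℕ} (a : ℝ) (z : Fin m → ℝ) :
    ww z ≤ ww (Fin.cons a z : Fin (m + 1) → ℝ) := by
  rw [ww_cons]; nlinarith [sq_nonneg a]

theorem ww_cons_ge' {m : ℕ} (a : ℝ) (z : Fin m → ℝ) :
    1 + a ^ 2 ≤ ww (Fin.cons a z : Fin (m + 1) → ℝ) := by
  rw [ww_cons]; nlinarith [ww_ge z]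

theorem NPsi.slice {m : ℕ} {ψ : (Fin (m + 1) → ℝ) → ℝ} (h : NPsi (m + 1) ψ) (a t : ℝ) (ht : 0 < t) :
    NPsi m (fun z => t * ψ (Fin.cons a z)) := by
  obtain ⟨c, hc, C, hC, hb⟩ := h.bd
  refine ⟨(h.cont.comp (cons_cont_right a)).const_mul t, t * c, by positivity,
    t * (C * (1 + a ^ 2)), by positivity, fun z => ⟨?_, ?_⟩⟩
  · rw [mul_assoc]
    gcongr
    exact le_trans (by gcongr; exact ww_cons_ge a z) (hb _).1
  · rw [mul_assoc, mul_assoc]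
    gcongr
    exact le_trans (hb _).2 (by gcongr; exact ww_cons_le a z)

theorem NPhi.slice {m : ℕ} {φ : (Fin (m + 1) → ℝ) → ℝ} {D} (h : NPhi (m + 1) φ D) (a : ℝ) :
    NPhi m (fun z => φ (Fin.cons a z)) (fun i z => D i.succ (Fin.cons a z)) := by
  obtain ⟨c, hc, C, hC, hb⟩ := h.bd
  refine ⟨h.cont.comp (cons_cont_right a), fun i => (h.contD _).comp (cons_cont_right a), ?_,
    c, by positivity, (C * (1 + a ^ 2)), by positivity, fun z => ⟨?_, ?_, fun i => ?_⟩⟩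
  · intro i x
    have := h.deriv i.succ (Fin.cons a x)
    simpa [Fin.cons_update] using this
  · exact le_trans (by gcongr; exact ww_cons_ge a z) (hb _).1
  · rw [mul_assoc]
    exact le_trans (hb _).2.1 (by gcongr; exact ww_cons_le a z)
  · rw [mul_assoc]
    exact le_trans ((hb _).2.2 _) (by gcongr; exact ww_cons_le a z)

/-- marginal facts -/
theorem NPsi.marginal {m : ℕ} {ψ : (Fin (m + 1) → ℝ) → ℝ} (h : NPsi (m + 1) ψ) (n : ℕ)
    (hn : m + 1 < 2 * n) :
    Continuous (fun a : ℝ => ∫ z : Fin m → ℝ, ((ψ (Fin.cons a z))⁻¹) ^ n) ∧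
    (∃ c1 > 0, ∀ a : ℝ, c1 * ((1 + a ^ 2)⁻¹) ^ n ≤ ∫ z : Fin m → ℝ, ((ψ (Fin.cons a z))⁻¹) ^ n) ∧
    Integrable (fun a : ℝ => ∫ z : Fin m → ℝ, ((ψ (Fin.cons a z))⁻¹) ^ n) ∧
    ∫ x, ((ψ x)⁻¹) ^ n = ∫ a : ℝ, ∫ z : Fin m → ℝ, ((ψ (Fin.cons a z))⁻¹) ^ n := by
  obtain ⟨c, hc, C, hC, hb⟩ := h.bd
  refine ⟨?_, ?_, (integral_cons _ (h.integrable n hn)).1, (integral_cons _ (h.integrable n hn)).2⟩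
  · refine continuous_of_dominated (bound := fun z => (c⁻¹) ^ n * ((ww z)⁻¹) ^ n) ?_ ?_
      ((ww_integrable n (by omega)).const_mul _) ?_
    · intro a
      exact ((h.inv_cont.comp (cons_cont_right a)).pow n).aestronglyMeasurable
    · refine fun a => Eventually.of_forall fun z => ?_
      have := h.pos (Fin.cons a z)
      rw [Real.norm_of_nonneg (by positivity)]
      apply inv_pow_le_aux hc (ww_pos z)
      exact le_trans (by gcongr; exact ww_cons_ge a z) (hb _).1
    · exact Eventually.of_forall fun z => (h.inv_cont.comp (cons_cont_left z)).pow n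
  · have hI : 0 < ∫ z : Fin m → ℝ, ((ww z)⁻¹) ^ n := by
      rw [integral_pos_iff_support_of_nonneg]
      · have : Function.support (fun z : Fin m → ℝ => ((ww z)⁻¹) ^ n) = Set.univ := by
          ext z; have := ww_pos z; simp; intro h; linarith
        rw [this]; exact (isOpen_univ.measure_pos _ Set.univ_nonempty)
      · intro z; have := ww_pos z; simp only [Pi.zero_apply]; positivity
      · exact ww_integrable n (by omega)
    refine ⟨(C⁻¹) ^ n * ∫ z : Fin m → ℝ, ((ww z)⁻¹) ^ n, by positivity, fun a => ?_⟩
    rw [mul_right_comm, ← integral_const_mul]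
    have hs := h.slice a 1 one_pos
    simp only [one_mul] at hs
    refine integral_mono ((ww_integrable n (by omega)).const_mul _) (hs.integrable n (by omega)) ?_
    intro z
    have h1 := h.pos (Fin.cons a z)
    have h2 := ww_pos z
    have h3 : 0 < 1 + a ^ 2 := by positivity
    simp only
    rw [← mul_pow, ← mul_pow, ← mul_inv, ← mul_inv]
    have : ψ (Fin.cons a z) ≤ C * (1 + a ^ 2) * ww z := by
      rw [mul_assoc]
      exact le_trans (hb _).2 (by gcongr; exact ww_cons_le a z)
    gcongr

theorem amgm_aux (k : ℕ) (s τ : ℝ) (hs : 0 < s) (hτ : 0 < τ) :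
    ((k:ℝ) + 1) * (s ^ k * τ) ^ ((1:ℝ) / (k + 1)) ≤ k * s + τ := by
  have hk : (0:ℝ) < (k:ℝ) + 1 := by positivity
  have h := Real.geom_mean_le_arith_mean2_weighted (w₁ := (k:ℝ) / (k + 1)) (w₂ := 1 / ((k:ℝ) + 1))
    (p₁ := s) (p₂ := τ) (by positivity) (by positivity) hs.le hτ.le (by field_simp)
  have e : (s ^ k * τ) ^ ((1:ℝ) / (k + 1)) = s ^ ((k:ℝ) / (k + 1)) * τ ^ (1 / ((k:ℝ) + 1)) := by
    rw [Real.mul_rpow (by positivity) hτ.le, ← Real.rpow_natCast s k, ← Real.rpow_mul hs.le]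
    congr 2; field_simp
  rw [e]
  calc _ ≤ ((k:ℝ) + 1) * ((k:ℝ) / (k + 1) * s + 1 / ((k:ℝ) + 1) * τ) := by gcongr
    _ = _ := by field_simp

theorem pow_aux1 (n : ℕ) (hn : 3 ≤ n) (τ : ℝ) (hτ : 0 < τ) :
    ((τ ^ (-(1:ℝ) / n))⁻¹) ^ n = τ := by
  have : (n:ℝ) ≠ 0 := by positivity
  rw [← Real.rpow_neg hτ.le, ← Real.rpow_natCast, ← Real.rpow_mul hτ.le]
  convert Real.rpow_one τ using 2
  field_simp

theorem pow_aux2 (n k : ℕ) (hn : 3 ≤ n) (s τ : ℝ) (hs : 0 < s) (hτ : 0 < τ) :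
    ((s ^ k * τ) ^ ((1:ℝ) / (k + 1))) ^ (((k + 1 : ℕ) : ℝ) / n) * ((τ ^ (-(1:ℝ) / n))⁻¹) ^ (n - 1)
      = s ^ ((k:ℝ) / n) * τ := by
  have hn0 : (n:ℝ) ≠ 0 := by positivity
  have hk : (0:ℝ) < (k:ℝ) + 1 := by positivity
  rw [← Real.rpow_neg hτ.le, ← Real.rpow_natCast _ (n - 1), ← Real.rpow_mul hτ.le,
    ← Real.rpow_mul (by positivity), Real.mul_rpow (by positivity) hτ.le,
    ← Real.rpow_natCast s k, ← Real.rpow_mul hs.le, mul_assoc, ← Real.rpow_add hτ]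
  congr 1
  · congr 1; push_cast; field_simp
  · convert Real.rpow_one τ using 2
    rw [Nat.cast_sub (by omega)]; push_cast; field_simp; ring

theorem meas_slice {m : ℕ} (F : (Fin (m + 1) → ℝ) → ℝ) (hF : Continuous F) :
    Measurable (fun a : ℝ => ∫⁻ z : Fin m → ℝ, ENNReal.ofReal (F (Fin.cons a z))) := by
  have : Measurable (fun q : ℝ × (Fin m → ℝ) => ENNReal.ofReal (F (Fin.cons q.1 q.2))) :=
    (hF.comp cons_cont).measurable.ennreal_ofReal
  exact this.lintegral_prod_right'

theorem claim_step_ibp (n m : ℕ) (hn : 3 ≤ n) (A B : ℝ) (hA : 0 < A) (hB : 0 < B)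
    (hAB : 4 * A * B = ((n:ℝ) - 1) ^ 2) (hmn : m + 1 ≤ n)
    (φ : (Fin (m + 1) → ℝ) → ℝ) (D) (ψ : (Fin (m + 1) → ℝ) → ℝ)
    (hφ : NPhi (m + 1) φ D) (hψ : NPsi (m + 1) ψ) (T T' : ℝ → ℝ)
    (hTm : StrictMono T) (hTs : Function.Surjective T) (hTd : ∀ x, HasDerivAt T (T' x) x)
    (hT'c : Continuous T') (hT0 : ∀ x, 0 < T' x)
    (hTpq : ∀ a, ∫ z : Fin m → ℝ, ((φ (Fin.cons a z))⁻¹) ^ n =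
      T' a * ∫ z : Fin m → ℝ, ((ψ (Fin.cons (T a) z))⁻¹) ^ n) :
    ∫⁻ a : ℝ, ENNReal.ofReal (T' a) *
        ∫⁻ z : Fin m → ℝ, ENNReal.ofReal (((φ (Fin.cons a z))⁻¹) ^ (n - 1)) ≤
      (∫⁻ a : ℝ, ∫⁻ z : Fin m → ℝ,
        ENNReal.ofReal (A * ((φ (Fin.cons a z))⁻¹) ^ n * D 0 (Fin.cons a z) ^ 2)) +
      ∫⁻ a : ℝ, ∫⁻ z : Fin m → ℝ, ENNReal.ofReal (B * (((ψ (Fin.cons a z))⁻¹) ^ n * a ^ 2)) := by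
  have hφ' := hφ.toPsi
  obtain ⟨hpc, ⟨c1, hc1, hplow⟩, hpi, -⟩ := hφ'.marginal n (by omega)
  obtain ⟨hqc, -, hqi, -⟩ := hψ.marginal n (by omega)
  have hTc : Continuous T := continuous_iff_continuousAt.2 fun x => (hTd x).continuousAt
  set p : ℝ → ℝ := fun a => ∫ z : Fin m → ℝ, ((φ (Fin.cons a z))⁻¹) ^ n with hp
  set q : ℝ → ℝ := fun a => ∫ z : Fin m → ℝ, ((ψ (Fin.cons a z))⁻¹) ^ n with hq
  have hTpq' : ∀ a, p a = T' a * q (T a) := hTpq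
  have hp0 : ∀ a, 0 ≤ p a := fun a => integral_nonneg fun z => by
    have := hφ'.pos (Fin.cons a z); simp only [Pi.zero_apply]; positivity
  have hq0 : ∀ a, 0 ≤ q a := fun a => integral_nonneg fun z => by
    have := hψ.pos (Fin.cons a z); simp only [Pi.zero_apply]; positivity
  have hφs : ∀ a, Integrable (fun z : Fin m → ℝ => ((φ (Fin.cons a z))⁻¹) ^ n) := fun a =>
    (hφ.slice a).toPsi.integrable n (by omega)
  have hψs : ∀ a, Integrable (fun z : Fin m → ℝ => ((ψ (Fin.cons a z))⁻¹) ^ n) := fun a => by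
    have := (hψ.slice a 1 one_pos).integrable n (by omega)
    simpa using this
  -- the moment of the target
  have hmomq : ∀ b : ℝ, ∫⁻ z : Fin m → ℝ, ENNReal.ofReal (B * (((ψ (Fin.cons b z))⁻¹) ^ n * b ^ 2))
      = ENNReal.ofReal (B * (q b * b ^ 2)) := by
    intro b
    rw [← ofReal_integral_eq_lintegral_ofReal, integral_const_mul, integral_mul_const]
    · exact ((hψs b).mul_const _).const_mul _
    · refine Eventually.of_forall fun z => ?_
      have := hψ.pos (Fin.cons b z); simp only [Pi.zero_apply]; positivity
  have hmomp : ∀ a : ℝ, ∫⁻ z : Fin m → ℝ, ENNReal.ofReal (B * (((φ (Fin.cons a z))⁻¹) ^ n * T a ^ 2))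
      = ENNReal.ofReal (B * (p a * T a ^ 2)) := by
    intro b
    rw [← ofReal_integral_eq_lintegral_ofReal, integral_const_mul, integral_mul_const]
    · exact ((hφs b).mul_const _).const_mul _
    · refine Eventually.of_forall fun z => ?_
      have := hφ'.pos (Fin.cons b z); simp only [Pi.zero_apply]; positivity
  have hmom : ∫⁻ a, ENNReal.ofReal (B * (p a * T a ^ 2)) = ∫⁻ b, ENNReal.ofReal (B * (q b * b ^ 2)) := by
    rw [cov1D T T' hTm hTs hTd (fun x => (hT0 x).le) (fun b => ENNReal.ofReal (B * (q b * b ^ 2)))]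
    refine lintegral_congr fun a => ?_
    rw [← ENNReal.ofReal_mul (hT0 a).le, hTpq']
    congr 1; ring
  have hfin : ∫⁻ b, ENNReal.ofReal (B * (q b * b ^ 2)) ≠ ⊤ := by
    obtain ⟨c, hc, C, hC, hb⟩ := hψ.bd
    have hi := ((ww_integrable (m := m + 1) (n - 1) (by omega)).const_mul (B * (c⁻¹) ^ n))
    refine ne_top_of_le_ne_top hi.lintegral_lt_top.ne ?_
    rw [lintegral_cons]
    · refine lintegral_mono fun b => ?_
      rw [← hmomq]
      refine lintegral_mono fun z => ENNReal.ofReal_le_ofReal ?_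
      have h1 := inv_pow_le_aux hc (ww_pos _) (hb (Fin.cons b z)).1 n
      have h2 : b ^ 2 ≤ ww (Fin.cons b z : Fin (m + 1) → ℝ) := by
        have := ww_cons_ge' b z; linarith
      have h3 := ww_pos (Fin.cons b z : Fin (m + 1) → ℝ)
      have h4 := hψ.pos (Fin.cons b z)
      calc _ ≤ B * (((c⁻¹) ^ n * ((ww (Fin.cons b z : Fin (m + 1) → ℝ))⁻¹) ^ n) *
            ww (Fin.cons b z : Fin (m + 1) → ℝ)) := by gcongr
        _ = _ := by
          obtain ⟨j, rfl⟩ : ∃ j, n = j + 1 := ⟨n - 1, by omega⟩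
          simp only [Nat.add_sub_cancel, pow_succ]
          field_simp
    · exact (((ww_cont.inv₀ fun x => (ww_pos x).ne').pow _).const_mul _).measurable.ennreal_ofReal
  have hpT : Integrable (fun a => p a * T a ^ 2) := by
    have : Integrable (fun a => B * (p a * T a ^ 2)) := by
      refine (lintegral_ofReal_ne_top_iff_integrable ?_ ?_).1 ?_
      · exact ((hpc.mul (hTc.pow 2)).const_mul B).aestronglyMeasurable
      · refine Eventually.of_forall fun a => ?_
        have := hp0 a; simp only [Pi.zero_apply]; positivity
      · rw [hmom]; exact hfin
    have h2 := this.const_mul B⁻¹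
    refine h2.congr (Eventually.of_forall fun a => ?_)
    simp only; field_simp
  -- the integration by parts
  have hφcons : Continuous (fun q : ℝ × (Fin m → ℝ) => (φ (Fin.cons q.1 q.2))⁻¹) :=
    hφ'.inv_cont.comp cons_cont
  have hDcons : Continuous (fun q : ℝ × (Fin m → ℝ) => D 0 (Fin.cons q.1 q.2)) :=
    (hφ.contD 0).comp cons_cont
  have key : ∀ z : Fin m → ℝ, ∫⁻ a, ENNReal.ofReal (T' a * ((φ (Fin.cons a z))⁻¹) ^ (n - 1)) ≤
      ∫⁻ a, ENNReal.ofReal (A * ((φ (Fin.cons a z))⁻¹) ^ n * (D 0 (Fin.cons a z)) ^ 2 +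
        B * (((φ (Fin.cons a z))⁻¹) ^ n * T a ^ 2)) := by
    intro z
    obtain ⟨c, hc, C, hC, hb⟩ := hφ.bd
    refine ibp_main n hn (fun a => φ (Fin.cons a z)) (fun a => D 0 (Fin.cons a z)) p T T'
      c (C * ww z) c1 A B hc hc1 hA hB hAB ?_ ((hφ.contD 0).comp (cons_cont_left z)) hT'c hTd
      (fun x => (hT0 x).le) ?_ ?_ hplow hpT
    · intro a
      have := hφ.deriv 0 (Fin.cons a z)
      simpa [Fin.update_cons_zero] using this
    · intro a
      refine le_trans ?_ (hb _).1
      gcongr; exact ww_cons_ge' a z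
    · intro a
      refine ((hb _).2.2 0).trans ?_
      rw [mul_assoc, mul_comm (ww z)]
      gcongr; exact ww_cons_le a z
  calc _ = ∫⁻ a : ℝ, ∫⁻ z : Fin m → ℝ, ENNReal.ofReal (T' a * ((φ (Fin.cons a z))⁻¹) ^ (n - 1)) := by
        refine lintegral_congr fun a => ?_
        rw [← lintegral_const_mul' _ _ ENNReal.ofReal_ne_top]
        refine lintegral_congr fun z => ?_
        rw [ENNReal.ofReal_mul (hT0 a).le]
    _ = ∫⁻ z : Fin m → ℝ, ∫⁻ a : ℝ, ENNReal.ofReal (T' a * ((φ (Fin.cons a z))⁻¹) ^ (n - 1)) := by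
        rw [lintegral_lintegral_swap]
        refine (Measurable.ennreal_ofReal (Continuous.measurable ?_)).aemeasurable
        exact (hT'c.comp continuous_fst).mul (hφcons.pow _)
    _ ≤ ∫⁻ z : Fin m → ℝ, ∫⁻ a, ENNReal.ofReal (A * ((φ (Fin.cons a z))⁻¹) ^ n * (D 0 (Fin.cons a z)) ^ 2 +
        B * (((φ (Fin.cons a z))⁻¹) ^ n * T a ^ 2)) := lintegral_mono key
    _ = ∫⁻ a : ℝ, ∫⁻ z : Fin m → ℝ, ENNReal.ofReal (A * ((φ (Fin.cons a z))⁻¹) ^ n * (D 0 (Fin.cons a z)) ^ 2 +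
        B * (((φ (Fin.cons a z))⁻¹) ^ n * T a ^ 2)) := by
        rw [lintegral_lintegral_swap]
        refine (Measurable.ennreal_ofReal (Continuous.measurable ?_)).aemeasurable
        have h1 : Continuous (fun q : (Fin m → ℝ) × ℝ => (φ (Fin.cons q.2 q.1))⁻¹) :=
          hφcons.comp continuous_swap
        have h2 : Continuous (fun q : (Fin m → ℝ) × ℝ => D 0 (Fin.cons q.2 q.1)) :=
          hDcons.comp continuous_swap
        exact (((h1.pow n).const_mul A).mul (h2.pow 2)).add
          (((h1.pow n).mul ((hTc.comp continuous_snd).pow 2)).const_mul B)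
    _ = ∫⁻ a : ℝ, ((∫⁻ z : Fin m → ℝ, ENNReal.ofReal (A * ((φ (Fin.cons a z))⁻¹) ^ n * (D 0 (Fin.cons a z)) ^ 2)) +
        ENNReal.ofReal (B * (p a * T a ^ 2))) := by
        refine lintegral_congr fun a => ?_
        rw [← hmomp, ← lintegral_add_left]
        · refine lintegral_congr fun z => ?_
          have := hφ'.pos (Fin.cons a z)
          rw [ENNReal.ofReal_add (by positivity) (by positivity)]
        · refine Measurable.ennreal_ofReal (Continuous.measurable ?_)
          have h1 := hφcons.comp (Continuous.prodMk_right a)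
          have h2 := hDcons.comp (Continuous.prodMk_right a)
          exact ((h1.pow n).const_mul A).mul (h2.pow 2)
    _ = _ := by
        rw [lintegral_add_left, hmom]
        · simp only [hmomq]
        · refine meas_slice (fun x => A * ((φ x)⁻¹) ^ n * (D 0 x) ^ 2) ?_
          exact ((hφ'.inv_cont.pow n).const_mul A).mul ((hφ.contD 0).pow 2)

theorem claim (n : ℕ) (hn : 3 ≤ n) (A B : ℝ) (hA : 0 < A) (hB : 0 < B)
    (hAB : 4 * A * B = ((n:ℝ) - 1) ^ 2) : ∀ m k : ℕ, n = k + m →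
    ∀ (φ : (Fin m → ℝ) → ℝ) (D) (ψ : (Fin m → ℝ) → ℝ), NPhi m φ D → NPsi m ψ →
    ∫ x, ((φ x)⁻¹) ^ n = ∫ x, ((ψ x)⁻¹) ^ n → ∀ s : ℝ, 0 < s →
    ENNReal.ofReal (n * s ^ ((k:ℝ) / n)) * ∫⁻ x, ENNReal.ofReal (((ψ x)⁻¹) ^ (n - 1)) ≤
      ENNReal.ofReal (k * s) * (∫⁻ x, ENNReal.ofReal (((φ x)⁻¹) ^ (n - 1))) +
      (∫⁻ x, ENNReal.ofReal (A * ((φ x)⁻¹) ^ n * ∑ i, D i x ^ 2)) +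
      ∫⁻ x, ENNReal.ofReal (B * (((ψ x)⁻¹) ^ n * ∑ i, x i ^ 2)) := by
  intro m
  induction m with
  | zero =>
    intro k hk φ D ψ hφ hψ hI s hs
    have hkn : k = n := by omega
    subst hkn
    have hv : (volume : Measure (Fin 0 → ℝ)) Set.univ = 1 := by
      simp [volume_pi]
    have hk0 : (k:ℝ) ≠ 0 := by positivity
    rw [integral_unique, integral_unique] at hI
    simp only [Measure.real, hv, ENNReal.toReal_one, one_smul] at hI
    have h4 : ∀ x : Fin 0 → ℝ, (φ x)⁻¹ = (ψ x)⁻¹ := fun x => by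
      rw [Subsingleton.elim (@default (Fin 0 → ℝ) Unique.instInhabited) x] at hI
      have h1 := hφ.toPsi.pos x
      have h2 := hψ.pos x
      exact (pow_left_inj₀ (by positivity) (by positivity) (show k ≠ 0 by omega)).1 hI
    simp only [lintegral_unique, hv, mul_one, div_self hk0, Real.rpow_one, h4]
    rw [add_assoc]
    exact le_self_add
  | succ m ih =>
    intro k hk φ D ψ hφ hψ hI s hs
    have hφ' := hφ.toPsi
    obtain ⟨hpc, ⟨c1, hc1, hplow⟩, hpi, hpI⟩ := hφ'.marginal n (by omega)
    obtain ⟨hqc, ⟨c2, hc2, hqlow⟩, hqi, hqI⟩ := hψ.marginal n (by omega)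
    have hp0 : ∀ a, 0 < ∫ z : Fin m → ℝ, ((φ (Fin.cons a z))⁻¹) ^ n := fun a =>
      lt_of_lt_of_le (by positivity) (hplow a)
    have hq0 : ∀ a, 0 < ∫ z : Fin m → ℝ, ((ψ (Fin.cons a z))⁻¹) ^ n := fun a =>
      lt_of_lt_of_le (by positivity) (hqlow a)
    rw [hpI, hqI] at hI
    obtain ⟨T, hTm, hTs, hTc, hTd⟩ := transport1D _ _ hpc hqc hp0 hq0 hpi hqi hI
    obtain ⟨T', hT'⟩ : ∃ T' : ℝ → ℝ, T' = fun a => (∫ z : Fin m → ℝ, ((φ (Fin.cons a z))⁻¹) ^ n) /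
      (∫ z : Fin m → ℝ, ((ψ (Fin.cons (T a) z))⁻¹) ^ n) := ⟨_, rfl⟩
    have hTd' : ∀ x, HasDerivAt T (T' x) x := by subst hT'; exact hTd
    have hT0 : ∀ x, 0 < T' x := by intro x; rw [hT']; exact div_pos (hp0 _) (hq0 _)
    have hT'c : Continuous T' := by
      rw [hT']; exact hpc.div (hqc.comp hTc) fun a => (hq0 _).ne'
    have hTpq : ∀ a, ∫ z : Fin m → ℝ, ((φ (Fin.cons a z))⁻¹) ^ n =
        T' a * ∫ z : Fin m → ℝ, ((ψ (Fin.cons (T a) z))⁻¹) ^ n := by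
      intro a; rw [hT']; have := (hq0 (T a)).ne'; simp only; rw [div_mul_cancel₀ _ this]
    have hibp := claim_step_ibp n m hn A B hA hB hAB (by omega) φ D ψ hφ hψ T T' hTm hTs hTd' hT'c hT0 hTpq
    -- continuity facts
    have hψpc : ∀ j, Continuous (fun x => ((ψ x)⁻¹) ^ j) := fun j => hψ.inv_cont.pow j
    have hφpc : ∀ j, Continuous (fun x => ((φ x)⁻¹) ^ j) := fun j => hφ'.inv_cont.pow j
    -- slice inequality
    have hslice : ∀ a : ℝ, ENNReal.ofReal (n * s ^ ((k:ℝ) / n)) *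
        (ENNReal.ofReal (T' a) * ∫⁻ z : Fin m → ℝ, ENNReal.ofReal (((ψ (Fin.cons (T a) z))⁻¹) ^ (n - 1))) ≤
        ENNReal.ofReal (k * s) * (∫⁻ z : Fin m → ℝ, ENNReal.ofReal (((φ (Fin.cons a z))⁻¹) ^ (n - 1))) +
        ENNReal.ofReal (T' a) * (∫⁻ z : Fin m → ℝ, ENNReal.ofReal (((φ (Fin.cons a z))⁻¹) ^ (n - 1))) +
        (∫⁻ z : Fin m → ℝ, ENNReal.ofReal (A * ((φ (Fin.cons a z))⁻¹) ^ n *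
          ∑ i : Fin m, D i.succ (Fin.cons a z) ^ 2)) +
        ENNReal.ofReal (T' a) * ∫⁻ z : Fin m → ℝ,
          ENNReal.ofReal (B * (((ψ (Fin.cons (T a) z))⁻¹) ^ n * ∑ i, z i ^ 2)) := by
      intro a
      have ht := hT0 a
      have ht2 : 0 < T' a ^ (-(1:ℝ) / n) := Real.rpow_pos_of_pos ht _
      have h := ih (k + 1) (by omega) _ _ _ (hφ.slice a) (hψ.slice (T a) (T' a ^ (-(1:ℝ) / n)) ht2)
        (by
          rw [hTpq, ← integral_const_mul]
          congr 1; funext z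
          rw [mul_inv, mul_pow, pow_aux1 n hn _ ht])
        ((s ^ k * T' a) ^ ((1:ℝ) / (k + 1))) (by positivity)
      have e1 : ENNReal.ofReal (n * ((s ^ k * T' a) ^ ((1:ℝ) / (k + 1))) ^ (((k + 1 : ℕ) : ℝ) / n)) *
          ∫⁻ z : Fin m → ℝ, ENNReal.ofReal (((T' a ^ (-(1:ℝ) / n) * ψ (Fin.cons (T a) z))⁻¹) ^ (n - 1)) =
          ENNReal.ofReal (n * s ^ ((k:ℝ) / n)) *
        (ENNReal.ofReal (T' a) * ∫⁻ z : Fin m → ℝ, ENNReal.ofReal (((ψ (Fin.cons (T a) z))⁻¹) ^ (n - 1))) := by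
        have : ∀ z : Fin m → ℝ, ENNReal.ofReal (((T' a ^ (-(1:ℝ) / n) * ψ (Fin.cons (T a) z))⁻¹) ^ (n - 1))
            = ENNReal.ofReal (((T' a ^ (-(1:ℝ) / n))⁻¹) ^ (n - 1)) *
              ENNReal.ofReal (((ψ (Fin.cons (T a) z))⁻¹) ^ (n - 1)) := by
          intro z
          rw [mul_inv, mul_pow, ENNReal.ofReal_mul (by positivity)]
        simp only [this]
        rw [lintegral_const_mul' _ _ ENNReal.ofReal_ne_top, ← mul_assoc, ← mul_assoc,
          ← ENNReal.ofReal_mul (by positivity), ← ENNReal.ofReal_mul (by positivity),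
          mul_assoc (n:ℝ), pow_aux2 n k hn s _ hs ht, mul_assoc (n:ℝ)]
      have e2 : ∫⁻ z : Fin m → ℝ, ENNReal.ofReal
          (B * (((T' a ^ (-(1:ℝ) / n) * ψ (Fin.cons (T a) z))⁻¹) ^ n * ∑ i, z i ^ 2)) =
          ENNReal.ofReal (T' a) * ∫⁻ z : Fin m → ℝ,
          ENNReal.ofReal (B * (((ψ (Fin.cons (T a) z))⁻¹) ^ n * ∑ i, z i ^ 2)) := by
        rw [← lintegral_const_mul' _ _ ENNReal.ofReal_ne_top]
        refine lintegral_congr fun z => ?_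
        rw [← ENNReal.ofReal_mul ht.le, mul_inv, mul_pow, pow_aux1 n hn _ ht]
        congr 1; ring
      rw [e1, e2] at h
      refine h.trans ?_
      gcongr
      rw [← add_mul, ← ENNReal.ofReal_add (by positivity) ht.le]
      gcongr
      push_cast
      exact amgm_aux k s _ hs ht
    have hint := lintegral_mono (μ := (volume : Measure ℝ)) hslice
    rw [lintegral_const_mul' _ _ ENNReal.ofReal_ne_top,
      ← cov1D T T' hTm hTs hTd' (fun x => (hT0 x).le)
        (fun b => ∫⁻ z : Fin m → ℝ, ENNReal.ofReal (((ψ (Fin.cons b z))⁻¹) ^ (n - 1))),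
      ← lintegral_cons (fun x => ENNReal.ofReal (((ψ x)⁻¹) ^ (n - 1)))
        (hψpc _).measurable.ennreal_ofReal] at hint
    refine hint.trans ?_
    have mH := meas_slice _ (hφpc (n - 1))
    have cA : Continuous (fun x => A * ((φ x)⁻¹) ^ n * ∑ i : Fin m, D i.succ x ^ 2) :=
      ((hφpc n).const_mul A).mul (continuous_finsetSum _ fun i _ => (hφ.contD _).pow 2)
    have mA := meas_slice _ cA
    have mHk := mH.const_mul (ENNReal.ofReal (k * s))
    have mHT := hT'c.measurable.ennreal_ofReal.mul mH
    rw [lintegral_add_left ?m1, lintegral_add_left ?m2, lintegral_add_left ?m3,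
      lintegral_const_mul' _ _ ENNReal.ofReal_ne_top,
      ← lintegral_cons (fun x => ENNReal.ofReal (((φ x)⁻¹) ^ (n - 1)))
        (hφpc _).measurable.ennreal_ofReal,
      ← cov1D T T' hTm hTs hTd' (fun x => (hT0 x).le)
        (fun b => ∫⁻ z : Fin m → ℝ, ENNReal.ofReal (B * (((ψ (Fin.cons b z))⁻¹) ^ n * ∑ i, z i ^ 2)))]
    case m1 => exact (mHk.add mHT).add mA
    case m2 => exact mHk.add mHT
    case m3 => exact mHk
    have cA2 : Continuous (fun x => A * ((φ x)⁻¹) ^ n * ∑ i, D i x ^ 2) :=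
      ((hφpc n).const_mul A).mul (continuous_finsetSum _ fun i _ => (hφ.contD _).pow 2)
    have cB2 : Continuous (fun x : Fin (m + 1) → ℝ => B * (((ψ x)⁻¹) ^ n * ∑ i, x i ^ 2)) := by
      have := hψpc n
      fun_prop
    have cA0 : Continuous (fun x => A * ((φ x)⁻¹) ^ n * D 0 x ^ 2) :=
      ((hφpc n).const_mul A).mul ((hφ.contD _).pow 2)
    have cB0 : Continuous (fun x : Fin (m + 1) → ℝ => B * (((ψ x)⁻¹) ^ n * x 0 ^ 2)) := by
      have := hψpc n
      fun_prop
    have E1 : ∫⁻ x, ENNReal.ofReal (A * ((φ x)⁻¹) ^ n * ∑ i, D i x ^ 2) =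
        (∫⁻ a : ℝ, ∫⁻ z : Fin m → ℝ,
          ENNReal.ofReal (A * ((φ (Fin.cons a z))⁻¹) ^ n * D 0 (Fin.cons a z) ^ 2)) +
        ∫⁻ a : ℝ, ∫⁻ z : Fin m → ℝ, ENNReal.ofReal (A * ((φ (Fin.cons a z))⁻¹) ^ n *
          ∑ i : Fin m, D i.succ (Fin.cons a z) ^ 2) := by
      rw [← lintegral_cons (fun x => ENNReal.ofReal (A * ((φ x)⁻¹) ^ n * D 0 x ^ 2))
          cA0.measurable.ennreal_ofReal,
        ← lintegral_cons (fun x => ENNReal.ofReal (A * ((φ x)⁻¹) ^ n * ∑ i : Fin m, D i.succ x ^ 2))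
          cA.measurable.ennreal_ofReal, ← lintegral_add_left cA0.measurable.ennreal_ofReal]
      refine lintegral_congr fun x => ?_
      have := hφ'.pos x
      rw [← ENNReal.ofReal_add (by positivity) (by positivity), Fin.sum_univ_succ, mul_add]
    have E2 : ∫⁻ x : Fin (m + 1) → ℝ, ENNReal.ofReal (B * (((ψ x)⁻¹) ^ n * ∑ i, x i ^ 2)) =
        (∫⁻ a : ℝ, ∫⁻ z : Fin m → ℝ, ENNReal.ofReal (B * (((ψ (Fin.cons a z))⁻¹) ^ n * a ^ 2))) +
        ∫⁻ a : ℝ, ∫⁻ z : Fin m → ℝ,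
          ENNReal.ofReal (B * (((ψ (Fin.cons a z))⁻¹) ^ n * ∑ i, z i ^ 2)) := by
      have mB0 := meas_slice _ cB0
      simp only [Fin.cons_zero] at mB0
      rw [lintegral_cons _ cB2.measurable.ennreal_ofReal, ← lintegral_add_left mB0]
      refine lintegral_congr fun a => ?_
      rw [← lintegral_add_left]
      · refine lintegral_congr fun z => ?_
        have := hψ.pos (Fin.cons a z)
        rw [← ENNReal.ofReal_add (by positivity) (by positivity), Fin.sum_univ_succ]
        simp only [Fin.cons_zero, Fin.cons_succ]
        congr 1; ring
      · have := cB0.comp (cons_cont_right (m := m) a)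
        simp only [Function.comp_def, Fin.cons_zero] at this
        exact this.measurable.ennreal_ofReal
    rw [E1, E2]
    refine (add_le_add (add_le_add (add_le_add le_rfl hibp) le_rfl) le_rfl).trans (le_of_eq ?_)
    ring

theorem gauss_pi (m : ℕ) (t : ℝ) (ht : 0 < t) :
    ∫⁻ x : Fin m → ℝ, ENNReal.ofReal (Real.exp (-t * ∑ i, x i ^ 2)) =
      ENNReal.ofReal ((Real.pi / t) ^ ((m:ℝ) / 2)) := by
  have e : ∀ x : Fin m → ℝ, Real.exp (-t * ∑ i, x i ^ 2) = ∏ i, Real.exp (-t * x i ^ 2) := by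
    intro x; rw [Finset.mul_sum, Real.exp_sum]
  simp only [e]
  rw [← ofReal_integral_eq_lintegral_ofReal]
  · rw [integral_fintype_prod_volume_eq_pow (fun y : ℝ => Real.exp (-t * y ^ 2)), integral_gaussian,
      Fintype.card_fin, Real.sqrt_eq_rpow, ← Real.rpow_natCast, ← Real.rpow_mul (by positivity)]
    congr 2; ring
  · exact Integrable.fintype_prod fun i => integrable_exp_neg_mul_sq ht
  · exact Eventually.of_forall fun x => Finset.prod_nonneg fun i _ => (Real.exp_pos _).le

theorem gammaInt (a r : ℝ) (ha : 0 < a) (hr : 0 < r) :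
    ∫⁻ t in Set.Ioi (0:ℝ), ENNReal.ofReal (t ^ (a - 1) * Real.exp (-(r * t))) =
      ENNReal.ofReal ((1 / r) ^ a * Real.Gamma a) := by
  rw [← Real.integral_rpow_mul_exp_neg_mul_Ioi ha hr, ofReal_integral_eq_lintegral_ofReal]
  · have := integrableOn_rpow_mul_exp_neg_mul_rpow (p := 1) (s := a - 1) (b := r) (by linarith) one_pos hr
    simp only [Real.rpow_one, neg_mul] at this
    exact this
  · filter_upwards [ae_restrict_mem measurableSet_Ioi] with t ht
    have : (0:ℝ) < t := ht
    positivity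

theorem ww_int_val (m j : ℕ) (hj : m < 2 * j) :
    ∫ x : Fin m → ℝ, ((ww x)⁻¹) ^ j =
      Real.pi ^ ((m:ℝ) / 2) * Real.Gamma (j - (m:ℝ) / 2) / Real.Gamma j := by
  have hj0 : (0:ℝ) < j := by exact_mod_cast (show 0 < j by omega)
  have hj1 : (0:ℝ) < j - (m:ℝ) / 2 := by
    have : (m:ℝ) < 2 * j := by exact_mod_cast hj
    linarith
  have hG := Real.Gamma_pos_of_pos hj0
  have hG1 := Real.Gamma_pos_of_pos hj1
  have hc : Continuous (fun x : Fin m → ℝ => ((ww x)⁻¹) ^ j * Real.Gamma j) :=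
    ((ww_cont.inv₀ fun x => (ww_pos x).ne').pow j).mul continuous_const
  rw [eq_div_iff hG.ne', ← integral_mul_const,
    integral_eq_lintegral_of_nonneg_ae (Eventually.of_forall fun x => by have := ww_pos x; positivity)
      hc.aestronglyMeasurable]
  have h1 : ∀ x : Fin m → ℝ, ENNReal.ofReal (((ww x)⁻¹) ^ j * Real.Gamma j) =
      ∫⁻ t in Set.Ioi (0:ℝ), ENNReal.ofReal (t ^ ((j:ℝ) - 1) * Real.exp (-(ww x * t))) := by
    intro x
    rw [gammaInt _ _ hj0 (ww_pos x), Real.rpow_natCast, one_div]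
  simp only [h1]
  rw [lintegral_lintegral_swap]
  · have h2 : ∀ t ∈ Set.Ioi (0:ℝ), ∫⁻ x : Fin m → ℝ,
        ENNReal.ofReal (t ^ ((j:ℝ) - 1) * Real.exp (-(ww x * t))) =
        ENNReal.ofReal (Real.pi ^ ((m:ℝ) / 2)) *
        ENNReal.ofReal (t ^ (((j:ℝ) - (m:ℝ) / 2) - 1) * Real.exp (-(1 * t))) := by
      intro t ht
      have ht : 0 < t := ht
      have h3 : ∀ x : Fin m → ℝ, ENNReal.ofReal (t ^ ((j:ℝ) - 1) * Real.exp (-(ww x * t))) =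
          ENNReal.ofReal (t ^ ((j:ℝ) - 1) * Real.exp (-t)) *
          ENNReal.ofReal (Real.exp (-t * ∑ i, x i ^ 2)) := by
        intro x
        rw [← ENNReal.ofReal_mul (by positivity), mul_assoc, ← Real.exp_add]
        unfold ww
        congr 3; ring
      simp only [h3]
      rw [lintegral_const_mul' _ _ ENNReal.ofReal_ne_top, gauss_pi m t ht,
        ← ENNReal.ofReal_mul (by positivity), ← ENNReal.ofReal_mul (by positivity),
        Real.div_rpow Real.pi_pos.le ht.le,
        show (j:ℝ) - m / 2 - 1 = (j - 1) - m / 2 by ring, Real.rpow_sub ht _ ((m:ℝ) / 2)]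
      congr 1
      rw [one_mul]; ring
    rw [setLIntegral_congr_fun measurableSet_Ioi h2, lintegral_const_mul' _ _ ENNReal.ofReal_ne_top,
      gammaInt _ _ hj1 one_pos, ← ENNReal.ofReal_mul (by positivity), ENNReal.toReal_ofReal]
    · simp
    · simp; positivity
  · have hw := (ww_cont (m := m)).measurable
    apply Measurable.aemeasurable
    unfold Function.uncurry
    fun_prop

theorem ww_int_ratio (n : ℕ) (hn : 3 ≤ n) :
    ∫ x : Fin n → ℝ, ((ww x)⁻¹) ^ (n - 1) =
      2 * ((n:ℝ) - 1) / (n - 2) * ∫ x : Fin n → ℝ, ((ww x)⁻¹) ^ n := by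
  have hn3 : (3:ℝ) ≤ n := by exact_mod_cast hn
  rw [ww_int_val n (n - 1) (by omega), ww_int_val n n (by omega)]
  have e1 : ((n - 1 : ℕ) : ℝ) = n - 1 := by rw [Nat.cast_sub (by omega)]; simp
  rw [e1]
  have g1 : Real.Gamma (n:ℝ) = (n - 1) * Real.Gamma ((n:ℝ) - 1) := by
    rw [← Real.Gamma_add_one (by linarith)]; congr 1; ring
  have g2 : Real.Gamma (n - (n:ℝ) / 2) = (n / 2 - 1) * Real.Gamma ((n:ℝ) - 1 - n / 2) := by
    rw [show (n:ℝ) - 1 - n / 2 = n / 2 - 1 by ring, ← Real.Gamma_add_one (by linarith)]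
    congr 1; ring
  rw [g1, g2]
  have := (Real.Gamma_pos_of_pos (show (0:ℝ) < n - 1 by linarith)).ne'
  have h3 : (n:ℝ) - 1 ≠ 0 := by linarith
  have h4 : (n:ℝ) - 2 ≠ 0 := by linarith
  field_simp

theorem Kd_eq (n : ℕ) (hn : 3 ≤ n) :
    Kd n = n * (n - 2) * (∫ x : Fin n → ℝ, ((ww x)⁻¹) ^ n) ^ ((2:ℝ) / n) := by
  have hn3 : (3:ℝ) ≤ n := by exact_mod_cast hn
  have h2 : (0:ℝ) < n - 2 := by linarith
  have hn0 : (0:ℝ) < n := by linarith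
  have hG := Real.Gamma_pos_of_pos hn0
  have hG2 := Real.Gamma_pos_of_pos (half_pos hn0)
  rw [ww_int_val n n (by omega), show (n:ℝ) - n / 2 = n / 2 by ring]
  unfold Kd Cd
  rw [mul_pow, Real.sq_sqrt (by positivity), ← Real.rpow_natCast (_ ^ _) 2, ← Real.rpow_mul (by positivity),
    mul_div_assoc, Real.mul_rpow (by positivity) (by positivity), ← Real.rpow_mul Real.pi_pos.le,
    show (n:ℝ) / 2 * (2 / n) = 1 by field_simp, Real.rpow_one,
    show (1:ℝ) / n * ((2:ℕ):ℝ) = 2 / n by push_cast; ring,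
    Real.div_rpow hG.le hG2.le, Real.div_rpow hG2.le hG.le]
  have p1 : 0 < Real.Gamma (n:ℝ) ^ ((2:ℝ) / n) := by positivity
  have p2 : 0 < Real.Gamma ((n:ℝ) / 2) ^ ((2:ℝ) / n) := by positivity
  field_simp

theorem ww_NPsi (n : ℕ) (l : ℝ) (hl : 0 < l) : NPsi n (fun x => l * ww x) :=
  ⟨continuous_const.mul ww_cont, l, hl, l, hl, fun _ => ⟨le_rfl, le_rfl⟩⟩

theorem ww_sq_int (n : ℕ) (hn : 3 ≤ n) :
    Integrable (fun x : Fin n → ℝ => ((ww x)⁻¹) ^ n * ∑ i, x i ^ 2) ∧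
    ∫ x : Fin n → ℝ, ((ww x)⁻¹) ^ n * ∑ i, x i ^ 2 =
      (n:ℝ) / (n - 2) * ∫ x : Fin n → ℝ, ((ww x)⁻¹) ^ n := by
  have hn3 : (3:ℝ) ≤ n := by exact_mod_cast hn
  have i1 := ww_integrable (m := n) (n - 1) (by omega)
  have i0 := ww_integrable (m := n) n (by omega)
  have e : (fun x : Fin n → ℝ => ((ww x)⁻¹) ^ n * ∑ i, x i ^ 2) =
      fun x => ((ww x)⁻¹) ^ (n - 1) - ((ww x)⁻¹) ^ n := by
    funext x
    have h := (ww_pos x).ne'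
    have e2 : ∑ i, x i ^ 2 = ww x - 1 := by unfold ww; ring
    obtain ⟨k, rfl⟩ : ∃ k, n = k + 1 := ⟨n - 1, by omega⟩
    rw [e2, Nat.add_sub_cancel, pow_succ]
    field_simp
  rw [e]
  refine ⟨i1.sub i0, ?_⟩
  rw [integral_sub i1 i0, ww_int_ratio n hn]
  have : (n:ℝ) - 2 ≠ 0 := by linarith
  field_simp
  ring

theorem NPhi.energy_integrable {n : ℕ} (hn : 3 ≤ n) {φ : (Fin n → ℝ) → ℝ} {D} (h : NPhi n φ D) :
    Integrable (fun x => ((φ x)⁻¹) ^ n * ∑ i, D i x ^ 2) := by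
  obtain ⟨c, hc, C, hC, hb⟩ := h.bd
  have hc' : Continuous (fun x => ((φ x)⁻¹) ^ n * ∑ i, D i x ^ 2) :=
    (h.toPsi.inv_cont.pow n).mul (continuous_finsetSum _ fun i _ => (h.contD _).pow 2)
  refine Integrable.mono' ((ww_integrable (m := n) (n - 1) (by omega)).const_mul ((c⁻¹) ^ n * (n * C)))
    hc'.aestronglyMeasurable (Eventually.of_forall fun x => ?_)
  have hp := h.toPsi.pos x
  have hw := ww_pos x
  rw [Real.norm_of_nonneg (by positivity)]
  have h1 := inv_pow_le_aux hc hw (hb x).1 n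
  have h2 : ∑ i, D i x ^ 2 ≤ n * (C * ww x) := by
    refine (Finset.sum_le_sum fun i _ => (hb x).2.2 i).trans (le_of_eq ?_)
    simp
  calc _ ≤ ((c⁻¹) ^ n * ((ww x)⁻¹) ^ n) * (n * (C * ww x)) := by gcongr
    _ = _ := by
      obtain ⟨k, rfl⟩ : ∃ k, n = k + 1 := ⟨n - 1, by omega⟩
      rw [Nat.add_sub_cancel, pow_succ (ww x)⁻¹]
      field_simp

theorem sob_phi (n : ℕ) (hn : 3 ≤ n) (φ : (Fin n → ℝ) → ℝ) (D) (h : NPhi n φ D) :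
    Kd n * (∫ x, ((φ x)⁻¹) ^ n) ^ (((n:ℝ) - 2) / n) ≤
      ((n:ℝ) - 2) ^ 2 / 4 * ∫ x, ((φ x)⁻¹) ^ n * ∑ i, D i x ^ 2 := by
  have hn3 : (3:ℝ) ≤ n := by exact_mod_cast hn
  have h2 : (0:ℝ) < n - 2 := by linarith
  have h1 : (0:ℝ) < n - 1 := by linarith
  have hn0 : (0:ℝ) < n := by linarith
  have i0 := ww_integrable (m := n) n (by omega)
  have i1 := ww_integrable (m := n) (n - 1) (by omega)
  obtain ⟨i2, e2⟩ := ww_sq_int n hn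
  have r1 := ww_int_ratio n hn
  have hE := h.energy_integrable hn
  have hPi := h.toPsi.integrable n (by omega)
  have hP : 0 < ∫ x, ((φ x)⁻¹) ^ n :=
    (integral_pos_iff_support_of_nonneg (fun x => by have := h.toPsi.pos x; positivity) hPi).2 (by
      have : Function.support (fun x => ((φ x)⁻¹) ^ n) = Set.univ := by
        ext x; have := h.toPsi.pos x; simp [this.ne']
      rw [this]; exact isOpen_univ.measure_pos _ Set.univ_nonempty)
  have hI0 : 0 < ∫ x : Fin n → ℝ, ((ww x)⁻¹) ^ n :=
    (integral_pos_iff_support_of_nonneg (fun x => by have := ww_pos x; positivity) i0).2 (by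
      have : Function.support (fun x : Fin n → ℝ => ((ww x)⁻¹) ^ n) = Set.univ := by
        ext x; have := ww_pos x; simp [this.ne']
      rw [this]; exact isOpen_univ.measure_pos _ Set.univ_nonempty)
  rw [Kd_eq n hn]
  set P := ∫ x, ((φ x)⁻¹) ^ n with hPdef
  set I := ∫ x : Fin n → ℝ, ((ww x)⁻¹) ^ n with hIdef
  set E := ∫ x, ((φ x)⁻¹) ^ n * ∑ i, D i x ^ 2 with hEdef
  obtain ⟨l, hl⟩ : ∃ l : ℝ, l = (P / I) ^ ((1:ℝ) / n) := ⟨_, rfl⟩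
  have hl0 : 0 < l := by rw [hl]; positivity
  have hln : l ^ n = P / I := by
    rw [hl, ← Real.rpow_natCast, ← Real.rpow_mul (by positivity), one_div_mul_cancel hn0.ne', Real.rpow_one]
  have hl2 : l ^ (n - 2) = P ^ (((n:ℝ) - 2) / n) / I ^ (((n:ℝ) - 2) / n) := by
    rw [hl, ← Real.rpow_natCast, ← Real.rpow_mul (by positivity), ← Real.div_rpow hP.le hI0.le,
      Nat.cast_sub (by omega)]
    congr 1; push_cast; ring
  have hII : I ^ ((2:ℝ) / n) * I ^ (((n:ℝ) - 2) / n) = I := by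
    rw [← Real.rpow_add hI0, ← add_div]; 
    rw [show (2:ℝ) + (n - 2) = n by ring, div_self hn0.ne', Real.rpow_one]
  -- apply the claim with ψ = l⁻¹ ww
  have hc := claim n hn ((n - 1) / 4 * l) ((n - 1) * l⁻¹) (by positivity) (by positivity)
    (by field_simp) n 0 (by omega) φ D _ h (ww_NPsi n l⁻¹ (by positivity))
    (by
      simp only [mul_inv, inv_inv, mul_pow]
      rw [integral_const_mul, hln, ← hIdef, ← hPdef]; field_simp) 1 one_pos
  simp only [mul_inv, inv_inv, mul_pow, Nat.cast_zero, zero_div, Real.rpow_zero, mul_one,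
    ENNReal.ofReal_zero, zero_mul, zero_add] at hc
  have f1 : ∫⁻ x : Fin n → ℝ, ENNReal.ofReal (l ^ (n - 1) * ((ww x)⁻¹) ^ (n - 1)) =
      ENNReal.ofReal (l ^ (n - 1) * (2 * ((n:ℝ) - 1) / (n - 2) * I)) := by
    rw [← r1, ← integral_const_mul, ofReal_integral_eq_lintegral_ofReal (i1.const_mul _)]
    exact Eventually.of_forall fun x => by have := ww_pos x; positivity
  have f2 : ∫⁻ x, ENNReal.ofReal (((n:ℝ) - 1) / 4 * l * ((φ x)⁻¹) ^ n * ∑ i, D i x ^ 2) =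
      ENNReal.ofReal (((n:ℝ) - 1) / 4 * l * E) := by
    rw [hEdef, ← integral_const_mul, ofReal_integral_eq_lintegral_ofReal (hE.const_mul _)]
    · simp only [mul_assoc]
    · exact Eventually.of_forall fun x => by have := h.toPsi.pos x; positivity
  have f3 : ∫⁻ x : Fin n → ℝ, ENNReal.ofReal (((n:ℝ) - 1) * l⁻¹ * (l ^ n * ((ww x)⁻¹) ^ n * ∑ i, x i ^ 2)) =
      ENNReal.ofReal (((n:ℝ) - 1) * l⁻¹ * l ^ n * ((n:ℝ) / (n - 2) * I)) := by
    rw [← e2, ← integral_const_mul, ofReal_integral_eq_lintegral_ofReal (i2.const_mul _)]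
    · simp only [mul_assoc]
    · exact Eventually.of_forall fun x => by have := ww_pos x; positivity
  have hE0 : 0 ≤ E := integral_nonneg fun x => by have := h.toPsi.pos x; positivity
  rw [f1, f2, f3, ← ENNReal.ofReal_mul (by positivity), ← ENNReal.ofReal_add (by positivity) (by positivity),
    ENNReal.ofReal_le_ofReal_iff (by positivity)] at hc
  obtain ⟨k, rfl⟩ : ∃ k, n = k + 2 := ⟨n - 2, by omega⟩
  rw [Nat.add_sub_cancel] at hl2
  rw [show k + 2 - 1 = k + 1 by omega, pow_succ l (k+1), pow_succ l k] at hc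
  have hI' : 0 < I ^ ((((k + 2 : ℕ):ℝ) - 2) / ((k + 2 : ℕ):ℝ)) := by positivity
  have key : ((k + 2 : ℕ):ℝ) * (((k + 2 : ℕ):ℝ) - 2) * (I * l ^ k) ≤ (((k + 2 : ℕ):ℝ) - 2) ^ 2 / 4 * E := by
    generalize ((k + 2 : ℕ):ℝ) = N at *
    generalize l ^ k = L at *
    field_simp at hc
    field_simp
    nlinarith [hc]
  refine le_trans (le_of_eq ?_) key
  rw [hl2, mul_assoc, mul_assoc, mul_assoc]
  congr 2
  rw [eq_comm, mul_div_assoc', div_eq_iff hI'.ne']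
  rw [mul_right_comm, hII]

theorem cs_bound {m : ℕ} (f g : (Fin m → ℝ) → ℝ) (hf : Continuous f) (hs : HasCompactSupport f)
    (hg : Continuous g) : ∃ C > 0, ∀ x, f x ^ 2 * g x ≤ C := by
  have hs2 : HasCompactSupport (fun x => f x ^ 2 * g x) := by
    have : (fun x => f x ^ 2 * g x) = f * (fun x => f x * g x) := by funext x; simp; ring
    rw [this]; exact hs.mul_right
  obtain ⟨C, hC⟩ := hs2.exists_bound_of_continuous ((hf.pow 2).mul hg)
  exact ⟨|C| + 1, by positivity, fun x => by
    have := hC x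
    rw [Real.norm_eq_abs] at this
    linarith [le_abs_self (f x ^ 2 * g x), le_abs_self C]⟩

theorem rp1 (n : ℕ) (hn : 3 ≤ n) (v : ℝ) (hv : 0 < v) :
    ((v ^ (-(1 / ((n:ℝ) - 2))))⁻¹) ^ n = v ^ ((n:ℝ) / (n - 2)) := by
  rw [← Real.rpow_neg hv.le, ← Real.rpow_natCast, ← Real.rpow_mul hv.le]
  congr 1; ring

theorem rp2 (n : ℕ) (hn : 3 ≤ n) (v : ℝ) (hv : 0 < v) :
    ((v ^ (-(1 / ((n:ℝ) - 2))))⁻¹) ^ n * (v ^ (-(1 / ((n:ℝ) - 2)) - 1)) ^ 2 = v⁻¹ := by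
  have hn3 : (3:ℝ) ≤ n := by exact_mod_cast hn
  have h2 : (n:ℝ) - 2 ≠ 0 := by linarith
  rw [rp1 n hn v hv, ← Real.rpow_natCast (_ ^ _), ← Real.rpow_mul hv.le, ← Real.rpow_add hv, ← Real.rpow_neg_one]
  congr 1; field_simp; push_cast; ring

theorem rp3 (n : ℕ) (hn : 3 ≤ n) (w : ℝ) (hw : 0 < w) :
    ((w⁻¹) ^ (n - 2)) ^ (-(1 / ((n:ℝ) - 2))) = w := by
  have hn3 : (3:ℝ) ≤ n := by exact_mod_cast hn
  have h2 : (n:ℝ) - 2 ≠ 0 := by linarith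
  rw [← Real.rpow_natCast, ← Real.rpow_mul (by positivity), Nat.cast_sub (by omega), Real.inv_rpow hw.le,
    ← Real.rpow_neg hw.le, show -(((n:ℝ) - ((2:ℕ):ℝ)) * -(1 / (n - 2))) = 1 by push_cast; field_simp, Real.rpow_one]

theorem cs_ineq (u a e N x p W v : ℝ) (he : 0 < e) (hW : 0 < W) (hv : v = u ^ 2 + e * W) :
    v⁻¹ * (2 * u * a - e * N * (2 * x) * (p * W)) ^ 2 ≤ 4 * (a ^ 2 + e * N ^ 2 * (x ^ 2 * (p ^ 2 * W))) := by
  have hv0 : 0 < v := by rw [hv]; positivity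
  rw [inv_mul_le_iff₀ hv0, hv]
  have : 0 ≤ e * W * (u * N * x * p + a) ^ 2 := by positivity
  nlinarith [this]

theorem update_ww {m : ℕ} (i : Fin m) (x : Fin m → ℝ) (t : ℝ) :
    ww (Function.update x i t) = ww x - x i ^ 2 + t ^ 2 := by
  unfold ww
  rw [← Finset.add_sum_erase _ _ (Finset.mem_univ i),
    ← Finset.add_sum_erase _ (fun i => x i ^ 2) (Finset.mem_univ i)]
  rw [Function.update_self]
  have : ∑ j ∈ Finset.univ.erase i, Function.update x i t j ^ 2 = ∑ j ∈ Finset.univ.erase i, x j ^ 2 := by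
    refine Finset.sum_congr rfl fun j hj => ?_
    rw [Function.update_of_ne]
    exact Finset.ne_of_mem_erase hj
  rw [this]; ring

theorem sob_eps (n : ℕ) (hn : 3 ≤ n) (u : (Fin n → ℝ) → ℝ) (Du : Fin n → (Fin n → ℝ) → ℝ)
    (hu : Continuous u) (hDu : ∀ i, Continuous (Du i))
    (hd : ∀ i x, HasDerivAt (fun t => u (Function.update x i t)) (Du i x) (x i))
    (hs : HasCompactSupport u) (hsD : ∀ i, HasCompactSupport (Du i)) (e : ℝ) (he : 0 < e) :
    Kd n * (∫ x, (u x ^ 2) ^ ((n:ℝ) / (n - 2))) ^ (((n:ℝ) - 2) / n) ≤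
      (∫ x, ∑ i, Du i x ^ 2) +
        e * (((n:ℝ) - 2) ^ 2 * ∫ x : Fin n → ℝ, ((ww x)⁻¹) ^ n * ∑ i, x i ^ 2) := by
  have hn3 : (3:ℝ) ≤ n := by exact_mod_cast hn
  have h2 : (0:ℝ) < n - 2 := by linarith
  obtain ⟨W, hW⟩ : ∃ W : (Fin n → ℝ) → ℝ, W = fun x => ((ww x)⁻¹) ^ (n - 2) := ⟨_, rfl⟩
  obtain ⟨v, hv⟩ : ∃ v : (Fin n → ℝ) → ℝ, v = fun x => u x ^ 2 + e * W x := ⟨_, rfl⟩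
  have hvx : ∀ x, v x = u x ^ 2 + e * W x := fun x => by rw [hv]
  have hW0 : ∀ x, 0 < W x := fun x => by have := ww_pos x; rw [hW]; positivity
  have hv0 : ∀ x, 0 < v x := fun x => by have := hW0 x; rw [hv]; positivity
  have hWc : Continuous W := by rw [hW]; exact (ww_cont.inv₀ fun x => (ww_pos x).ne').pow _
  have hvc : Continuous v := by rw [hv]; fun_prop
  obtain ⟨Dv, hDv⟩ : ∃ Dv : Fin n → (Fin n → ℝ) → ℝ, Dv = fun i x =>
    2 * u x * Du i x - e * ((n:ℝ) - 2) * (2 * x i) * ((ww x)⁻¹ * W x) := ⟨_, rfl⟩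
  have hDvc : ∀ i, Continuous (Dv i) := fun i => by
    have := hDu i
    have hw : Continuous (fun x : Fin n → ℝ => (ww x)⁻¹) := ww_cont.inv₀ fun x => (ww_pos x).ne'
    rw [hDv]; fun_prop
  have hWd : ∀ i x, HasDerivAt (fun t => W (Function.update x i t))
      (-(((n:ℝ) - 2) * (2 * x i) * ((ww x)⁻¹ * W x))) (x i) := by
    intro i x
    have h1 : HasDerivAt (fun t : ℝ => ww (Function.update x i t)) (2 * x i) (x i) := by
      simp only [update_ww]
      have := ((hasDerivAt_id (x i)).pow 2).const_add (ww x - x i ^ 2)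
      simpa using this
    have hw := ww_pos x
    have h3 := (h1.inv (by simp [hw.ne'])).pow (n - 2)
    rw [hW]
    refine h3.congr_deriv ?_
    obtain ⟨k, rfl⟩ : ∃ k, n = k + 1 + 2 := ⟨n - 3, by omega⟩
    simp
    field_simp
    push_cast
    ring
  have hvd : ∀ i x, HasDerivAt (fun t => v (Function.update x i t)) (Dv i x) (x i) := by
    intro i x
    have h1 := ((hd i x).pow 2).add ((hWd i x).const_mul e)
    rw [hv, hDv]
    refine h1.congr_deriv ?_
    simp
    ring
  obtain ⟨φ, hφ⟩ : ∃ φ : (Fin n → ℝ) → ℝ, φ = fun x => v x ^ (-(1 / ((n:ℝ) - 2))) := ⟨_, rfl⟩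
  obtain ⟨D, hD⟩ : ∃ D : Fin n → (Fin n → ℝ) → ℝ, D = fun i x =>
    -(1 / ((n:ℝ) - 2)) * (v x ^ (-(1 / ((n:ℝ) - 2)) - 1)) * Dv i x := ⟨_, rfl⟩
  have key : ∀ i x, ((φ x)⁻¹) ^ n * D i x ^ 2 ≤
      (4 / ((n:ℝ) - 2) ^ 2) * (Du i x ^ 2 + e * ((n:ℝ) - 2) ^ 2 * (((ww x)⁻¹) ^ n * x i ^ 2)) := by
    intro i x
    have h3 := cs_ineq (u x) (Du i x) e ((n:ℝ) - 2) (x i) (ww x)⁻¹ (W x) (v x) he (hW0 x) (hvx x)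
    have h4 : ((φ x)⁻¹) ^ n * D i x ^ 2 = (1 / ((n:ℝ) - 2) ^ 2) * ((v x)⁻¹ * Dv i x ^ 2) := by
      rw [← rp2 n hn (v x) (hv0 x), hφ, hD]
      simp only [one_div, ← inv_pow]
      generalize ((n:ℝ) - 2)⁻¹ = a
      ring
    have h5 : ((ww x)⁻¹) ^ n = ((ww x)⁻¹) ^ 2 * W x := by
      rw [hW]; simp only; rw [← pow_add]; congr 1; omega
    rw [h4, h5]
    calc _ ≤ (1 / ((n:ℝ) - 2) ^ 2) * (4 * (Du i x ^ 2 + e * ((n:ℝ) - 2) ^ 2 * (x i ^ 2 * ((ww x)⁻¹ ^ 2 * W x)))) := by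
          refine mul_le_mul_of_nonneg_left ?_ (by positivity)
          rw [hDv]; exact h3
      _ = _ := by ring
  have hφ0 : ∀ x, 0 < φ x := fun x => by rw [hφ]; exact Real.rpow_pos_of_pos (hv0 x) _
  have hN : NPhi n φ D := by
    refine ⟨?_, ?_, ?_, ?_⟩
    · rw [hφ]; exact hvc.rpow_const fun x => Or.inl (hv0 x).ne'
    · intro i
      rw [hD]
      exact (continuous_const.mul (hvc.rpow_const fun x => Or.inl (hv0 x).ne')).mul (hDvc i)
    · intro i x
      have h1 := (hvd i x).rpow_const (p := -(1 / ((n:ℝ) - 2))) (Or.inl (by simpa using (hv0 x).ne'))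
      rw [hφ, hD]
      refine h1.congr_deriv ?_
      simp; ring
    · obtain ⟨C1, hC1, hb1⟩ := cs_bound u (fun x => (W x)⁻¹) hu hs (hWc.inv₀ fun x => (hW0 x).ne')
      have hb2 : ∀ i, ∃ C > 0, ∀ x, Du i x ^ 2 * ww x ^ n ≤ C := fun i =>
        cs_bound (Du i) (fun x => ww x ^ n) (hDu i) (hsD i) (ww_cont.pow n)
      choose C2 hC2 hb2 using hb2
      have hvle : ∀ x, v x ≤ (C1 + e) * W x := fun x => by
        have := hb1 x
        rw [← div_eq_mul_inv, div_le_iff₀ (hW0 x)] at this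
        rw [hvx]; linarith
      have hvge : ∀ x, e * W x ≤ v x := fun x => by rw [hvx]; nlinarith [sq_nonneg (u x)]
      have hneg : -(1 / ((n:ℝ) - 2)) ≤ 0 := by simp; linarith
      have hup : ∀ x, φ x ≤ e ^ (-(1 / ((n:ℝ) - 2))) * ww x := fun x => by
        have := Real.rpow_le_rpow_of_nonpos (by have := hW0 x; positivity) (hvge x) hneg
        rw [Real.mul_rpow he.le (hW0 x).le] at this
        rw [hφ]
        refine this.trans (le_of_eq ?_)
        congr 1; rw [hW]; exact rp3 n hn _ (ww_pos x)
      have hlow : ∀ x, (C1 + e) ^ (-(1 / ((n:ℝ) - 2))) * ww x ≤ φ x := fun x => by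
        have := Real.rpow_le_rpow_of_nonpos (hv0 x) (hvle x) hneg
        rw [Real.mul_rpow (by positivity) (hW0 x).le] at this
        rw [hφ]
        refine le_trans (le_of_eq ?_) this
        congr 1; rw [hW]; exact (rp3 n hn _ (ww_pos x)).symm
      obtain ⟨Q, hQ⟩ : ∃ Q : ℝ, Q = e ^ (-(1 / ((n:ℝ) - 2))) := ⟨_, rfl⟩
      have hQ0 : 0 < Q := by rw [hQ]; positivity
      rw [← hQ] at hup
      have hDb : ∀ i x, D i x ^ 2 ≤ Q ^ n * (4 / ((n:ℝ) - 2) ^ 2 *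
          (∑ j, C2 j + e * ((n:ℝ) - 2) ^ 2)) * ww x := by
        intro i x
        have hw := ww_ge x
        have hw0 := ww_pos x
        have hp := hφ0 x
        have hk := key i x
        have hk2 : D i x ^ 2 ≤ φ x ^ n * ((4 / ((n:ℝ) - 2) ^ 2) * (Du i x ^ 2 + e * ((n:ℝ) - 2) ^ 2 * (((ww x)⁻¹) ^ n * x i ^ 2))) := by
          rw [inv_pow, inv_mul_le_iff₀ (by positivity)] at hk
          exact hk
        have hxi : x i ^ 2 ≤ ww x := by
          have := Finset.single_le_sum (f := fun i => x i ^ 2) (fun i _ => sq_nonneg _) (Finset.mem_univ i)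
          unfold ww; linarith
        have hCj : C2 i ≤ ∑ j, C2 j := Finset.single_le_sum (f := C2) (fun i _ => (hC2 i).le) (Finset.mem_univ i)
        calc D i x ^ 2 ≤ _ := hk2
          _ ≤ (Q * ww x) ^ n * ((4 / ((n:ℝ) - 2) ^ 2) * (Du i x ^ 2 + e * ((n:ℝ) - 2) ^ 2 * (((ww x)⁻¹) ^ n * x i ^ 2))) := by
            gcongr
            exact hup x
          _ = Q ^ n * (4 / ((n:ℝ) - 2) ^ 2 * (Du i x ^ 2 * ww x ^ n + e * ((n:ℝ) - 2) ^ 2 * x i ^ 2)) := by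
            rw [mul_pow, inv_pow]; field_simp
          _ ≤ Q ^ n * (4 / ((n:ℝ) - 2) ^ 2 * ((∑ j, C2 j) * ww x + e * ((n:ℝ) - 2) ^ 2 * ww x)) := by
            have hq : Du i x ^ 2 * ww x ^ n ≤ (∑ j, C2 j) * ww x :=
              ((hb2 i x).trans hCj).trans
                (le_mul_of_one_le_right (Finset.sum_nonneg fun i _ => (hC2 i).le) hw)
            refine mul_le_mul_of_nonneg_left (mul_le_mul_of_nonneg_left (add_le_add hq ?_) (by positivity)) (by positivity)
            gcongr
          _ = _ := by ring
      have hS : 0 ≤ ∑ j, C2 j := Finset.sum_nonneg fun i _ => (hC2 i).le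
      obtain ⟨Z, hZ⟩ : ∃ Z : ℝ, Z = Q ^ n * (4 / ((n:ℝ) - 2) ^ 2 *
          (∑ j, C2 j + e * ((n:ℝ) - 2) ^ 2)) := ⟨_, rfl⟩
      have hZ0 : 0 ≤ Z := by rw [hZ]; positivity
      rw [← hZ] at hDb
      refine ⟨(C1 + e) ^ (-(1 / ((n:ℝ) - 2))), by positivity, Q + Z, by positivity, fun x => ?_⟩
      have hw0 := ww_pos x
      refine ⟨hlow x, (hup x).trans ?_, fun i => (hDb i x).trans ?_⟩
      · gcongr; linarith
      · gcongr; linarith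
  have hfin := sob_phi n hn φ D hN
  have hPi := hN.toPsi.integrable n (by omega)
  have hφn : ∀ x, ((φ x)⁻¹) ^ n = v x ^ ((n:ℝ) / (n - 2)) := fun x => by
    rw [hφ]; exact rp1 n hn (v x) (hv0 x)
  have hK : 0 ≤ Kd n := by unfold Kd; positivity
  have hI2 := (ww_sq_int n hn).1
  have hDi : Integrable (fun x => ∑ i, Du i x ^ 2) := by
    refine integrable_finsetSum _ fun i _ => ?_
    have : HasCompactSupport (fun x => Du i x ^ 2) := by
      have : (fun x => Du i x ^ 2) = Du i * Du i := by funext x; simp; ring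
      rw [this]; exact (hsD i).mul_right
    exact ((hDu i).pow 2).integrable_of_hasCompactSupport this
  calc _ ≤ Kd n * (∫ x, ((φ x)⁻¹) ^ n) ^ (((n:ℝ) - 2) / n) := by
        refine mul_le_mul_of_nonneg_left (Real.rpow_le_rpow (integral_nonneg fun x => by positivity) ?_
          (by positivity)) hK
        refine integral_mono_of_nonneg (Eventually.of_forall fun x => by positivity) hPi
          (Eventually.of_forall fun x => ?_)
        simp only [hφn]
        gcongr
        rw [hvx]; have := hW0 x; nlinarith
    _ ≤ _ := hfin
    _ ≤ ((n:ℝ) - 2) ^ 2 / 4 * ∫ x, (4 / ((n:ℝ) - 2) ^ 2) * (∑ i, Du i x ^ 2 + e * ((n:ℝ) - 2) ^ 2 *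
          (((ww x)⁻¹) ^ n * ∑ i, x i ^ 2)) := by
        refine mul_le_mul_of_nonneg_left ?_ (by positivity)
        refine integral_mono (hN.energy_integrable hn) ((hDi.add (hI2.const_mul _)).const_mul _) fun x => ?_
        simp only [Finset.mul_sum, ← Finset.sum_add_distrib]
        refine Finset.sum_le_sum fun i _ => ?_
        refine (key i x).trans (le_of_eq ?_)
        ring
    _ = _ := by
        rw [integral_const_mul, integral_add hDi (hI2.const_mul _), integral_const_mul]
        field_simp

theorem sob_pi (n : ℕ) (hn : 3 ≤ n) (u : (Fin n → ℝ) → ℝ) (Du : Fin n → (Fin n → ℝ) → ℝ)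
    (hu : Continuous u) (hDu : ∀ i, Continuous (Du i))
    (hd : ∀ i x, HasDerivAt (fun t => u (Function.update x i t)) (Du i x) (x i))
    (hs : HasCompactSupport u) (hsD : ∀ i, HasCompactSupport (Du i)) :
    Kd n * (∫ x, (u x ^ 2) ^ ((n:ℝ) / (n - 2))) ^ (((n:ℝ) - 2) / n) ≤ ∫ x, ∑ i, Du i x ^ 2 := by
  obtain ⟨M, hM⟩ : ∃ M : ℝ, M = ((n:ℝ) - 2) ^ 2 * ∫ x : Fin n → ℝ, ((ww x)⁻¹) ^ n * ∑ i, x i ^ 2 := ⟨_, rfl⟩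
  have hM0 : 0 ≤ M := by
    rw [hM]
    exact mul_nonneg (sq_nonneg _) (integral_nonneg fun x => by have := ww_pos x; positivity)
  refine le_of_forall_pos_le_add fun e he => ?_
  refine (sob_eps n hn u Du hu hDu hd hs hsD (e / (M + 1)) (by positivity)).trans ?_
  rw [← hM]
  gcongr
  rw [div_mul_eq_mul_div, div_le_iff₀ (by positivity)]
  nlinarith

theorem grad_coord {d : ℕ} (g : EuclideanSpace ℝ (Fin d) → ℝ) (x : EuclideanSpace ℝ (Fin d)) (i : Fin d) :
    gradient g x i = fderiv ℝ g x (EuclideanSpace.single i 1) := by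
  have h : inner ℝ (gradient g x) (EuclideanSpace.single i (1:ℝ)) = fderiv ℝ g x (EuclideanSpace.single i 1) := by
    unfold gradient
    rw [InnerProductSpace.toDual_symm_apply]
  rw [← h, EuclideanSpace.inner_single_right]
  simp

theorem grad_norm_sq {d : ℕ} (g : EuclideanSpace ℝ (Fin d) → ℝ) (x : EuclideanSpace ℝ (Fin d)) :
    ‖gradient g x‖ ^ 2 = ∑ i, fderiv ℝ g x (EuclideanSpace.single i 1) ^ 2 := by
  rw [EuclideanSpace.norm_sq_eq]
  refine Finset.sum_congr rfl fun i _ => ?_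
  rw [grad_coord, Real.norm_eq_abs, sq_abs]

theorem sob_euc (d : ℕ) (hd : 3 ≤ d) (g : EuclideanSpace ℝ (Fin d) → ℝ) (hg : ContDiff ℝ 1 g)
    (hs : HasCompactSupport g) :
    Kd d * (∫ x, (g x ^ 2) ^ ((d:ℝ) / (d - 2))) ^ (((d:ℝ) - 2) / d) ≤ ∫ x, ‖gradient g x‖ ^ 2 := by
  have hmp := PiLp.volume_preserving_toLp (Fin d)
  have hemb : MeasurableEmbedding (WithLp.toLp 2 : (Fin d → ℝ) → EuclideanSpace ℝ (Fin d)) :=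
    (MeasurableEquiv.toLp 2 (Fin d → ℝ)).measurableEmbedding
  have hc : Continuous (WithLp.toLp 2 : (Fin d → ℝ) → EuclideanSpace ℝ (Fin d)) := PiLp.continuous_toLp 2 _
  let hom : (Fin d → ℝ) ≃ₜ EuclideanSpace ℝ (Fin d) :=
    (PiLp.homeomorph 2 (fun _ : Fin d => ℝ)).symm
  have hhom : ∀ x, hom x = WithLp.toLp 2 x := fun x => rfl
  have hfc := hg.continuous_fderiv one_ne_zero
  have h := sob_pi d hd (fun x => g (WithLp.toLp 2 x))
    (fun i x => fderiv ℝ g (WithLp.toLp 2 x) (EuclideanSpace.single i 1))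
    (hg.continuous.comp hc)
    (fun i => ((hfc.comp hc).clm_apply continuous_const))
    (by
      intro i x
      have e : ∀ t, WithLp.toLp 2 (Function.update x i t) =
          WithLp.toLp 2 x + (t - x i) • (EuclideanSpace.single i (1:ℝ)) := by
        intro t
        ext j
        by_cases hj : j = i
        · subst hj; simp
        · simp [hj]
      simp only [e]
      have h1 : HasDerivAt (fun t : ℝ => WithLp.toLp 2 x + (t - x i) • (EuclideanSpace.single i (1:ℝ)))
          (EuclideanSpace.single i (1:ℝ)) (x i) := by
        have := (((hasDerivAt_id (x i)).sub_const (x i)).smul_const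
          (EuclideanSpace.single i (1:ℝ))).const_add (WithLp.toLp 2 x)
        simpa using this
      have h2 : HasFDerivAt g (fderiv ℝ g (WithLp.toLp 2 x))
          (WithLp.toLp 2 x + (x i - x i) • (EuclideanSpace.single i (1:ℝ))) := by
        have := (hg.differentiable one_ne_zero (WithLp.toLp 2 x)).hasFDerivAt
        simpa using this
      exact h2.comp_hasDerivAt (x i) h1)
    (hs.comp_homeomorph hom)
    (fun i => by
      have h1 : HasCompactSupport (fun y => fderiv ℝ g y (EuclideanSpace.single i (1:ℝ))) :=
        (hs.fderiv (𝕜 := ℝ)).comp_left (g := fun L : EuclideanSpace ℝ (Fin d) →L[ℝ] ℝ => L (EuclideanSpace.single i (1:ℝ))) (by simp)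
      exact h1.comp_homeomorph hom)
  rw [hmp.integral_comp hemb (fun y => (g y ^ 2) ^ ((d:ℝ) / (d - 2))),
    hmp.integral_comp hemb (fun y => ∑ i, fderiv ℝ g y (EuclideanSpace.single i 1) ^ 2)] at h
  simpa only [grad_norm_sq] using h

theorem grad_norm {d : ℕ} (g : EuclideanSpace ℝ (Fin d) → ℝ) (x : EuclideanSpace ℝ (Fin d)) :
    ‖gradient g x‖ = ‖fderiv ℝ g x‖ := by
  unfold gradient; rw [LinearIsometryEquiv.norm_map]

theorem loc_int {d : ℕ} (f h : EuclideanSpace ℝ (Fin d) → ℝ) (hf : Measurable f)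
    (hloc : ∀ K : Set (EuclideanSpace ℝ (Fin d)), IsCompact K → ∃ M : ℝ, ∀ x ∈ K, |f x| ≤ M)
    (hh : Continuous h) (hs : HasCompactSupport h) : Integrable (fun x => f x * h x) := by
  obtain ⟨M, hM⟩ := hloc (tsupport h) hs
  refine Integrable.mono' ((hh.norm.integrable_of_hasCompactSupport hs.norm).const_mul M)
    (hf.mul hh.measurable).aestronglyMeasurable (Eventually.of_forall fun x => ?_)
  rw [norm_mul]
  by_cases hx : x ∈ tsupport h
  · gcongr; exact hM x hx
  · rw [image_eq_zero_of_notMem_tsupport hx]; simp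

theorem avg_lint {d : ℕ} (F a : EuclideanSpace ℝ (Fin d) → ℝ) (hF : Measurable F) (hF0 : ∀ x, 0 ≤ F x)
    (ha : Measurable a) :
    ∫⁻ y, ∫⁻ x, ENNReal.ofReal (F x * a (x - y)) =
      (∫⁻ x, ENNReal.ofReal (F x)) * ∫⁻ x, ENNReal.ofReal (a x) := by
  rw [lintegral_lintegral_swap]
  · rw [← lintegral_mul_const _ hF.ennreal_ofReal]
    refine lintegral_congr fun x => ?_
    simp only [ENNReal.ofReal_mul (hF0 x)]
    rw [lintegral_const_mul' _ _ ENNReal.ofReal_ne_top,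
      lintegral_sub_left_eq_self (fun z => ENNReal.ofReal (a z)) x]
  · apply Measurable.aemeasurable
    unfold Function.uncurry
    fun_prop

theorem holder_sob (d : ℕ) (hd : 3 ≤ d) (W : EuclideanSpace ℝ (Fin d) → ℝ) (hW : Measurable W)
    (hW0 : ∀ x, 0 ≤ W x) (Gy : Set (EuclideanSpace ℝ (Fin d))) (hGy : MeasurableSet Gy)
    (hb : Bornology.IsBounded Gy)
    (hloc : ∀ K : Set (EuclideanSpace ℝ (Fin d)), IsCompact K → ∃ M : ℝ, ∀ x ∈ K, |W x| ≤ M)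
    (c : ℝ) (hc : (∫ x in Gy, W x ^ ((d : ℝ) / 2)) ^ ((2 : ℝ) / (d : ℝ)) ≤ c)
    (g : EuclideanSpace ℝ (Fin d) → ℝ) (hg : ContDiff ℝ 1 g) (hs : HasCompactSupport g)
    (hsup : ∀ x, x ∉ Gy → g x = 0) :
    Kd d * ∫ x, W x * g x ^ 2 ≤ c * ∫ x, ‖gradient g x‖ ^ 2 := by
  have hd3 : (3:ℝ) ≤ d := by exact_mod_cast hd
  have h2 : (0:ℝ) < d - 2 := by linarith
  have hK : 0 ≤ Kd d := by unfold Kd; positivity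
  obtain ⟨M, hM⟩ := hloc _ hb.isCompact_closure
  have hfin : volume Gy < ⊤ := hb.measure_lt_top
  haveI : IsFiniteMeasure (volume.restrict Gy) := ⟨by simpa using hfin⟩
  have hpq : Real.HolderConjugate ((d:ℝ) / 2) ((d:ℝ) / (d - 2)) := by
    rw [Real.holderConjugate_iff]
    constructor
    · linarith
    · field_simp; ring
  have e1 : ∫ x, W x * g x ^ 2 = ∫ x in Gy, W x * g x ^ 2 := by
    rw [setIntegral_eq_integral_of_forall_compl_eq_zero]
    intro x hx; rw [hsup x hx]; simp
  have e2 : ∫ x, (g x ^ 2) ^ ((d:ℝ) / (d - 2)) = ∫ x in Gy, (g x ^ 2) ^ ((d:ℝ) / (d - 2)) := by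
    rw [setIntegral_eq_integral_of_forall_compl_eq_zero]
    intro x hx; rw [hsup x hx]
    rw [zero_pow two_ne_zero, Real.zero_rpow (by positivity)]
  have hWm : MemLp W (ENNReal.ofReal ((d:ℝ) / 2)) (volume.restrict Gy) := by
    refine MemLp.of_bound hW.aestronglyMeasurable M ?_
    filter_upwards [ae_restrict_mem hGy] with x hx
    exact hM x (subset_closure hx)
  have hgm : MemLp (fun x => g x ^ 2) (ENNReal.ofReal ((d:ℝ) / (d - 2))) (volume.restrict Gy) := by
    obtain ⟨C, hC⟩ := hs.exists_bound_of_continuous hg.continuous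
    refine MemLp.of_bound (hg.continuous.pow 2).aestronglyMeasurable (C ^ 2) (Eventually.of_forall fun x => ?_)
    rw [norm_pow]
    have := hC x
    gcongr
  have hH := integral_mul_le_Lp_mul_Lq_of_nonneg hpq (μ := volume.restrict Gy) (f := W) (g := fun x => g x ^ 2)
    (Eventually.of_forall hW0) (Eventually.of_forall fun x => sq_nonneg _) hWm hgm
  rw [one_div_div, one_div_div] at hH
  have hS := sob_euc d hd g hg hs
  rw [e2] at hS
  rw [e1]
  have hA0 : 0 ≤ (∫ x in Gy, W x ^ ((d : ℝ) / 2)) ^ ((2 : ℝ) / (d : ℝ)) :=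
    Real.rpow_nonneg (integral_nonneg fun x => Real.rpow_nonneg (hW0 x) _) _
  calc _ ≤ Kd d * (_ * _) := mul_le_mul_of_nonneg_left hH hK
    _ = (∫ x in Gy, W x ^ ((d : ℝ) / 2)) ^ ((2 : ℝ) / (d : ℝ)) *
        (Kd d * (∫ x in Gy, (g x ^ 2) ^ ((d:ℝ) / (d - 2))) ^ (((d:ℝ) - 2) / d)) := by ring
    _ ≤ (∫ x in Gy, W x ^ ((d : ℝ) / 2)) ^ ((2 : ℝ) / (d : ℝ)) * _ := mul_le_mul_of_nonneg_left hS hA0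
    _ ≤ _ := mul_le_mul_of_nonneg_right hc (integral_nonneg fun x => by positivity)

theorem grad_prod {d : ℕ} (f g : EuclideanSpace ℝ (Fin d) → ℝ) (x : EuclideanSpace ℝ (Fin d))
    (hf : DifferentiableAt ℝ f x) (hg : DifferentiableAt ℝ g x) (δ : ℝ) (hδ : 0 < δ) :
    ‖gradient (fun x => f x * g x) x‖ ^ 2 ≤
      (1 + δ) * (f x ^ 2 * ‖gradient g x‖ ^ 2) + (1 + 1 / δ) * (g x ^ 2 * ‖gradient f x‖ ^ 2) := by
  rw [grad_norm, grad_norm, grad_norm, fderiv_fun_mul hf hg]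
  have h1 : ‖f x • fderiv ℝ g x + g x • fderiv ℝ f x‖ ≤ |f x| * ‖fderiv ℝ g x‖ + |g x| * ‖fderiv ℝ f x‖ := by
    refine (norm_add_le _ _).trans (le_of_eq ?_)
    rw [norm_smul, norm_smul]; simp
  rw [← sq_abs (f x), ← sq_abs (g x), ← mul_pow, ← mul_pow]
  generalize |f x| * ‖fderiv ℝ g x‖ = A at *
  generalize |g x| * ‖fderiv ℝ f x‖ = B at *
  calc _ ≤ (A + B) ^ 2 := by gcongr
    _ ≤ _ := by
      have : 0 ≤ (δ * A - B) ^ 2 / δ := by positivity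
      have e : (1 + δ) * A ^ 2 + (1 + 1 / δ) * B ^ 2 - (A + B) ^ 2 = (δ * A - B) ^ 2 / δ := by
        field_simp; ring
      linarith

set_option maxHeartbeats 2000000

theorem statement6 (d : ℕ) (hd : 3 ≤ d) (V : EuclideanSpace ℝ (Fin d) → ℝ)
    (hVmeas : Measurable V)
    (hVloc : ∀ K : Set (EuclideanSpace ℝ (Fin d)), IsCompact K →
      ∃ M : ℝ, ∀ x ∈ K, |V x| ≤ M)
    (G : Set (EuclideanSpace ℝ (Fin d))) (ρ₀ : ℝ) (hρ₀ : 0 < ρ₀)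
    (hGopen : IsOpen G) (hGbdd : Bornology.IsBounded G) (hGdiam : Metric.diam G = 2)
    (hGball : ball (0 : EuclideanSpace ℝ (Fin d)) ρ₀ ⊆ G)
    (hGstar : ∀ c ∈ ball (0 : EuclideanSpace ℝ (Fin d)) ρ₀, StarConvex ℝ c G)
    (r₀ : ℝ) (hr₀ : 0 < r₀)
    (hlimsup : ∃ c : ℝ, c < Kd d ∧ ∃ R : ℝ, ∀ y : EuclideanSpace ℝ (Fin d), R ≤ ‖y‖ →
      (∫ x in Gr G r₀ y, (max (-V x) 0) ^ ((d : ℝ) / 2)) ^ ((2 : ℝ) / (d : ℝ)) ≤ c) :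
    ∃ C : ℝ, ∀ u : EuclideanSpace ℝ (Fin d) → ℝ, ContDiff ℝ (⊤ : ℕ∞) u → HasCompactSupport u →
      -C * ∫ x, (u x) ^ 2 ≤ ∫ x, (‖gradient u x‖ ^ 2 + V x * (u x) ^ 2) := by
  have hd3 : (3:ℝ) ≤ d := by exact_mod_cast hd
  have hKpos : 0 < Kd d := by
    have h2 : (0:ℝ) < d - 2 := by linarith
    have hd0 : (0:ℝ) < d := by linarith
    have := Real.Gamma_pos_of_pos hd0
    have := Real.Gamma_pos_of_pos (half_pos hd0)
    unfold Kd Cd; positivity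
  obtain ⟨c0, hc0, R, hR⟩ := hlimsup
  obtain ⟨c, hcdef⟩ : ∃ c, c = max c0 0 := ⟨_, rfl⟩
  have hc : c < Kd d := by rw [hcdef]; exact max_lt hc0 hKpos
  have hcn : 0 ≤ c := by rw [hcdef]; exact le_max_right _ _
  have hRc : ∀ y : EuclideanSpace ℝ (Fin d), R ≤ ‖y‖ →
      (∫ x in Gr G r₀ y, (max (-V x) 0) ^ ((d : ℝ) / 2)) ^ ((2 : ℝ) / (d : ℝ)) ≤ c := fun y hy =>
    (hR y hy).trans (by rw [hcdef]; exact le_max_left _ _)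
  obtain ⟨W, hWdef⟩ : ∃ W : EuclideanSpace ℝ (Fin d) → ℝ, W = fun x => max (-V x) 0 := ⟨_, rfl⟩
  have hW : Measurable W := by rw [hWdef]; exact hVmeas.neg.max measurable_const
  have hW0 : ∀ x, 0 ≤ W x := fun x => by rw [hWdef]; exact le_max_right _ _
  have hWV : ∀ x, -W x ≤ V x := fun x => by
    rw [hWdef]; simp only; linarith [le_max_left (-V x) 0]
  have hWloc : ∀ K : Set (EuclideanSpace ℝ (Fin d)), IsCompact K → ∃ M : ℝ, ∀ x ∈ K, |W x| ≤ M := by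
    intro K hK
    obtain ⟨M, hM⟩ := hVloc K hK
    refine ⟨M, fun x hx => ?_⟩
    rw [abs_of_nonneg (hW0 x), hWdef]
    exact max_le ((neg_le_abs _).trans (hM x hx)) ((abs_nonneg _).trans (hM x hx))
  have hθ : ∃ δ > 0, c * (1 + δ) ≤ Kd d := by
    refine ⟨(Kd d - c) / (c + 1), div_pos (by linarith) (by linarith), ?_⟩
    have h1 : 0 < c + 1 := by linarith
    have h3 : c * ((Kd d - c) / (c + 1)) ≤ Kd d - c := by
      rw [mul_div_assoc', div_le_iff₀ h1]; nlinarith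
    linarith
  obtain ⟨δ, hδ, hδK⟩ := hθ
  obtain ⟨ρ, hρdef⟩ : ∃ ρ, ρ = ρ₀ * r₀ := ⟨_, rfl⟩
  have hρ : 0 < ρ := by rw [hρdef]; positivity
  obtain ⟨M0, hM0⟩ := hWloc (closedBall 0 (R + ρ)) (isCompact_closedBall _ _)
  obtain ⟨M, hMdef⟩ : ∃ M, M = max M0 0 := ⟨_, rfl⟩
  have hM : ∀ x ∈ closedBall (0 : EuclideanSpace ℝ (Fin d)) (R + ρ), W x ≤ M := fun x hx =>
    (le_abs_self _).trans ((hM0 x hx).trans (by rw [hMdef]; exact le_max_left _ _))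
  have hMn : 0 ≤ M := by rw [hMdef]; exact le_max_right _ _
  let χ : ContDiffBump (0 : EuclideanSpace ℝ (Fin d)) := ⟨ρ / 2, ρ, by positivity, by linarith⟩
  have hχd : ContDiff ℝ (⊤ : ℕ∞) (χ : EuclideanSpace ℝ (Fin d) → ℝ) := χ.contDiff
  have hχs : HasCompactSupport (χ : EuclideanSpace ℝ (Fin d) → ℝ) := χ.hasCompactSupport
  have hχsupp : ∀ x, ρ ≤ ‖x‖ → χ x = 0 := fun x hx => by
    have := χ.support_eq
    by_contra h
    have h3 : x ∈ Function.support (χ : EuclideanSpace ℝ (Fin d) → ℝ) := h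
    rw [this] at h3
    have h4 : ‖x‖ < ρ := by simpa [χ] using h3
    linarith
  have hfc : Continuous (fun x => ‖gradient (χ : EuclideanSpace ℝ (Fin d) → ℝ) x‖ ^ 2) := by
    simp only [grad_norm]
    exact (hχd.continuous_fderiv (by simp)).norm.pow 2
  obtain ⟨C', hC'⟩ : ∃ C' : ℝ, C' = c / Kd d * (1 + 1 / δ) := ⟨_, rfl⟩
  have hC'n : 0 ≤ C' := by rw [hC']; positivity
  obtain ⟨a, ha⟩ : ∃ a : EuclideanSpace ℝ (Fin d) → ℝ, a = fun x => χ x ^ 2 := ⟨_, rfl⟩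
  obtain ⟨b, hb⟩ : ∃ b : EuclideanSpace ℝ (Fin d) → ℝ,
    b = fun x => C' * ‖gradient (χ : EuclideanSpace ℝ (Fin d) → ℝ) x‖ ^ 2 + M * χ x ^ 2 := ⟨_, rfl⟩
  have hac : Continuous a := by rw [ha]; exact χ.continuous.pow 2
  have hbc : Continuous b := by
    rw [hb]; exact (continuous_const.mul hfc).add (continuous_const.mul (χ.continuous.pow 2))
  have ha0 : ∀ x, 0 ≤ a x := fun x => by rw [ha]; positivity
  have hb0 : ∀ x, 0 ≤ b x := fun x => by rw [hb]; positivity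
  have has : HasCompactSupport a := by
    rw [ha]; exact hχs.comp_left (g := fun t : ℝ => t ^ 2) (by simp)
  have hbs : HasCompactSupport b := by
    rw [hb]
    refine HasCompactSupport.add ?_ ?_
    · simp only [grad_norm]
      exact (hχs.fderiv (𝕜 := ℝ)).comp_left
        (g := fun L : EuclideanSpace ℝ (Fin d) →L[ℝ] ℝ => C' * ‖L‖ ^ 2) (by simp)
    · exact hχs.comp_left (g := fun t : ℝ => M * t ^ 2) (by simp)
  have hai := hac.integrable_of_hasCompactSupport has (μ := volume)
  have hbi := hbc.integrable_of_hasCompactSupport hbs (μ := volume)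
  have hS : 0 < ∫ x, a x := by
    refine hac.integral_pos_of_hasCompactSupport_nonneg_nonzero has ha0 (x := 0) ?_
    rw [ha]
    have : χ 0 = 1 := χ.one_of_mem_closedBall (by simp [χ]; linarith)
    simp [this]
  refine ⟨(∫ x, b x) / ∫ x, a x, fun u hu hus => ?_⟩
  have hu1 : ContDiff ℝ 1 u := hu.of_le (by exact_mod_cast le_top)
  have hχ1 : ContDiff ℝ 1 (χ : EuclideanSpace ℝ (Fin d) → ℝ) := χ.contDiff
  have hu2s : HasCompactSupport (fun x => u x ^ 2) := hus.comp_left (g := fun t : ℝ => t ^ 2) (by simp)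
  have hu2c : Continuous (fun x => u x ^ 2) := hu.continuous.pow 2
  have hgc : Continuous (fun x => ‖gradient u x‖ ^ 2) := by
    simp only [grad_norm]
    exact (hu1.continuous_fderiv one_ne_zero).norm.pow 2
  have hgs : HasCompactSupport (fun x => ‖gradient u x‖ ^ 2) := by
    simp only [grad_norm]
    exact (hus.fderiv (𝕜 := ℝ)).comp_left
        (g := fun L : EuclideanSpace ℝ (Fin d) →L[ℝ] ℝ => ‖L‖ ^ 2) (by simp)
  have hi1 := hgc.integrable_of_hasCompactSupport hgs (μ := volume)
  have hi2 := hu2c.integrable_of_hasCompactSupport hu2s (μ := volume)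
  have hiW := loc_int W _ hW hWloc hu2c hu2s
  have hiV := loc_int V _ hVmeas hVloc hu2c hu2s
  -- localized inequality
  have hlocal : ∀ y : EuclideanSpace ℝ (Fin d),
      ∫ x, W x * u x ^ 2 * a (x - y) ≤
        (∫ x, ‖gradient u x‖ ^ 2 * a (x - y)) + ∫ x, u x ^ 2 * b (x - y) := by
    intro y
    obtain ⟨η, hη⟩ : ∃ η : EuclideanSpace ℝ (Fin d) → ℝ, η = fun x => χ (x - y) := ⟨_, rfl⟩
    have hη1 : ContDiff ℝ 1 η := by rw [hη]; exact hχ1.comp (contDiff_id.sub contDiff_const)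
    have hηg : ∀ x, gradient η x = gradient (χ : EuclideanSpace ℝ (Fin d) → ℝ) (x - y) := by
      intro x
      unfold gradient
      rw [hη, fderiv_comp_sub]
    have hg1 : ContDiff ℝ 1 (fun x => η x * u x) := hη1.mul hu1
    have hgs1 : HasCompactSupport (fun x => η x * u x) := hus.mul_left
    have hηa : ∀ x, a (x - y) = η x ^ 2 := fun x => by rw [ha, hη]
    have hηb : ∀ x, b (x - y) = C' * ‖gradient η x‖ ^ 2 + M * η x ^ 2 := fun x => by rw [hb, hηg, hη]
    have hgi2 : Integrable (fun x => (η x * u x) ^ 2) :=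
      Continuous.integrable_of_hasCompactSupport (hg1.continuous.pow 2)
        (HasCompactSupport.comp_left (f := fun x => η x * u x) (g := fun t : ℝ => t ^ 2) hgs1 (by simp))
    have hgg : Integrable (fun x => ‖gradient (fun x => η x * u x) x‖ ^ 2) := by
      simp only [grad_norm]
      exact Continuous.integrable_of_hasCompactSupport ((hg1.continuous_fderiv one_ne_zero).norm.pow 2)
        (HasCompactSupport.comp_left (f := fderiv ℝ (fun x => η x * u x)) (hgs1.fderiv (𝕜 := ℝ))
        (g := fun L : EuclideanSpace ℝ (Fin d) →L[ℝ] ℝ => ‖L‖ ^ 2) (by simp))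
    have hmain : ∫ x, W x * (η x * u x) ^ 2 ≤
        c / Kd d * (∫ x, ‖gradient (fun x => η x * u x) x‖ ^ 2) + M * ∫ x, (η x * u x) ^ 2 := by
      have p1 : 0 ≤ ∫ x, ‖gradient (fun x => η x * u x) x‖ ^ 2 := integral_nonneg fun x => by positivity
      have p2 : 0 ≤ ∫ x, (η x * u x) ^ 2 := integral_nonneg fun x => by positivity
      by_cases hy : R ≤ ‖y‖
      · have hopen : IsOpen (Gr G r₀ y) :=
          hGopen.preimage (f := fun x => r₀⁻¹ • (x - y)) (by fun_prop)
        have hbdd : Bornology.IsBounded (Gr G r₀ y) := by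
          obtain ⟨B, hB⟩ := hGbdd.exists_norm_le
          refine (isBounded_iff_forall_norm_le).2 ⟨r₀ * B + ‖y‖, fun x hx => ?_⟩
          have h1 := hB _ hx
          rw [norm_smul, norm_inv, Real.norm_of_nonneg hr₀.le, inv_mul_le_iff₀ hr₀] at h1
          have h3 : ‖x‖ ≤ ‖x - y‖ + ‖y‖ := by simpa using norm_add_le (x - y) y
          linarith
        have h := holder_sob d hd W hW hW0 (Gr G r₀ y) hopen.measurableSet hbdd hWloc c
          (by rw [hWdef]; exact hRc y hy) (fun x => η x * u x) hg1 hgs1 (by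
            intro x hx
            have h1 : ρ ≤ ‖x - y‖ := by
              by_contra hlt
              push Not at hlt
              apply hx
              apply hGball
              rw [mem_ball_zero_iff, norm_smul, norm_inv, Real.norm_of_nonneg hr₀.le, inv_mul_lt_iff₀ hr₀]
              rw [hρdef] at hlt; linarith
            have h3 : η x = 0 := by rw [hη]; exact hχsupp _ h1
            simp [h3])
        have h4 : ∫ x, W x * (η x * u x) ^ 2 ≤
            c / Kd d * (∫ x, ‖gradient (fun x => η x * u x) x‖ ^ 2) := by
          rw [div_mul_eq_mul_div, le_div_iff₀ hKpos, mul_comm]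
          exact h
        have : 0 ≤ M * ∫ x, (η x * u x) ^ 2 := by positivity
        linarith
      · push Not at hy
        have h4 : ∫ x, W x * (η x * u x) ^ 2 ≤ M * ∫ x, (η x * u x) ^ 2 := by
          rw [← integral_const_mul]
          refine integral_mono_of_nonneg (Eventually.of_forall fun x => mul_nonneg (hW0 x) (sq_nonneg _))
            (hgi2.const_mul M) (Eventually.of_forall fun x => ?_)
          simp only
          by_cases hx : ρ ≤ ‖x - y‖
          · have h3 : η x = 0 := by rw [hη]; exact hχsupp _ hx
            simp [h3]
          · push Not at hx
            refine mul_le_mul_of_nonneg_right (hM x ?_) (sq_nonneg _)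
            rw [mem_closedBall_zero_iff]
            have h3 : ‖x‖ ≤ ‖x - y‖ + ‖y‖ := by simpa using norm_add_le (x - y) y
            linarith
        have : 0 ≤ c / Kd d * (∫ x, ‖gradient (fun x => η x * u x) x‖ ^ 2) := by positivity
        linarith
    have hac' : Continuous (fun x => a (x - y)) := hac.comp (continuous_id.sub continuous_const)
    have hbc' : Continuous (fun x => b (x - y)) := hbc.comp (continuous_id.sub continuous_const)
    have j1 : Integrable (fun x => ‖gradient u x‖ ^ 2 * a (x - y)) :=
      (hgc.mul hac').integrable_of_hasCompactSupport hgs.mul_right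
    have j2 : Integrable (fun x => u x ^ 2 * b (x - y)) :=
      (hu2c.mul hbc').integrable_of_hasCompactSupport hu2s.mul_right
    have e0 : ∀ x, W x * u x ^ 2 * a (x - y) = W x * (η x * u x) ^ 2 := fun x => by rw [hηa]; ring
    simp only [e0]
    refine hmain.trans ?_
    rw [← integral_const_mul, ← integral_const_mul, ← integral_add (hgg.const_mul _) (hgi2.const_mul _),
      ← integral_add j1 j2]
    refine integral_mono ((hgg.const_mul _).add (hgi2.const_mul _)) (j1.add j2) fun x => ?_
    simp only [hηa, hηb]
    have hp := grad_prod η u x (hη1.differentiable one_ne_zero x) (hu1.differentiable one_ne_zero x) δ hδ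
    have hq : c / Kd d * (1 + δ) ≤ 1 := by
      rw [div_mul_eq_mul_div, div_le_one hKpos]; exact hδK
    have hcK : 0 ≤ c / Kd d := by positivity
    have hp2 := mul_le_mul_of_nonneg_left hp hcK
    have hq2 := mul_le_mul_of_nonneg_right hq (show 0 ≤ η x ^ 2 * ‖gradient u x‖ ^ 2 by positivity)
    rw [hC']
    nlinarith [hp2, hq2]
  -- integrate over `y`
  have hlint : ∀ y : EuclideanSpace ℝ (Fin d),
      ∫⁻ x, ENNReal.ofReal (W x * u x ^ 2 * a (x - y)) ≤
        (∫⁻ x, ENNReal.ofReal (‖gradient u x‖ ^ 2 * a (x - y))) +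
          ∫⁻ x, ENNReal.ofReal (u x ^ 2 * b (x - y)) := by
    intro y
    have hac' : Continuous (fun x => a (x - y)) := hac.comp (continuous_id.sub continuous_const)
    have hbc' : Continuous (fun x => b (x - y)) := hbc.comp (continuous_id.sub continuous_const)
    have j1 : Integrable (fun x => ‖gradient u x‖ ^ 2 * a (x - y)) :=
      (hgc.mul hac').integrable_of_hasCompactSupport hgs.mul_right
    have j2 : Integrable (fun x => u x ^ 2 * b (x - y)) :=
      (hu2c.mul hbc').integrable_of_hasCompactSupport hu2s.mul_right
    have j3 : Integrable (fun x => W x * u x ^ 2 * a (x - y)) := by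
      simp only [mul_assoc]
      exact loc_int W (fun x => u x ^ 2 * a (x - y)) hW hWloc (hu2c.mul hac') hu2s.mul_right
    rw [← ofReal_integral_eq_lintegral_ofReal j1
        (Eventually.of_forall fun x => mul_nonneg (sq_nonneg _) (ha0 _)),
      ← ofReal_integral_eq_lintegral_ofReal j2
        (Eventually.of_forall fun x => mul_nonneg (sq_nonneg _) (hb0 _)),
      ← ofReal_integral_eq_lintegral_ofReal j3
        (Eventually.of_forall fun x => mul_nonneg (mul_nonneg (hW0 x) (sq_nonneg _)) (ha0 _)),
      ← ENNReal.ofReal_add (integral_nonneg fun x => mul_nonneg (sq_nonneg _) (ha0 _))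
        (integral_nonneg fun x => mul_nonneg (sq_nonneg _) (hb0 _))]
    exact ENNReal.ofReal_le_ofReal (hlocal y)
  have hall := lintegral_mono (μ := (volume : Measure (EuclideanSpace ℝ (Fin d)))) hlint
  have hm : Measurable (fun y : EuclideanSpace ℝ (Fin d) =>
      ∫⁻ x, ENNReal.ofReal (‖gradient u x‖ ^ 2 * a (x - y))) := by
    refine Measurable.lintegral_prod_right ?_
    exact ((hgc.measurable.comp measurable_snd).mul
      (hac.measurable.comp (measurable_snd.sub measurable_fst))).ennreal_ofReal
  rw [lintegral_add_left hm, avg_lint (fun x => W x * u x ^ 2) _ (hW.mul hu2c.measurable) (fun x => mul_nonneg (hW0 x) (sq_nonneg _)) hac.measurable,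
    avg_lint _ _ hgc.measurable (fun x => sq_nonneg _) hac.measurable,
    avg_lint _ _ hu2c.measurable (fun x => sq_nonneg _) hbc.measurable] at hall
  have q1 : 0 ≤ ∫ x, W x * u x ^ 2 := integral_nonneg fun x => mul_nonneg (hW0 x) (sq_nonneg _)
  have q2 : 0 ≤ ∫ x, ‖gradient u x‖ ^ 2 := integral_nonneg fun x => sq_nonneg _
  have q3 : 0 ≤ ∫ x, u x ^ 2 := integral_nonneg fun x => sq_nonneg _
  have q4 : 0 ≤ ∫ x, b x := integral_nonneg hb0
  rw [← ofReal_integral_eq_lintegral_ofReal hiW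
      (Eventually.of_forall fun x => mul_nonneg (hW0 x) (sq_nonneg _)),
    ← ofReal_integral_eq_lintegral_ofReal hi1 (Eventually.of_forall fun x => sq_nonneg _),
    ← ofReal_integral_eq_lintegral_ofReal hi2 (Eventually.of_forall fun x => sq_nonneg _),
    ← ofReal_integral_eq_lintegral_ofReal hai (Eventually.of_forall ha0),
    ← ofReal_integral_eq_lintegral_ofReal hbi (Eventually.of_forall hb0),
    ← ENNReal.ofReal_mul q1, ← ENNReal.ofReal_mul q2, ← ENNReal.ofReal_mul q3,
    ← ENNReal.ofReal_add (mul_nonneg q2 hS.le) (mul_nonneg q3 q4),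
    ENNReal.ofReal_le_ofReal_iff (add_nonneg (mul_nonneg q2 hS.le) (mul_nonneg q3 q4))] at hall
  have hfin : ∫ x, W x * u x ^ 2 ≤
      (∫ x, ‖gradient u x‖ ^ 2) + (∫ x, b x) / (∫ x, a x) * ∫ x, u x ^ 2 := by
    rw [← mul_le_mul_iff_left₀ hS]
    refine hall.trans (le_of_eq ?_)
    field_simp
  have hVW : -∫ x, W x * u x ^ 2 ≤ ∫ x, V x * u x ^ 2 := by
    rw [← integral_neg]
    refine integral_mono hiW.neg hiV fun x => ?_
    simp only [← neg_mul]
    exact mul_le_mul_of_nonneg_right (hWV x) (sq_nonneg _)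
  rw [integral_add hi1 hiV]
  linarith
end

section
/- Let d ≥ 3 and V ∈ L_{∞,loc}(ℝ^d). Let G ⊂ ℝ^d be an open bounded set with diam(G) = 2 that contains a ball B_ρ₀(0) (ρ₀ > 0) and is star-shaped with respect to every point of B_ρ₀(0), and set G_r(y) = {x ∈ ℝ^d : x/r ∈ G} + y. Let r₀ > 0. Suppose that for every y ∈ ℝ^d the function V₋ belongs to L_{d/2}(G_{r₀}(y)) and that the integrals I_y(N) = ∫_{G_{r₀}(y)} ((V(x) + N)₋)^{d/2} dx tend to 0 as N → +∞ uniformly in y ∈ ℝ^d (for every ε > 0 there is N₀ such that I_y(N) ≤ ε for all N ≥ N₀ and all y). Then the Schrödinger operator H = −Δ + V is bounded below: there exists C ∈ ℝ such that ∫_{ℝ^d}(|∇u|² + V|u|²) dx ≥ −C ∫_{ℝ^d}|u|² dx for all u ∈ C₀^∞(ℝ^d). -/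
open MeasureTheory Metric Filter

open scoped ENNReal NNReal

/-- Hölder + Sobolev for a function supported in `B`. -/
lemma holder_sobolev (d : ℕ) (hd : 3 ≤ d) : ∃ S : ℝ≥0, ∀ (W : EuclideanSpace ℝ (Fin d) → ℝ≥0∞)
    (B : Set (EuclideanSpace ℝ (Fin d))) (v : EuclideanSpace ℝ (Fin d) → ℝ), Measurable W →
    MeasurableSet B → ContDiff ℝ 1 v → HasCompactSupport v → (∀ x, x ∉ B → v x = 0) →
    ∫⁻ x, W x * ‖v x‖ₑ ^ 2 ≤ (∫⁻ x in B, W x ^ ((d : ℝ) / 2)) ^ (2 / (d : ℝ)) *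
      (S * ∫⁻ x, ‖fderiv ℝ v x‖ₑ ^ 2) := by
  have hd' : (3 : ℝ) ≤ d := by exact_mod_cast hd
  refine ⟨(eLpNormLESNormFDerivOfEqInnerConst
    (volume : Measure (EuclideanSpace ℝ (Fin d))) (2 : ℝ≥0)) ^ 2, ?_⟩
  intro W B v hW hB hv hvc hvB
  set q : ℝ≥0 := ⟨2 * d / (d - 2), by apply div_nonneg <;> linarith⟩ with hq
  have hqr : (q : ℝ) = 2 * d / (d - 2) := rfl
  have hq0 : (0 : ℝ) < q := by rw [hqr]; apply div_pos <;> linarith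
  have hsob := eLpNorm_le_eLpNorm_fderiv_of_eq_inner
    (volume : Measure (EuclideanSpace ℝ (Fin d))) hv hvc (p := 2) (p' := q)
    (by norm_num) (by simp; omega) (by
      rw [hqr]; simp
      have : (d : ℝ) - 2 ≠ 0 := by linarith
      have : (d : ℝ) ≠ 0 := by linarith
      field_simp)
  have hsq : (∫⁻ x, ‖v x‖ₑ ^ (q : ℝ)) ^ (2 / (q : ℝ)) ≤
      (((eLpNormLESNormFDerivOfEqInnerConst
        (volume : Measure (EuclideanSpace ℝ (Fin d))) (2 : ℝ≥0)) ^ 2 : ℝ≥0) : ℝ≥0∞) *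
        ∫⁻ x, ‖fderiv ℝ v x‖ₑ ^ 2 := by
    have h2 := pow_le_pow_left' hsob 2
    rw [mul_pow] at h2
    have hL : eLpNorm v q volume ^ 2 = (∫⁻ x, ‖v x‖ₑ ^ (q : ℝ)) ^ (2 / (q : ℝ)) := by
      rw [eLpNorm_eq_lintegral_rpow_enorm_toReal (by exact_mod_cast hq0.ne') (by simp)]
      rw [← ENNReal.rpow_natCast, ← ENNReal.rpow_mul]
      simp [div_eq_mul_inv, mul_comm]
    have hR : eLpNorm (fderiv ℝ v) (2 : ℝ≥0) volume ^ 2 = ∫⁻ x, ‖fderiv ℝ v x‖ₑ ^ 2 := by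
      rw [eLpNorm_eq_lintegral_rpow_enorm_toReal (by simp) (by simp)]
      rw [← ENNReal.rpow_natCast, ← ENNReal.rpow_mul]
      simp
    rw [hL, hR] at h2
    simpa using h2
  have hvm : Measurable v := hv.continuous.measurable
  have hconj : Real.HolderConjugate ((d : ℝ) / 2) ((q : ℝ) / 2) := by
    rw [Real.holderConjugate_iff, hqr]
    constructor
    · linarith
    · have : (d : ℝ) - 2 ≠ 0 := by linarith
      have : (d : ℝ) ≠ 0 := by linarith
      field_simp
      ring
  calc ∫⁻ x, W x * ‖v x‖ₑ ^ 2 = ∫⁻ x in B, (W * fun x => ‖v x‖ₑ ^ 2) x := by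
        rw [← lintegral_indicator hB]
        congr 1; ext x
        by_cases hx : x ∈ B
        · simp [hx]
        · simp [hx, hvB x hx]
    _ ≤ (∫⁻ x in B, W x ^ ((d : ℝ) / 2)) ^ (1 / ((d : ℝ) / 2)) *
        (∫⁻ x in B, (‖v x‖ₑ ^ 2) ^ ((q : ℝ) / 2)) ^ (1 / ((q : ℝ) / 2)) :=
        ENNReal.lintegral_mul_le_Lp_mul_Lq _ hconj hW.aemeasurable
          (hvm.enorm.pow_const 2).aemeasurable
    _ ≤ _ := by
        rw [one_div_div, one_div_div]
        gcongr
        refine le_trans ?_ hsq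
        refine ENNReal.rpow_le_rpow ?_ (by positivity)
        refine (setLIntegral_le_lintegral _ _).trans (le_of_eq ?_)
        congr 1; ext x
        rw [← ENNReal.rpow_natCast, ← ENNReal.rpow_mul]
        congr 1; push_cast; ring

lemma fderiv_prod_bound {d : ℕ} {f g : EuclideanSpace ℝ (Fin d) → ℝ} (hf : ContDiff ℝ 1 f)
    (hg : ContDiff ℝ 1 g) (x : EuclideanSpace ℝ (Fin d)) :
    ‖fderiv ℝ (fun z => f z * g z) x‖ₑ ^ 2 ≤
      2 * (‖f x‖ₑ ^ 2 * ‖fderiv ℝ g x‖ₑ ^ 2 + ‖fderiv ℝ f x‖ₑ ^ 2 * ‖g x‖ₑ ^ 2) := by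
  rw [fderiv_fun_mul (hf.differentiable one_ne_zero x) (hg.differentiable one_ne_zero x)]
  have h : ‖f x • fderiv ℝ g x + g x • fderiv ℝ f x‖ ^ 2 ≤
      2 * (‖f x‖ ^ 2 * ‖fderiv ℝ g x‖ ^ 2 + ‖fderiv ℝ f x‖ ^ 2 * ‖g x‖ ^ 2) := by
    have h1 := norm_add_le (f x • fderiv ℝ g x) (g x • fderiv ℝ f x)
    rw [norm_smul, norm_smul] at h1
    have h2 := pow_le_pow_left₀ (norm_nonneg _) h1 2
    nlinarith [sq_nonneg (‖f x‖ * ‖fderiv ℝ g x‖ - ‖g x‖ * ‖fderiv ℝ f x‖)]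
  have hfin := ENNReal.ofReal_le_ofReal h
  rw [ENNReal.ofReal_mul (by norm_num), ENNReal.ofReal_add (by positivity) (by positivity),
    ENNReal.ofReal_mul (by positivity), ENNReal.ofReal_mul (by positivity)] at hfin
  simp only [ENNReal.ofReal_pow (norm_nonneg _), ofReal_norm] at hfin
  simpa using hfin

/-- averaging over translates -/
lemma lintegral_translate {d : ℕ} (a b : EuclideanSpace ℝ (Fin d) → ℝ≥0∞) (ha : Measurable a)
    (hb : Measurable b) :
    ∫⁻ y, ∫⁻ x, a (x - y) * b x = (∫⁻ z, a z) * ∫⁻ x, b x := by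
  rw [lintegral_lintegral_swap (by fun_prop)]
  have : ∀ x, ∫⁻ y, a (x - y) * b x = (∫⁻ z, a z) * b x := by
    intro x
    rw [lintegral_mul_const _ (by fun_prop), lintegral_sub_left_eq_self a x]
  simp_rw [this]
  rw [lintegral_const_mul _ hb]

lemma localized (d : ℕ) (hd : 3 ≤ d) (δ : ℝ) (hδ : 0 < δ) :
    ∃ ε > (0 : ℝ), ∃ K : ℝ≥0, ∀ W : EuclideanSpace ℝ (Fin d) → ℝ≥0∞, Measurable W →
      (∀ y, ∫⁻ x in ball y δ, W x ^ ((d : ℝ) / 2) ≤ ENNReal.ofReal ε) →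
      ∀ u : EuclideanSpace ℝ (Fin d) → ℝ, ContDiff ℝ 1 u → HasCompactSupport u →
      ∫⁻ x, W x * ‖u x‖ₑ ^ 2 ≤ (∫⁻ x, ‖fderiv ℝ u x‖ₑ ^ 2) + K * ∫⁻ x, ‖u x‖ₑ ^ 2 := by
  obtain ⟨S, hS⟩ := holder_sobolev d hd
  have hd' : (3 : ℝ) ≤ d := by exact_mod_cast hd
  let χ : ContDiffBump (0 : EuclideanSpace ℝ (Fin d)) := ⟨δ / 2, δ, by linarith, by linarith⟩
  have hχ : ContDiff ℝ 1 (χ : EuclideanSpace ℝ (Fin d) → ℝ) := χ.contDiff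
  have hχc : HasCompactSupport (χ : EuclideanSpace ℝ (Fin d) → ℝ) := χ.hasCompactSupport
  have hχd : Continuous (fderiv ℝ (χ : EuclideanSpace ℝ (Fin d) → ℝ)) :=
    hχ.continuous_fderiv one_ne_zero
  set c0 : ℝ≥0∞ := ∫⁻ z, ‖χ z‖ₑ ^ 2 with hc0
  set k0 : ℝ≥0∞ := ∫⁻ z, ‖fderiv ℝ (χ : EuclideanSpace ℝ (Fin d) → ℝ) z‖ₑ ^ 2 with hk0
  have key : ∀ {F : Type} [NormedAddCommGroup F] (f : EuclideanSpace ℝ (Fin d) → F),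
      Continuous f → HasCompactSupport f → ∫⁻ z, ‖f z‖ₑ ^ 2 ≠ ⊤ := by
    intro F _ f hf hfc
    have h := (hf.memLp_of_hasCompactSupport (p := 2) (μ := volume) hfc).eLpNorm_lt_top
    rw [eLpNorm_eq_lintegral_rpow_enorm_toReal (by simp) (by simp)] at h
    intro htop
    simp [htop] at h
  have hc0t : c0 ≠ ⊤ := key _ hχ.continuous hχc
  have hk0t : k0 ≠ ⊤ := key _ hχd (hχc.fderiv ℝ)
  have hc00 : c0 ≠ 0 := by
    have hχm := hχ.continuous
    rw [hc0, Ne, lintegral_eq_zero_iff (by fun_prop)]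
    intro h
    have hfin := (Continuous.ae_eq_iff_eq (μ := (volume : Measure (EuclideanSpace ℝ (Fin d))))
      (by fun_prop) continuous_zero).1 h
    have h0 := congrFun hfin 0
    have h1 : χ 0 = 1 := χ.one_of_mem_closedBall (by simp [χ]; linarith)
    simp [h1] at h0
  obtain ⟨ε, hε, hεS⟩ : ∃ ε > (0:ℝ), (ENNReal.ofReal ε) ^ (2 / (d:ℝ)) * (S * 2) ≤ 1 := by
    refine ⟨((S * 2 + 1 : ℝ)⁻¹) ^ ((d : ℝ) / 2), by positivity, ?_⟩
    rw [ENNReal.ofReal_rpow_of_nonneg (by positivity) (by positivity), ← Real.rpow_mul (by positivity)]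
    have : (d : ℝ) / 2 * (2 / d) = 1 := by
      have : (d : ℝ) ≠ 0 := by linarith
      field_simp
    rw [this, Real.rpow_one]
    have e : (S : ℝ≥0∞) * 2 = ENNReal.ofReal (S * 2) := by
      rw [ENNReal.ofReal_mul (by positivity)]; simp
    rw [e, ← ENNReal.ofReal_mul (by positivity)]
    apply ENNReal.ofReal_le_one.2
    rw [inv_mul_le_iff₀ (by positivity)]
    linarith
  refine ⟨ε, hε, (k0 / c0).toNNReal, ?_⟩
  intro W hW hWε u hu huc
  rw [ENNReal.coe_toNNReal (ENNReal.div_ne_top hk0t hc00)]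
  have hum := hu.continuous
  have hud : Continuous (fderiv ℝ u) := hu.continuous_fderiv one_ne_zero
  have hχm := hχ.continuous
  have hy : ∀ y, ∫⁻ x, ‖χ (x - y)‖ₑ ^ 2 * (W x * ‖u x‖ₑ ^ 2) ≤
      ∫⁻ x, (‖χ (x - y)‖ₑ ^ 2 * ‖fderiv ℝ u x‖ₑ ^ 2 +
        ‖fderiv ℝ (χ : EuclideanSpace ℝ (Fin d) → ℝ) (x - y)‖ₑ ^ 2 * ‖u x‖ₑ ^ 2) := by
    intro y
    have hτ : ContDiff ℝ 1 (fun x => χ (x - y)) := hχ.comp (contDiff_id.sub contDiff_const)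
    have h1 := hS W (ball y δ) (fun x => χ (x - y) * u x) hW measurableSet_ball
      (hτ.mul hu) huc.mul_left (by
        intro x hx
        have : χ (x - y) = 0 := χ.zero_of_le_dist (by
          simp only [mem_ball, not_lt] at hx
          simpa [χ, dist_eq_norm] using hx)
        simp [this])
    have h2 : ∫⁻ x, ‖fderiv ℝ (fun x => χ (x - y) * u x) x‖ₑ ^ 2 ≤
        2 * ∫⁻ x, (‖χ (x - y)‖ₑ ^ 2 * ‖fderiv ℝ u x‖ₑ ^ 2 +
        ‖fderiv ℝ (χ : EuclideanSpace ℝ (Fin d) → ℝ) (x - y)‖ₑ ^ 2 * ‖u x‖ₑ ^ 2) := by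
      rw [← lintegral_const_mul _ (by fun_prop)]
      refine lintegral_mono fun x => ?_
      have := fderiv_prod_bound hτ hu x
      have e : fderiv ℝ (fun x => χ (x - y)) x =
          fderiv ℝ (χ : EuclideanSpace ℝ (Fin d) → ℝ) (x - y) := by
        rw [fderiv_comp_sub]
      rwa [e] at this
    set J := ∫⁻ x, (‖χ (x - y)‖ₑ ^ 2 * ‖fderiv ℝ u x‖ₑ ^ 2 +
        ‖fderiv ℝ (χ : EuclideanSpace ℝ (Fin d) → ℝ) (x - y)‖ₑ ^ 2 * ‖u x‖ₑ ^ 2) with hJ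
    calc ∫⁻ x, ‖χ (x - y)‖ₑ ^ 2 * (W x * ‖u x‖ₑ ^ 2)
        = ∫⁻ x, W x * ‖χ (x - y) * u x‖ₑ ^ 2 := by
          congr 1; ext x; rw [enorm_mul]; ring
      _ ≤ _ := h1
      _ ≤ (ENNReal.ofReal ε) ^ (2 / (d:ℝ)) * (S * (2 * J)) := by
          gcongr
          exact hWε y
      _ = ((ENNReal.ofReal ε) ^ (2 / (d:ℝ)) * (S * 2)) * J := by ring
      _ ≤ 1 * J := by gcongr
      _ = _ := one_mul _
  have hI := lintegral_mono (μ := (volume : Measure (EuclideanSpace ℝ (Fin d)))) hy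
  rw [lintegral_translate (fun z => ‖χ z‖ₑ ^ 2) _ (by fun_prop) (by fun_prop)] at hI
  have hR : ∫⁻ y, ∫⁻ x, (‖χ (x - y)‖ₑ ^ 2 * ‖fderiv ℝ u x‖ₑ ^ 2 +
        ‖fderiv ℝ (χ : EuclideanSpace ℝ (Fin d) → ℝ) (x - y)‖ₑ ^ 2 * ‖u x‖ₑ ^ 2) =
      c0 * (∫⁻ x, ‖fderiv ℝ u x‖ₑ ^ 2) + k0 * ∫⁻ x, ‖u x‖ₑ ^ 2 := by
    rw [← lintegral_translate (fun z => ‖χ z‖ₑ ^ 2) _ (by fun_prop) (by fun_prop),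
      ← lintegral_translate (fun z => ‖fderiv ℝ (χ : EuclideanSpace ℝ (Fin d) → ℝ) z‖ₑ ^ 2) _
        (by fun_prop) (by fun_prop), ← lintegral_add_left]
    · congr 1; ext y
      rw [lintegral_add_left (by fun_prop)]
    · exact Measurable.lintegral_prod_right' (f := fun p : _ × _ =>
        ‖χ (p.2 - p.1)‖ₑ ^ 2 * ‖fderiv ℝ u p.2‖ₑ ^ 2) (by fun_prop)
  have hI2 := hI.trans hR.le
  rw [← ENNReal.mul_le_mul_iff_right hc00 hc0t]
  refine hI2.trans (le_of_eq ?_)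
  rw [mul_add, ← mul_assoc c0 (k0 / c0), ENNReal.mul_div_cancel hc00 hc0t]

theorem statement7 (d : ℕ) (hd : 3 ≤ d) (V : EuclideanSpace ℝ (Fin d) → ℝ)
    (hVmeas : Measurable V)
    (hVloc : ∀ K : Set (EuclideanSpace ℝ (Fin d)), IsCompact K →
      ∃ M : ℝ, ∀ x ∈ K, |V x| ≤ M)
    (G : Set (EuclideanSpace ℝ (Fin d))) (ρ₀ : ℝ) (hρ₀ : 0 < ρ₀)
    (hGopen : IsOpen G) (hGbdd : Bornology.IsBounded G) (hGdiam : Metric.diam G = 2)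
    (hGball : ball (0 : EuclideanSpace ℝ (Fin d)) ρ₀ ⊆ G)
    (hGstar : ∀ c ∈ ball (0 : EuclideanSpace ℝ (Fin d)) ρ₀, StarConvex ℝ c G)
    (r₀ : ℝ) (hr₀ : 0 < r₀)
    (hVneg : ∀ y : EuclideanSpace ℝ (Fin d),
      IntegrableOn (fun x => (max (-V x) 0) ^ ((d : ℝ) / 2)) (Gr G r₀ y))
    (hunif : ∀ ε > (0:ℝ), ∃ N₀ : ℝ, ∀ N : ℝ, N₀ ≤ N → ∀ y : EuclideanSpace ℝ (Fin d),
      (∫ x in Gr G r₀ y, (max (-(V x + N)) 0) ^ ((d : ℝ) / 2)) ≤ ε) :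
    ∃ C : ℝ, ∀ u : EuclideanSpace ℝ (Fin d) → ℝ, ContDiff ℝ (⊤ : ℕ∞) u → HasCompactSupport u →
      -C * ∫ x, (u x) ^ 2 ≤ ∫ x, (‖gradient u x‖ ^ 2 + V x * (u x) ^ 2) := by
  obtain ⟨ε, hε, K, hK⟩ := localized d hd (r₀ * ρ₀) (by positivity)
  obtain ⟨N₀, hN₀⟩ := hunif ε hε
  set N := max N₀ 0 with hN
  have hN0 : 0 ≤ N := le_max_right _ _
  set W : EuclideanSpace ℝ (Fin d) → ℝ := fun x => max (-(V x + N)) 0 with hWdef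
  have hWm : Measurable W := by fun_prop
  have hW0 : ∀ x, 0 ≤ W x := fun x => le_max_right _ _
  have hWV : ∀ x, W x ≤ max (-V x) 0 := fun x => max_le_max (by linarith) le_rfl
  have hVW : ∀ x, -N - W x ≤ V x := fun x => by
    have : -(V x + N) ≤ W x := le_max_left _ _
    linarith
  have hsub : ∀ y, ball y (r₀ * ρ₀) ⊆ Gr G r₀ y := by
    intro y x hx
    apply hGball
    rw [mem_ball_zero_iff, norm_smul, norm_inv, Real.norm_of_nonneg hr₀.le,
      inv_mul_lt_iff₀ hr₀, ← dist_eq_norm]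
    exact hx
  have hball : ∀ y, ∫⁻ x in ball y (r₀ * ρ₀), ENNReal.ofReal (W x) ^ ((d : ℝ) / 2) ≤
      ENNReal.ofReal ε := by
    intro y
    have hint : IntegrableOn (fun x => W x ^ ((d : ℝ) / 2)) (Gr G r₀ y) := by
      refine Integrable.mono' (hVneg y)
        (hWm.pow_const _).aestronglyMeasurable (Eventually.of_forall fun x => ?_)
      rw [Real.norm_of_nonneg (Real.rpow_nonneg (hW0 x) _)]
      exact Real.rpow_le_rpow (hW0 x) (hWV x) (by positivity)
    calc _ ≤ ∫⁻ x in Gr G r₀ y, ENNReal.ofReal (W x) ^ ((d : ℝ) / 2) :=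
          lintegral_mono_set (hsub y)
      _ = ∫⁻ x in Gr G r₀ y, ENNReal.ofReal (W x ^ ((d : ℝ) / 2)) := by
          congr 1; ext x
          rw [ENNReal.ofReal_rpow_of_nonneg (hW0 x) (by positivity)]
      _ = ENNReal.ofReal (∫ x in Gr G r₀ y, W x ^ ((d : ℝ) / 2)) :=
          (ofReal_integral_eq_lintegral_ofReal hint
            (Eventually.of_forall fun x => Real.rpow_nonneg (hW0 x) _)).symm
      _ ≤ _ := ENNReal.ofReal_le_ofReal (hN₀ N (le_max_left _ _) y)
  refine ⟨N + K, fun u hu' huc => ?_⟩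
  have hu : ContDiff ℝ 1 u := hu'.of_le (by exact_mod_cast le_top)
  have hmain := hK (fun x => ENNReal.ofReal (W x)) (by fun_prop) hball u hu huc
  have hum := hu.continuous
  have hud : Continuous (fderiv ℝ u) := hu.continuous_fderiv one_ne_zero
  have hgrad : ∀ x, ‖gradient u x‖ = ‖fderiv ℝ u x‖ := fun x => by
    simp [gradient]
  simp_rw [hgrad]
  have hu2 : Integrable (fun x => u x ^ 2) := by
    refine Continuous.integrable_of_hasCompactSupport (by fun_prop) ?_
    exact huc.comp_left (g := fun t : ℝ => t ^ 2) (by simp)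
  have hd2 : Integrable (fun x => ‖fderiv ℝ u x‖ ^ 2) := by
    refine Continuous.integrable_of_hasCompactSupport (by fun_prop) ?_
    exact (huc.fderiv ℝ).comp_left (g := fun t => ‖t‖ ^ 2) (by simp)
  obtain ⟨M, hM⟩ := hVloc (tsupport u) huc
  have hVu : Integrable (fun x => V x * u x ^ 2) := by
    refine Integrable.mono' (hu2.const_mul M) (by fun_prop) (Eventually.of_forall fun x => ?_)
    by_cases hx : x ∈ tsupport u
    · rw [norm_mul, Real.norm_of_nonneg (sq_nonneg (u x)), Real.norm_eq_abs]
      gcongr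
      exact hM x hx
    · simp [image_eq_zero_of_notMem_tsupport hx]
  have hWu : Integrable (fun x => W x * u x ^ 2) := by
    refine Integrable.mono' hVu.norm (by fun_prop) (Eventually.of_forall fun x => ?_)
    rw [norm_mul, norm_mul]
    gcongr
    rw [Real.norm_of_nonneg (hW0 x), Real.norm_eq_abs]
    exact (hWV x).trans (max_le (neg_le_abs _) (abs_nonneg _))
  have e1 : ∫⁻ x, ENNReal.ofReal (W x) * ‖u x‖ₑ ^ 2 = ENNReal.ofReal (∫ x, W x * u x ^ 2) := by
    rw [ofReal_integral_eq_lintegral_ofReal hWu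
      (Eventually.of_forall fun x => mul_nonneg (hW0 x) (sq_nonneg _))]
    congr 1; ext x
    rw [ENNReal.ofReal_mul (hW0 x), ← sq_abs (u x), ENNReal.ofReal_pow (abs_nonneg _),
      ← Real.norm_eq_abs, ofReal_norm]
  have e2 : ∫⁻ x, ‖u x‖ₑ ^ 2 = ENNReal.ofReal (∫ x, u x ^ 2) := by
    rw [ofReal_integral_eq_lintegral_ofReal hu2 (Eventually.of_forall fun x => sq_nonneg _)]
    congr 1; ext x
    rw [← sq_abs (u x), ENNReal.ofReal_pow (abs_nonneg _),
      ← Real.norm_eq_abs, ofReal_norm]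
  have e3 : ∫⁻ x, ‖fderiv ℝ u x‖ₑ ^ 2 = ENNReal.ofReal (∫ x, ‖fderiv ℝ u x‖ ^ 2) := by
    rw [ofReal_integral_eq_lintegral_ofReal hd2 (Eventually.of_forall fun x => sq_nonneg _)]
    congr 1; ext x
    rw [ENNReal.ofReal_pow (norm_nonneg _), ofReal_norm]
  have p2 : 0 ≤ ∫ x, u x ^ 2 := integral_nonneg fun x => sq_nonneg _
  have p3 : 0 ≤ ∫ x, ‖fderiv ℝ u x‖ ^ 2 := integral_nonneg fun x => sq_nonneg _
  have hreal : ∫ x, W x * u x ^ 2 ≤ (∫ x, ‖fderiv ℝ u x‖ ^ 2) + K * ∫ x, u x ^ 2 := by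
    rw [e1, e2, e3, ← ENNReal.ofReal_coe_nnreal, ← ENNReal.ofReal_mul (by positivity),
      ← ENNReal.ofReal_add p3 (by positivity)] at hmain
    exact (ENNReal.ofReal_le_ofReal_iff (by positivity)).1 hmain
  rw [integral_add hd2 hVu]
  have hlow : -N * (∫ x, u x ^ 2) - ∫ x, W x * u x ^ 2 ≤ ∫ x, V x * u x ^ 2 := by
    rw [← integral_const_mul, ← integral_sub (hu2.const_mul _) hWu]
    refine integral_mono ((hu2.const_mul _).sub hWu) hVu fun x => ?_
    have := mul_le_mul_of_nonneg_right (hVW x) (sq_nonneg (u x))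
    simp only
    linarith
  linarith
end

section
/- Let d ≥ 3 and let V : ℝ^d → [0, ∞) be locally integrable. Then the following three conditions are equivalent: (1) for every r > 0, ∫_{B_r(y)} V(x) dx → +∞ as |y| → ∞; (2) for every r > 0 and every A > 0, mes₁({t ∈ (0,r) : ∫_{B_t(y)} V(x) dx ≤ A}) → 0 as |y| → ∞; (3) for every r > 0 and every A > 0, mes₂({(s,t) : 0 < s < t < r and ∫_{B_t(y) \ closure(B_s(y))} V(x) dx ≤ A}) → 0 as |y| → ∞. -/
open MeasureTheory Metric Filter

lemma aux_mono {d : ℕ} {V : EuclideanSpace ℝ (Fin d) → ℝ}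
    (hVnn : ∀ x, 0 ≤ V x) (hVloc : LocallyIntegrable V volume)
    {S T : Set (EuclideanSpace ℝ (Fin d))} {y : EuclideanSpace ℝ (Fin d)} {r : ℝ}
    (hST : S ⊆ T) (hT : T ⊆ ball y r) : ∫ x in S, V x ≤ ∫ x in T, V x := by
  have hi : IntegrableOn V T volume :=
    (hVloc.integrableOn_isCompact (isCompact_closedBall y r)).mono_set
      (hT.trans ball_subset_closedBall)
  exact setIntegral_mono_set hi (Filter.Eventually.of_forall hVnn) hST.eventuallyLE

lemma aux_annulus {d : ℕ} (hd : 3 ≤ d) (y : EuclideanSpace ℝ (Fin d)) {s t δ : ℝ}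
    (hs : 0 < s) (hδ : 0 < δ) (hst : s + δ ≤ t) :
    ∃ z : EuclideanSpace ℝ (Fin d), ‖y‖ - t ≤ ‖z‖ ∧
      ball z (δ / 2) ⊆ ball y t \ closure (ball y s) := by
  obtain ⟨e, he⟩ : ∃ e : EuclideanSpace ℝ (Fin d), ‖e‖ = 1 :=
    ⟨EuclideanSpace.single (⟨0, by omega⟩ : Fin d) (1 : ℝ), by simp⟩
  have hv : ‖((s + t) / 2) • e‖ = (s + t) / 2 := by
    rw [norm_smul, he, Real.norm_eq_abs, abs_of_pos (by linarith), mul_one]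
  have hd' : dist (y + ((s + t) / 2) • e) y = (s + t) / 2 := by
    rw [dist_eq_norm, add_sub_cancel_left, hv]
  refine ⟨y + ((s + t) / 2) • e, ?_, ?_⟩
  · have := norm_sub_le (y + ((s + t) / 2) • e) (((s + t) / 2) • e)
    rw [add_sub_cancel_right, hv] at this
    linarith
  · intro x hx
    rw [mem_ball] at hx
    refine ⟨?_, fun hx2 => ?_⟩
    · rw [mem_ball]
      have := dist_triangle x (y + ((s + t) / 2) • e) y
      linarith
    · have h2 := closure_ball_subset_closedBall hx2
      rw [mem_closedBall] at h2
      have := dist_triangle_left (y + ((s + t) / 2) • e) y x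
      linarith

theorem statement11 (d : ℕ) (hd : 3 ≤ d) (V : EuclideanSpace ℝ (Fin d) → ℝ)
    (hVnn : ∀ x, 0 ≤ V x) (hVloc : LocallyIntegrable V volume) :
    ((∀ r > (0:ℝ), ∀ A : ℝ, ∃ R : ℝ, ∀ y : EuclideanSpace ℝ (Fin d), R ≤ ‖y‖ →
        A ≤ ∫ x in ball y r, V x) ↔
      (∀ r > (0:ℝ), ∀ A > (0:ℝ), ∀ ε > (0:ℝ), ∃ R : ℝ,
        ∀ y : EuclideanSpace ℝ (Fin d), R ≤ ‖y‖ →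
          volume {t : ℝ | t ∈ Set.Ioo 0 r ∧ (∫ x in ball y t, V x) ≤ A} ≤
            ENNReal.ofReal ε)) ∧
    ((∀ r > (0:ℝ), ∀ A > (0:ℝ), ∀ ε > (0:ℝ), ∃ R : ℝ,
        ∀ y : EuclideanSpace ℝ (Fin d), R ≤ ‖y‖ →
          volume {t : ℝ | t ∈ Set.Ioo 0 r ∧ (∫ x in ball y t, V x) ≤ A} ≤
            ENNReal.ofReal ε) ↔
      (∀ r > (0:ℝ), ∀ A > (0:ℝ), ∀ ε > (0:ℝ), ∃ R : ℝ,
        ∀ y : EuclideanSpace ℝ (Fin d), R ≤ ‖y‖ →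
          volume {p : ℝ × ℝ | 0 < p.1 ∧ p.1 < p.2 ∧ p.2 < r ∧
            (∫ x in ball y p.2 \ closure (ball y p.1), V x) ≤ A} ≤
            ENNReal.ofReal ε)) := by
  have h12 : (∀ r > (0:ℝ), ∀ A : ℝ, ∃ R : ℝ, ∀ y : EuclideanSpace ℝ (Fin d), R ≤ ‖y‖ →
        A ≤ ∫ x in ball y r, V x) → (∀ r > (0:ℝ), ∀ A > (0:ℝ), ∀ ε > (0:ℝ), ∃ R : ℝ,
        ∀ y : EuclideanSpace ℝ (Fin d), R ≤ ‖y‖ →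
          volume {t : ℝ | t ∈ Set.Ioo 0 r ∧ (∫ x in ball y t, V x) ≤ A} ≤
            ENNReal.ofReal ε) := by
    intro h r hr A hA ε hε
    obtain ⟨R, hR⟩ := h ε hε (A + 1)
    refine ⟨R, fun y hy => ?_⟩
    have h1 := hR y hy
    calc _ ≤ volume (Set.Ioo (0:ℝ) ε) := by
          apply measure_mono
          rintro t ⟨⟨ht0, _⟩, ht⟩
          refine ⟨ht0, ?_⟩
          by_contra hc
          have := aux_mono hVnn hVloc (ball_subset_ball (x := y) (not_lt.1 hc)) subset_rfl
          linarith
      _ = ENNReal.ofReal ε := by rw [Real.volume_Ioo, sub_zero]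
  have h21 : (∀ r > (0:ℝ), ∀ A > (0:ℝ), ∀ ε > (0:ℝ), ∃ R : ℝ,
        ∀ y : EuclideanSpace ℝ (Fin d), R ≤ ‖y‖ →
          volume {t : ℝ | t ∈ Set.Ioo 0 r ∧ (∫ x in ball y t, V x) ≤ A} ≤
            ENNReal.ofReal ε) → (∀ r > (0:ℝ), ∀ A : ℝ, ∃ R : ℝ,
        ∀ y : EuclideanSpace ℝ (Fin d), R ≤ ‖y‖ → A ≤ ∫ x in ball y r, V x) := by
    intro h r hr A
    obtain ⟨R, hR⟩ := h r hr (max A 1) (by positivity) (r / 2) (by positivity)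
    refine ⟨R, fun y hy => ?_⟩
    by_contra hc
    have h1 : volume (Set.Ioo (0:ℝ) r) ≤ ENNReal.ofReal (r / 2) := by
      refine (measure_mono ?_).trans (hR y hy)
      intro t ht
      refine ⟨ht, ?_⟩
      have := aux_mono hVnn hVloc (ball_subset_ball (x := y) ht.2.le) subset_rfl
      have := le_max_left A 1
      linarith
    rw [Real.volume_Ioo, sub_zero, ENNReal.ofReal_le_ofReal_iff (by positivity)] at h1
    linarith
  refine ⟨⟨h12, h21⟩, fun h2 => ?_, fun h3 => h12 ?_⟩
  · have h := h21 h2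
    intro r hr A hA ε hε
    have hδ : 0 < ε / r := by positivity
    obtain ⟨R, hR⟩ := h (ε / r / 2) (by positivity) (A + 1)
    refine ⟨R + r, fun y hy => ?_⟩
    calc _ ≤ volume (regionBetween (fun s : ℝ => s) (fun s => s + ε / r) (Set.Ioo 0 r)) := by
          apply measure_mono
          rintro ⟨s, t⟩ ⟨hs, hst, htr, hI⟩
          simp only at hs hst htr hI
          refine ⟨⟨hs, hst.trans htr⟩, hst, ?_⟩
          by_contra hc
          obtain ⟨z, hz, hsub⟩ := aux_annulus hd y hs hδ (not_lt.1 hc)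
          have h1 := hR z (by linarith)
          have h2 := aux_mono hVnn hVloc hsub Set.sdiff_subset
          linarith
      _ = ENNReal.ofReal ε := by
          rw [Measure.volume_eq_prod, volume_regionBetween_eq_lintegral (by fun_prop)
            (by fun_prop) measurableSet_Ioo]
          simp only [Pi.sub_apply, add_sub_cancel_left]
          rw [setLIntegral_const, Real.volume_Ioo, sub_zero, ← ENNReal.ofReal_mul hδ.le,
            div_mul_cancel₀ _ hr.ne']
  · intro r hr A
    obtain ⟨R, hR⟩ := h3 r hr (max A 1) (by positivity) (r ^ 2 / 8) (by positivity)
    refine ⟨R, fun y hy => ?_⟩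
    by_contra hc
    have h1 : volume (Set.Ioo (0:ℝ) (r / 2) ×ˢ Set.Ioo (r / 2) r) ≤
        ENNReal.ofReal (r ^ 2 / 8) := by
      refine (measure_mono ?_).trans (hR y hy)
      rintro ⟨s, t⟩ ⟨hs, ht⟩
      refine ⟨hs.1, hs.2.trans ht.1, ht.2, ?_⟩
      have := aux_mono hVnn hVloc (S := ball y t \ closure (ball y s)) (T := ball y r)
        (Set.sdiff_subset.trans (ball_subset_ball ht.2.le)) subset_rfl
      have := le_max_left A 1
      simp only
      linarith
    rw [Measure.volume_eq_prod, Measure.prod_prod, Real.volume_Ioo, Real.volume_Ioo,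
      ← ENNReal.ofReal_mul (by linarith), ENNReal.ofReal_le_ofReal_iff (by positivity)] at h1
    nlinarith
end

section
/- Let r > 0, let u_n : (0,r) → ℝ be a sequence of continuous functions, let λ_n be a sequence of real numbers with λ_n → +∞, and set Δ_r = {(s,t) ∈ ℝ² : 0 < s < t < r} and E_n = {(s,t) ∈ Δ_r : u_n(t) − u_n(s) > ∫_s^t u_n(ξ)² dξ + λ_n (t − s)}. Then mes₂(E_n) → 0 as n → ∞. -/
open MeasureTheory Metric Filter

/-- The primitive of `v ^ 2 + l` vanishing at `m`. -/
noncomputable def primF (v : ℝ → ℝ) (l m x : ℝ) : ℝ := (∫ ξ in m..x, (v ξ) ^ 2) + l * (x - m)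

lemma sq_intervalIntegrable {r : ℝ} {v : ℝ → ℝ} (hv : ContinuousOn v (Set.Ioo 0 r))
    {a b : ℝ} (ha : a ∈ Set.Ioo 0 r) (hb : b ∈ Set.Ioo 0 r) :
    IntervalIntegrable (fun ξ => (v ξ) ^ 2) volume a b := by
  apply ContinuousOn.intervalIntegrable
  exact (hv.pow 2).mono ((Set.ordConnected_Ioo).uIcc_subset ha hb)

lemma primF_hasDerivAt {r : ℝ} {v : ℝ → ℝ} (hv : ContinuousOn v (Set.Ioo 0 r))
    {l m x : ℝ} (hm : m ∈ Set.Ioo 0 r) (hx : x ∈ Set.Ioo 0 r) :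
    HasDerivAt (primF v l m) ((v x) ^ 2 + l) x := by
  have h1 : HasDerivAt (fun y => ∫ ξ in m..y, (v ξ) ^ 2) ((v x) ^ 2) x := by
    apply intervalIntegral.integral_hasDerivAt_right (sq_intervalIntegrable hv hm hx)
    · exact (hv.pow 2).stronglyMeasurableAtFilter isOpen_Ioo x hx
    · exact (hv.pow 2).continuousAt (isOpen_Ioo.mem_nhds hx)
  have h2 : HasDerivAt (fun y => l * (y - m)) l x := by
    simpa using ((hasDerivAt_id x).sub_const m).const_mul l
  exact h1.add h2

lemma primF_strictMono {r : ℝ} {v : ℝ → ℝ} (hv : ContinuousOn v (Set.Ioo 0 r))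
    {l m : ℝ} (hl : 0 < l) (hm : m ∈ Set.Ioo 0 r) :
    StrictMonoOn (primF v l m) (Set.Ioo 0 r) := by
  apply strictMonoOn_of_deriv_pos (convex_Ioo 0 r)
  · exact fun x hx => (primF_hasDerivAt hv hm hx).continuousAt.continuousWithinAt
  · intro x hx
    rw [interior_Ioo] at hx
    rw [(primF_hasDerivAt hv hm hx).deriv]
    positivity

/-- The exceptional set for the point `m`. -/
def excG (r : ℝ) (v : ℝ → ℝ) (l m : ℝ) : Set ℝ :=
  {x | x ∈ Set.Ioo 0 r ∧ (primF v l m x) ^ 2 < (v x) ^ 2}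

lemma volume_excG {r : ℝ} {v : ℝ → ℝ} (hv : ContinuousOn v (Set.Ioo 0 r))
    {l m : ℝ} (hl : 0 < l) (hm : m ∈ Set.Ioo 0 r) :
    volume (excG r v l m) ≤ ENNReal.ofReal (Real.pi / √l) := by
  have hs : 0 < √l := Real.sqrt_pos.2 hl
  have hsq : √l ^ 2 = l := Real.sq_sqrt hl.le
  have hFc : ContinuousOn (primF v l m) (Set.Ioo 0 r) :=
    fun x hx => (primF_hasDerivAt hv hm hx).continuousAt.continuousWithinAt
  have hopen : IsOpen (excG r v l m) := by
    have : excG r v l m = Set.Ioo 0 r ∩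
        Set.preimage (fun x => (v x) ^ 2 - (primF v l m x) ^ 2) (Set.Ioi 0) := by
      ext x; simp [excG]
    rw [this]
    exact ((hv.pow 2).sub (hFc.pow 2)).isOpen_inter_preimage isOpen_Ioo isOpen_Ioi
  have hsub : excG r v l m ⊆ Set.Ioo 0 r := fun x hx => hx.1
  set H : ℝ → ℝ := fun x => Real.arctan (primF v l m x / √l) / √l with hH
  set dH : ℝ → ℝ := fun x => ((v x) ^ 2 + l) / ((primF v l m x) ^ 2 + l) with hdef
  have hd : ∀ x ∈ excG r v l m, HasDerivWithinAt H (dH x) (excG r v l m) x := by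
    intro x hx
    have h := (((primF_hasDerivAt (l := l) hv hm hx.1).div_const (√l)).arctan).div_const (√l)
    refine (h.congr_deriv ?_).hasDerivWithinAt
    simp only [hdef]
    have h1 : 0 < (primF v l m x) ^ 2 + l := by positivity
    have h2 : 1 + (primF v l m x / √l) ^ 2 = ((primF v l m x) ^ 2 + l) / l := by
      rw [div_pow, hsq]; field_simp; ring
    rw [h2]
    field_simp
    rw [hsq]
  have hinj : Set.InjOn H (excG r v l m) := by
    intro x hx y hy hxy
    apply (primF_strictMono hv hl hm).injOn hx.1 hy.1
    have h1 : Real.arctan (primF v l m x / √l) = Real.arctan (primF v l m y / √l) := by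
      simp only [hH] at hxy
      field_simp at hxy
      exact hxy
    have h2 := Real.arctan_injective h1
    field_simp at h2
    exact h2
  have key := lintegral_image_eq_lintegral_abs_deriv_mul hopen.measurableSet hd hinj (fun _ => 1)
  calc volume (excG r v l m) = ∫⁻ x in excG r v l m, 1 := by simp
    _ ≤ ∫⁻ x in excG r v l m, ENNReal.ofReal |dH x| * 1 := by
        apply setLIntegral_mono' hopen.measurableSet
        intro x hx
        rw [mul_one, ENNReal.one_le_ofReal]
        refine le_trans ?_ (le_abs_self _)
        simp only [hdef]
        rw [one_le_div (by positivity)]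
        linarith [hx.2]
    _ = volume (Set.image H (excG r v l m)) := by rw [← key]; simp
    _ ≤ volume (Set.Icc (-(Real.pi / 2) / √l) ((Real.pi / 2) / √l)) := by
        apply measure_mono
        rintro _ ⟨x, -, rfl⟩
        constructor
        · exact div_le_div_of_nonneg_right (Real.neg_pi_div_two_lt_arctan _).le hs.le
        · exact div_le_div_of_nonneg_right (Real.arctan_lt_pi_div_two _).le hs.le
    _ = ENNReal.ofReal (Real.pi / √l) := by
        rw [Real.volume_Icc]; congr 1; ring

/-- The set of pairs in the statement. -/
def setE (r : ℝ) (v : ℝ → ℝ) (l : ℝ) : Set (ℝ × ℝ) :=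
  {p : ℝ × ℝ | 0 < p.1 ∧ p.1 < p.2 ∧ p.2 < r ∧
        (∫ ξ in p.1..p.2, (v ξ) ^ 2) + l * (p.2 - p.1) < v p.2 - v p.1}

lemma setE_cross {r : ℝ} {v : ℝ → ℝ} (hv : ContinuousOn v (Set.Ioo 0 r))
    {l m : ℝ} (hl : 0 < l) (hm : m ∈ Set.Ioo 0 r) {p : ℝ × ℝ} (hp : p ∈ setE r v l)
    (h1 : p.1 < m) (h2 : m < p.2) :
    p ∈ excG r v l m ×ˢ Set.Ioo 0 r ∪ Set.Ioo 0 r ×ˢ excG r v l m := by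
  obtain ⟨a, b, c, d⟩ := hp
  have m1 : p.1 ∈ Set.Ioo 0 r := ⟨a, b.trans c⟩
  have m2 : p.2 ∈ Set.Ioo 0 r := ⟨a.trans b, c⟩
  have hz : primF v l m m = 0 := by simp [primF]
  have f1 := primF_strictMono hv hl hm m1 hm h1
  have f2 := primF_strictMono hv hl hm hm m2 h2
  rw [hz] at f1 f2
  have hadd : (∫ ξ in p.1..p.2, (v ξ) ^ 2) + l * (p.2 - p.1)
      = primF v l m p.2 - primF v l m p.1 := by
    have := intervalIntegral.integral_interval_sub_left (sq_intervalIntegrable hv hm m2)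
      (sq_intervalIntegrable hv hm m1)
    simp only [primF]
    rw [← this]; ring
  rw [hadd] at d
  by_cases h : primF v l m p.2 < v p.2
  · right
    exact ⟨m1, m2, by nlinarith⟩
  · left
    exact ⟨⟨m1, by nlinarith⟩, m2⟩

lemma volume_strip {r : ℝ} {v : ℝ → ℝ} (hr : 0 < r) (hv : ContinuousOn v (Set.Ioo 0 r))
    {l a b : ℝ} (hl : 0 < l) (hab : a ≤ b) (hb : 0 < b) (hbr : b ≤ r) :
    volume (setE r v l ∩ {p | a ≤ p.1 ∧ p.1 < b}) ≤
      ENNReal.ofReal (2 * r * (Real.pi / √l) + (b - a) ^ 2) := by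
  have hsq : volume (Set.Icc a b ×ˢ Set.Icc a b) = ENNReal.ofReal ((b - a) ^ 2) := by
    rw [Measure.volume_eq_prod, Measure.prod_prod, Real.volume_Icc,
      ← ENNReal.ofReal_mul (by linarith), sq]
  have hpi : 0 ≤ Real.pi / √l := by positivity
  rcases hbr.eq_or_lt with h | h
  · refine (measure_mono (t := Set.Icc a b ×ˢ Set.Icc a b) ?_).trans ?_
    · rintro p ⟨⟨h1, h2, h3, -⟩, h4, h5⟩
      exact ⟨⟨h4, h5.le⟩, ⟨by linarith, by linarith⟩⟩
    · rw [hsq]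
      apply ENNReal.ofReal_le_ofReal
      have : 0 ≤ 2 * r * (Real.pi / √l) := by positivity
      linarith
  · have hm : b ∈ Set.Ioo 0 r := ⟨hb, h⟩
    have hG := volume_excG hv hl hm
    refine (measure_mono (t := (excG r v l b ×ˢ Set.Ioo 0 r ∪ Set.Ioo 0 r ×ˢ excG r v l b) ∪
      Set.Icc a b ×ˢ Set.Icc a b) ?_).trans ?_
    · rintro p ⟨hp, h4, h5⟩
      by_cases hc : b < p.2
      · left
        exact setE_cross hv hl hm hp h5 hc
      · right
        obtain ⟨h1, h2, h3, -⟩ := hp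
        exact ⟨⟨h4, h5.le⟩, ⟨by linarith, by linarith⟩⟩
    · have e : ENNReal.ofReal (2 * r * (Real.pi / √l) + (b - a) ^ 2) =
          (ENNReal.ofReal (Real.pi / √l) * ENNReal.ofReal r +
            ENNReal.ofReal r * ENNReal.ofReal (Real.pi / √l)) +
          ENNReal.ofReal ((b - a) ^ 2) := by
        rw [← ENNReal.ofReal_mul hpi, ← ENNReal.ofReal_mul hr.le,
          ← ENNReal.ofReal_add (by positivity) (by positivity),
          ← ENNReal.ofReal_add (by positivity) (by positivity)]
        congr 1; ring
      rw [e]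
      refine (measure_union_le _ _).trans (add_le_add ((measure_union_le _ _).trans ?_) hsq.le)
      rw [Measure.volume_eq_prod, Measure.prod_prod, Measure.prod_prod, Real.volume_Ioo, sub_zero]
      gcongr

lemma volume_setE {r : ℝ} {v : ℝ → ℝ} (hr : 0 < r) (hv : ContinuousOn v (Set.Ioo 0 r))
    {l : ℝ} (hl : 0 < l) (N : ℕ) (hN : 0 < N) :
    volume (setE r v l) ≤
      ENNReal.ofReal (N * (2 * r * (Real.pi / √l)) + r ^ 2 / N) := by
  have hN' : (0 : ℝ) < N := by exact_mod_cast hN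
  have hcov : setE r v l ⊆ ⋃ k ∈ Finset.range N,
      (setE r v l ∩ {p | (k : ℝ) * (r / N) ≤ p.1 ∧ p.1 < ((k : ℝ) + 1) * (r / N)}) := by
    intro p hp
    have hp1 : 0 < p.1 := hp.1
    have hp2 : p.1 < r := hp.2.1.trans hp.2.2.1
    have hd : 0 < r / N := by positivity
    have h0 : 0 ≤ p.1 / (r / N) := by positivity
    simp only [Set.mem_iUnion, Finset.mem_range]
    refine ⟨⌊p.1 / (r / N)⌋₊, ?_, hp, ?_, ?_⟩
    · rw [Nat.floor_lt h0, div_lt_iff₀ hd]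
      field_simp
      exact hp2
    · rw [← le_div_iff₀ hd]
      exact Nat.floor_le h0
    · rw [← div_lt_iff₀ hd]
      exact Nat.lt_floor_add_one _
  refine (measure_mono hcov).trans ((measure_biUnion_finset_le _ _).trans ?_)
  have hb : ∀ k ∈ Finset.range N,
      volume (setE r v l ∩ {p | (k : ℝ) * (r / N) ≤ p.1 ∧ p.1 < ((k : ℝ) + 1) * (r / N)}) ≤
      ENNReal.ofReal (2 * r * (Real.pi / √l) + (r / N) ^ 2) := by
    intro k hk
    have hk' : (k : ℝ) + 1 ≤ N := by exact_mod_cast Finset.mem_range.1 hk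
    have h := volume_strip (a := (k : ℝ) * (r / N)) (b := ((k : ℝ) + 1) * (r / N)) hr hv hl
      (by gcongr; linarith) (by positivity) (by
        calc ((k : ℝ) + 1) * (r / N) ≤ N * (r / N) := by gcongr
          _ = r := by field_simp)
    have e : ((k : ℝ) + 1) * (r / N) - k * (r / N) = r / N := by ring
    rwa [e] at h
  refine (Finset.sum_le_sum hb).trans ?_
  rw [Finset.sum_const, Finset.card_range, nsmul_eq_mul, ← ENNReal.ofReal_natCast,
    ← ENNReal.ofReal_mul hN'.le]
  apply ENNReal.ofReal_le_ofReal
  apply le_of_eq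
  field_simp

theorem statement12 (r : ℝ) (hr : 0 < r) (u : ℕ → ℝ → ℝ)
    (hu : ∀ n, ContinuousOn (u n) (Set.Ioo 0 r))
    (lam : ℕ → ℝ) (hlam : Tendsto lam atTop atTop) :
    Tendsto (fun n => volume {p : ℝ × ℝ | 0 < p.1 ∧ p.1 < p.2 ∧ p.2 < r ∧
        (∫ ξ in p.1..p.2, (u n ξ) ^ 2) + lam n * (p.2 - p.1) < u n p.2 - u n p.1})
      atTop (nhds 0) := by
  change Tendsto (fun n => volume (setE r (u n) (lam n))) atTop (nhds 0)
  rw [ENNReal.tendsto_nhds_zero]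
  intro ε hε
  by_cases htop : ε = ⊤
  · simp [htop]
  have he : 0 < ε.toReal := ENNReal.toReal_pos hε.ne' htop
  obtain ⟨N, hN⟩ := exists_nat_gt (r ^ 2 / ε.toReal)
  have hN' : (0 : ℝ) < N := lt_of_le_of_lt (by positivity) hN
  have hlim : Tendsto (fun n => (N : ℝ) * (2 * r * (Real.pi / √(lam n))) + r ^ 2 / N) atTop
      (nhds (N * (2 * r * 0) + r ^ 2 / N)) := by
    have h1 : Tendsto (fun n => Real.pi / √(lam n)) atTop (nhds 0) :=
      (Real.tendsto_sqrt_atTop.comp hlam).const_div_atTop Real.pi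
    exact ((h1.const_mul (2 * r)).const_mul (N : ℝ)).add_const _
  have hlt : (N : ℝ) * (2 * r * 0) + r ^ 2 / N < ε.toReal := by
    rw [div_lt_iff₀ he] at hN
    rw [mul_zero, mul_zero, zero_add, div_lt_iff₀ hN']
    linarith
  filter_upwards [hlim.eventually (gt_mem_nhds hlt), hlam.eventually_gt_atTop 0] with n h1 h2
  refine (volume_setE hr (hu n) h2 N (by exact_mod_cast hN')).trans ?_
  rw [← ENNReal.ofReal_toReal htop]
  exact ENNReal.ofReal_le_ofReal h1.le
end

section
/- Let r > 0, and for each n ∈ ℕ let t_n ∈ [0, r), let u_n : [t_n, r] → ℝ be a measurable bounded function, and let X_n ⊆ [t_n, r] be a measurable set. Suppose λ_n is a sequence of real numbers with λ_n → +∞ such that for every n and every t ∈ X_n: u_n(t) ≥ ∫_{t_n}^t u_n(ξ)² dξ + λ_n (t − t_n). Then mes₁(X_n) → 0 as n → ∞. -/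
open MeasureTheory Metric Filter

lemma riccati_bound (a b s : ℝ) (hab : a ≤ b) (hs : 0 < s) (u : ℝ → ℝ)
    (humeas : AEMeasurable u (volume.restrict (Set.Icc a b)))
    (M : ℝ) (hM : ∀ t ∈ Set.Icc a b, |u t| ≤ M)
    (X : Set ℝ) (hX : X ⊆ Set.Icc a b) (hXm : MeasurableSet X)
    (hineq : ∀ t ∈ X, (∫ ξ in a..t, (u ξ) ^ 2) + s ^ 2 * (t - a) ≤ u t) :
    volume X ≤ ENNReal.ofReal (Real.pi / s) := by
  have hint : IntegrableOn (fun x => (u x) ^ 2) (Set.Icc a b) := by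
    refine Integrable.of_bound (C := M ^ 2)
      (humeas.pow_const 2).aestronglyMeasurable ?_
    rw [ae_restrict_iff' measurableSet_Icc]
    refine Eventually.of_forall fun x hx => ?_
    rw [Real.norm_eq_abs, abs_pow]
    exact pow_le_pow_left₀ (abs_nonneg _) (hM x hx) 2
  have hii : IntervalIntegrable (fun x => (u x) ^ 2) volume a b :=
    (intervalIntegrable_iff_integrableOn_Icc_of_le hab).2 hint
  set G : ℝ → ℝ := fun t => ∫ ξ in a..t, (u ξ) ^ 2 with hG
  have hGmono : MonotoneOn G (Set.Icc a b) := by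
    intro x hx y hy hxy
    refine intervalIntegral.integral_mono_interval le_rfl hx.1 hxy
      (Eventually.of_forall fun z => sq_nonneg _) ?_
    refine hii.mono_set ?_
    rw [Set.uIcc_of_le hy.1, Set.uIcc_of_le hab]
    exact Set.Icc_subset_Icc le_rfl hy.2
  have hG0 : ∀ t ∈ Set.Icc a b, 0 ≤ G t := fun t ht =>
    intervalIntegral.integral_nonneg ht.1 fun z _ => sq_nonneg _
  set g : ℝ → ℝ := fun t => Real.arctan ((G t + s ^ 2 * (t - a)) / s) with hg
  have hgmono : MonotoneOn g (Set.uIcc a b) := by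
    rw [Set.uIcc_of_le hab]
    intro x hx y hy hxy
    apply Real.arctan_mono
    have := hGmono hx hy hxy
    gcongr
  have hder : ∀ᵐ x, x ∈ Set.Icc a b →
      HasDerivAt g (1 / (1 + ((G x + s ^ 2 * (x - a)) / s) ^ 2) * ((u x ^ 2 + s ^ 2) / s)) x := by
    filter_upwards [hii.ae_hasDerivAt_integral] with x hx hxm
    rw [Set.uIcc_of_le hab] at hx
    have h1 : HasDerivAt G (u x ^ 2) x := hx hxm a ⟨le_rfl, hab⟩
    have h2 : HasDerivAt (fun t : ℝ => s ^ 2 * (t - a)) (s ^ 2) x := by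
      simpa using ((hasDerivAt_id x).sub_const a).const_mul (s ^ 2)
    exact ((h1.add h2).div_const s).arctan
  have hle : ∫ x in Set.Icc a b, X.indicator (fun _ => s) x ≤ ∫ x in Set.Icc a b, deriv g x := by
    refine integral_mono_ae ?_ ?_ ?_
    · exact (integrable_const s).indicator hXm
    · exact (intervalIntegrable_iff_integrableOn_Icc_of_le hab).1 hgmono.intervalIntegrable_deriv
    · rw [EventuallyLE, ae_restrict_iff' measurableSet_Icc]
      filter_upwards [hder] with x hx hxm
      rw [(hx hxm).deriv]
      by_cases hxX : x ∈ X
      · rw [Set.indicator_of_mem hxX]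
        have h1 := hineq x hxX
        have h2 : 0 ≤ G x + s ^ 2 * (x - a) :=
          add_nonneg (hG0 x hxm) (mul_nonneg (sq_nonneg _) (sub_nonneg.2 hxm.1))
        have h3 : (G x + s ^ 2 * (x - a)) ^ 2 ≤ u x ^ 2 := pow_le_pow_left₀ h2 h1 2
        generalize G x + s ^ 2 * (x - a) = v at *
        have e : 1 / (1 + (v / s) ^ 2) * ((u x ^ 2 + s ^ 2) / s)
            = s * (u x ^ 2 + s ^ 2) / (s ^ 2 + v ^ 2) := by
          field_simp
        rw [e, le_div_iff₀ (by positivity)]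
        nlinarith
      · rw [Set.indicator_of_notMem hxX]
        positivity
  have hfin : volume X ≠ ⊤ := ((measure_mono hX).trans_lt (by simp)).ne
  have hub : ∫ x in Set.Icc a b, deriv g x ≤ Real.pi := by
    have h := hgmono.intervalIntegral_deriv_mem_uIcc
    have h0 : g a ≤ g b := hgmono (by simp) (by simp) hab
    rw [Set.uIcc_of_le (by linarith), intervalIntegral.integral_of_le hab,
      ← integral_Icc_eq_integral_Ioc] at h
    have h1 : g b < Real.pi / 2 := Real.arctan_lt_pi_div_two _
    have h2 : -(Real.pi / 2) < g a := Real.neg_pi_div_two_lt_arctan _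
    linarith [h.2]
  have hl : ∫ x in Set.Icc a b, X.indicator (fun _ => s) x = (volume X).toReal * s := by
    rw [setIntegral_indicator hXm, Set.inter_eq_right.2 hX, setIntegral_const, smul_eq_mul]
    rfl
  rw [← ENNReal.ofReal_toReal hfin]
  apply ENNReal.ofReal_le_ofReal
  rw [le_div_iff₀ hs]
  linarith

theorem statement13 (r : ℝ) (hr : 0 < r) (t₀ : ℕ → ℝ)
    (ht₀ : ∀ n, t₀ n ∈ Set.Ico 0 r) (u : ℕ → ℝ → ℝ)
    (humeas : ∀ n, AEMeasurable (u n) (volume.restrict (Set.Icc (t₀ n) r)))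
    (hubdd : ∀ n, ∃ M : ℝ, ∀ t ∈ Set.Icc (t₀ n) r, |u n t| ≤ M)
    (X : ℕ → Set ℝ) (hX : ∀ n, X n ⊆ Set.Icc (t₀ n) r)
    (hXmeas : ∀ n, MeasurableSet (X n))
    (lam : ℕ → ℝ) (hlam : Tendsto lam atTop atTop)
    (hineq : ∀ n, ∀ t ∈ X n,
      (∫ ξ in (t₀ n)..t, (u n ξ) ^ 2) + lam n * (t - t₀ n) ≤ u n t) :
    Tendsto (fun n => volume (X n)) atTop (nhds 0) := by
  have hlim : Tendsto (fun n => ENNReal.ofReal (Real.pi / Real.sqrt (lam n))) atTop (nhds 0) := by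
    rw [← ENNReal.ofReal_zero]
    exact ENNReal.tendsto_ofReal
      (tendsto_const_nhds.div_atTop (Real.tendsto_sqrt_atTop.comp hlam))
  refine tendsto_of_tendsto_of_tendsto_of_le_of_le' tendsto_const_nhds hlim
    (Eventually.of_forall fun n => zero_le) ?_
  filter_upwards [hlam.eventually_gt_atTop 0] with n hn
  obtain ⟨M, hM⟩ := hubdd n
  refine riccati_bound (t₀ n) r _ (ht₀ n).2.le (Real.sqrt_pos.2 hn) (u n) (humeas n) M hM
    (X n) (hX n) (hXmeas n) ?_
  rw [Real.sq_sqrt hn.le]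
  exact hineq n
end

section
/- Let a > 0, let u : [0,a] → ℝ be a measurable bounded function, and let K : {(ξ,t) ∈ ℝ² : 0 ≤ ξ ≤ t ≤ a} → ℝ be a measurable bounded function with K(t,ξ) ≥ 0 everywhere on this triangle. If u(t) ≥ ∫₀^t K(t,ξ) u(ξ) dξ for every t ∈ [0,a], then u(t) ≥ 0 for every t ∈ [0,a]. -/
open MeasureTheory Metric Filter

theorem statement14 (a : ℝ) (ha : 0 < a) (u : ℝ → ℝ)
    (humeas : AEMeasurable u (volume.restrict (Set.Icc 0 a)))
    (hubdd : ∃ M : ℝ, ∀ t ∈ Set.Icc 0 a, |u t| ≤ M)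
    (K : ℝ → ℝ → ℝ)
    (hKmeas : ∀ t ∈ Set.Icc (0:ℝ) a, AEMeasurable (fun ξ => K t ξ) (volume.restrict (Set.Icc 0 t)))
    (hKbdd : ∃ M : ℝ, ∀ t ξ : ℝ, 0 ≤ ξ → ξ ≤ t → t ≤ a → |K t ξ| ≤ M)
    (hKnn : ∀ t ξ : ℝ, 0 ≤ ξ → ξ ≤ t → t ≤ a → 0 ≤ K t ξ)
    (hineq : ∀ t ∈ Set.Icc (0:ℝ) a, (∫ ξ in (0:ℝ)..t, K t ξ * u ξ) ≤ u t) :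
    ∀ t ∈ Set.Icc (0:ℝ) a, 0 ≤ u t := by
  obtain ⟨M, hM⟩ := hubdd
  obtain ⟨C, hC⟩ := hKbdd
  have hM0 : 0 ≤ M := (abs_nonneg _).trans (hM 0 ⟨le_rfl, ha.le⟩)
  have hC0 : 0 ≤ C := (abs_nonneg _).trans (hC 0 0 le_rfl le_rfl ha.le)
  have key : ∀ n : ℕ, ∀ t ∈ Set.Icc (0:ℝ) a, -(M * ((C * t) ^ n / (n.factorial : ℝ))) ≤ u t := by
    intro n
    induction n with
    | zero =>
      intro t ht
      have := (abs_le.mp (hM t ht)).1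
      simpa using this
    | succ n ih =>
      intro t ht
      refine le_trans ?_ (hineq t ht)
      have hint : IntervalIntegrable (fun ξ => K t ξ * u ξ) volume 0 t := by
        rw [intervalIntegrable_iff_integrableOn_Icc_of_le ht.1]
        refine Integrable.of_bound (μ := volume.restrict (Set.Icc 0 t)) ?_ (C * M) ?_
        · exact ((hKmeas t ht).mul (humeas.mono_measure
            (Measure.restrict_mono (Set.Icc_subset_Icc le_rfl ht.2) le_rfl))).aestronglyMeasurable
        · refine (ae_restrict_iff' measurableSet_Icc).mpr (Eventually.of_forall ?_)
          intro x hx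
          rw [Real.norm_eq_abs, abs_mul]
          exact mul_le_mul (hC t x hx.1 hx.2 ht.2) (hM x ⟨hx.1, hx.2.trans ht.2⟩)
            (abs_nonneg _) hC0
      have hval : (∫ ξ in (0:ℝ)..t, -(C * (M * ((C * ξ) ^ n / (n.factorial : ℝ)))))
          = -(M * ((C * t) ^ (n+1) / ((n+1).factorial : ℝ))) := by
        have : (fun ξ : ℝ => -(C * (M * ((C * ξ) ^ n / (n.factorial : ℝ)))))
            = fun ξ => (-(C * M * C ^ n / (n.factorial : ℝ))) * ξ ^ n := by
          funext ξ
          rw [mul_pow]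
          ring
        rw [this, intervalIntegral.integral_const_mul, integral_pow, Nat.factorial_succ]
        have h1 : (n.factorial : ℝ) ≠ 0 := by positivity
        have h2 : (n : ℝ) + 1 ≠ 0 := by positivity
        push_cast
        rw [mul_pow]
        field_simp
        ring
      rw [← hval]
      refine intervalIntegral.integral_mono_on ht.1 ?_ hint ?_
      · apply Continuous.intervalIntegrable
        fun_prop
      · intro x hx
        have h1 := ih x ⟨hx.1, hx.2.trans ht.2⟩
        have h2 := hKnn t x hx.1 hx.2 ht.2
        have h3 := (abs_le.mp (hC t x hx.1 hx.2 ht.2)).2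
        have hx0 := hx.1
        have h4 : 0 ≤ M * ((C * x) ^ n / (n.factorial : ℝ)) := by positivity
        nlinarith [mul_le_mul_of_nonneg_left h1 h2, mul_le_mul_of_nonneg_right h3 h4]
  intro t ht
  have hlim := ((FloorSemiring.tendsto_pow_div_factorial_atTop (C * t)).const_mul M).neg
  rw [mul_zero, neg_zero] at hlim
  exact le_of_tendsto' hlim (fun n => key n t ht)
end

section
/- Let r > 0, let u_n : (0,r) → ℝ be a sequence of continuous functions, let λ_n be real numbers with λ_n → +∞, set Δ_r = {(s,t) ∈ ℝ² : 0 < s < t < r}, E_n = {(s,t) ∈ Δ_r : u_n(t) − u_n(s) > ∫_s^t u_n(ξ)² dξ + λ_n (t − s)}, ε_n^− = {t ∈ (0,r) : u_n(t) ≤ 0}, and E_n' = E_n ∩ ((0,r) × ε_n^−). Then mes₂(E_n') → 0 as n → ∞. -/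
open MeasureTheory Metric Filter

/-- One-dimensional bound for the sections of the exceptional set. -/
lemma section_bound (r : ℝ) (u H : ℝ → ℝ) (k : ℝ) (hk : 0 < k)
    (hH : ∀ x ∈ Set.Ioo 0 r, HasDerivAt H (u x ^ 2) x) (t : ℝ) (ht : t ∈ Set.Ioo 0 r)
    (A : Set ℝ) (hA : MeasurableSet A)
    (hA' : ∀ s ∈ A, 0 < s ∧ s < t ∧ H t - H s + k ^ 2 * (t - s) < - u s) :
    volume A ≤ ENNReal.ofReal (Real.pi / k) := by
  set F : ℝ → ℝ := fun s => H t - H s + k ^ 2 * (t - s) with hF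
  have hFd : ∀ x ∈ Set.Ioo 0 r, HasDerivAt F (-(u x ^ 2 + k ^ 2)) x := by
    intro x hx
    have h1 := ((hH x hx).const_sub (H t)).add
      (((hasDerivAt_id x).const_sub t).const_mul (k ^ 2))
    have h2 : -(u x ^ 2 + k ^ 2) = -u x ^ 2 + k ^ 2 * (-1) := by ring
    rw [h2]
    exact h1
  have hanti : AntitoneOn F (Set.Ioo 0 r) := by
    apply antitoneOn_of_hasDerivWithinAt_nonpos (convex_Ioo 0 r)
      (f' := fun x => -(u x ^ 2 + k ^ 2))
    · intro x hx
      exact (hFd x hx).continuousAt.continuousWithinAt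
    · intro x hx
      rw [interior_Ioo] at hx ⊢
      exact (hFd x hx).hasDerivWithinAt
    · intro x _
      have := sq_nonneg (u x)
      have := sq_nonneg k
      linarith
  have hAr : A ⊆ Set.Ioo 0 r := fun s hs =>
    ⟨(hA' s hs).1, (hA' s hs).2.1.trans ht.2⟩
  have key := lintegral_deriv_eq_volume_image_of_antitoneOn (s := A)
    (f := fun s => Real.arctan (F s / k))
    (f' := fun x => 1 / (1 + (F x / k) ^ 2) * (-(u x ^ 2 + k ^ 2) / k)) hA
    (fun x hx => (((hFd x (hAr hx)).div_const k).arctan).hasDerivWithinAt)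
    (by
      intro x hx y hy hxy
      apply Real.arctan_strictMono.monotone
      have := hanti (hAr hx) (hAr hy) hxy
      gcongr)
  have himg : volume ((fun s => Real.arctan (F s / k)) '' A) ≤ ENNReal.ofReal Real.pi := by
    calc _ ≤ volume (Set.Ioo (-(Real.pi / 2)) (Real.pi / 2)) := by
          apply measure_mono
          rintro _ ⟨x, _, rfl⟩
          exact Real.arctan_mem_Ioo _
      _ = _ := by
          rw [Real.volume_Ioo]; congr 1; ring
  have hlow : ENNReal.ofReal k * volume A ≤ ENNReal.ofReal Real.pi := by
    refine le_trans ?_ himg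
    rw [← key, ← setLIntegral_const]
    apply setLIntegral_mono' hA
    intro x hx
    apply ENNReal.ofReal_le_ofReal
    obtain ⟨h0, h1, h2⟩ := hA' x hx
    have hF0 : 0 ≤ F x := by
      have := hanti (hAr hx) ht h1.le
      have h3 : F t = 0 := by simp [hF]
      linarith
    have h2' : F x < - u x := h2
    have hsq : F x ^ 2 ≤ u x ^ 2 := by nlinarith
    have : -(1 / (1 + (F x / k) ^ 2) * (-(u x ^ 2 + k ^ 2) / k))
        = k * ((u x ^ 2 + k ^ 2) / (F x ^ 2 + k ^ 2)) := by
      have : F x ^ 2 + k ^ 2 ≠ 0 := by positivity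
      have : 1 + (F x / k) ^ 2 ≠ 0 := by positivity
      field_simp
      ring
    rw [this]
    apply le_mul_of_one_le_right hk.le
    rw [one_le_div (by positivity)]
    linarith
  rw [ENNReal.ofReal_div_of_pos hk, ENNReal.le_div_iff_mul_le (by simp [hk]) (by simp), mul_comm]
  exact hlow

lemma set_bound (r : ℝ) (hr : 0 < r) (u : ℝ → ℝ) (hu : ContinuousOn u (Set.Ioo 0 r))
    (k : ℝ) (hk : 0 < k) :
    volume ({p : ℝ × ℝ | 0 < p.1 ∧ p.1 < p.2 ∧ p.2 < r ∧
        (∫ ξ in p.1..p.2, (u ξ) ^ 2) + k ^ 2 * (p.2 - p.1) < u p.2 - u p.1} ∩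
        Set.Ioo 0 r ×ˢ {t ∈ Set.Ioo 0 r | u t ≤ 0}) ≤
      ENNReal.ofReal (Real.pi / k) * ENNReal.ofReal r := by
  have hu2 : ContinuousOn (fun x => u x ^ 2) (Set.Ioo 0 r) := hu.pow 2
  have hint : ∀ a ∈ Set.Ioo 0 r, ∀ b ∈ Set.Ioo 0 r,
      IntervalIntegrable (fun x => u x ^ 2) volume a b := by
    intro a ha b hb
    exact (hu2.mono (Set.ordConnected_Ioo.uIcc_subset ha hb)).intervalIntegrable
  have hc : r / 2 ∈ Set.Ioo 0 r := ⟨by linarith, by linarith⟩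
  set H : ℝ → ℝ := fun x => ∫ ξ in (r / 2)..x, u ξ ^ 2 with hHdef
  have hH : ∀ x ∈ Set.Ioo 0 r, HasDerivAt H (u x ^ 2) x := by
    intro x hx
    exact intervalIntegral.integral_hasDerivAt_right (hint _ hc _ hx)
      (hu2.stronglyMeasurableAtFilter isOpen_Ioo x hx)
      (hu2.continuousAt (isOpen_Ioo.mem_nhds hx))
  have hHc : ContinuousOn H (Set.Ioo 0 r) := fun x hx =>
    (hH x hx).continuousAt.continuousWithinAt
  have hHsub : ∀ a ∈ Set.Ioo 0 r, ∀ b ∈ Set.Ioo 0 r, ∫ ξ in a..b, u ξ ^ 2 = H b - H a := by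
    intro a ha b hb
    exact (intervalIntegral.integral_interval_sub_left (hint _ hc _ hb) (hint _ hc _ ha)).symm
  set Q : Set (ℝ × ℝ) := Set.Ioo 0 r ×ˢ Set.Ioo 0 r with hQ
  set G : ℝ × ℝ → ℝ := fun p => -u p.1 - (H p.2 - H p.1 + k ^ 2 * (p.2 - p.1)) with hG
  have hQ1 : ∀ {f : ℝ → ℝ}, ContinuousOn f (Set.Ioo 0 r) →
      ContinuousOn (fun p : ℝ × ℝ => f p.1) Q := fun hf =>
    hf.comp continuous_fst.continuousOn (fun p hp => hp.1)
  have hQ2 : ∀ {f : ℝ → ℝ}, ContinuousOn f (Set.Ioo 0 r) →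
      ContinuousOn (fun p : ℝ × ℝ => f p.2) Q := fun hf =>
    hf.comp continuous_snd.continuousOn (fun p hp => hp.2)
  have hGc : ContinuousOn G Q :=
    (hQ1 hu).neg.sub (((hQ2 hHc).sub (hQ1 hHc)).add (by fun_prop))
  set B : Set (ℝ × ℝ) := (Q ∩ G ⁻¹' Set.Ioi 0) ∩ {p | p.1 < p.2} with hB
  have hBm : MeasurableSet B :=
    ((hGc.isOpen_inter_preimage (isOpen_Ioo.prod isOpen_Ioo) isOpen_Ioi).inter
      (isOpen_lt continuous_fst continuous_snd)).measurableSet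
  have hsub : ({p : ℝ × ℝ | 0 < p.1 ∧ p.1 < p.2 ∧ p.2 < r ∧
        (∫ ξ in p.1..p.2, (u ξ) ^ 2) + k ^ 2 * (p.2 - p.1) < u p.2 - u p.1} ∩
        Set.Ioo 0 r ×ˢ {t ∈ Set.Ioo 0 r | u t ≤ 0}) ⊆ B := by
    rintro ⟨s, t⟩ ⟨⟨h0, h1, h2, h3⟩, hs, ht, hut⟩
    dsimp only at h0 h1 h2 h3 hs ht hut
    rw [hHsub s hs t ht] at h3
    refine ⟨⟨⟨hs, ht⟩, ?_⟩, h1⟩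
    change 0 < -u s - (H t - H s + k ^ 2 * (t - s))
    linarith
  refine (measure_mono hsub).trans ?_
  rw [Measure.volume_eq_prod, Measure.prod_apply_symm hBm]
  calc ∫⁻ t, volume ((fun s => (s, t)) ⁻¹' B)
      ≤ ∫⁻ t, (Set.Ioo 0 r).indicator (fun _ => ENNReal.ofReal (Real.pi / k)) t := by
        apply lintegral_mono
        intro t
        by_cases ht : t ∈ Set.Ioo 0 r
        · rw [Set.indicator_of_mem ht]
          apply section_bound r u H k hk hH t ht _ (measurable_prodMk_right hBm)
          rintro s ⟨⟨⟨hs, _⟩, h1⟩, h2⟩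
          have h1' : 0 < -u s - (H t - H s + k ^ 2 * (t - s)) := h1
          exact ⟨hs.1, h2, by linarith⟩
        · have : (fun s => (s, t)) ⁻¹' B = ∅ := by
            ext s
            simp only [Set.mem_preimage, Set.mem_empty_iff_false, iff_false]
            exact fun h => ht h.1.1.2
          beta_reduce
          rw [this]
          simp
    _ = ENNReal.ofReal (Real.pi / k) * ENNReal.ofReal r := by
        rw [lintegral_indicator measurableSet_Ioo, setLIntegral_const, Real.volume_Ioo, sub_zero]

theorem statement15 (r : ℝ) (hr : 0 < r) (u : ℕ → ℝ → ℝ)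
    (hu : ∀ n, ContinuousOn (u n) (Set.Ioo 0 r))
    (lam : ℕ → ℝ) (hlam : Tendsto lam atTop atTop) :
    Tendsto (fun n => volume ({p : ℝ × ℝ | 0 < p.1 ∧ p.1 < p.2 ∧ p.2 < r ∧
        (∫ ξ in p.1..p.2, (u n ξ) ^ 2) + lam n * (p.2 - p.1) < u n p.2 - u n p.1} ∩
        Set.Ioo 0 r ×ˢ {t ∈ Set.Ioo 0 r | u n t ≤ 0}))
      atTop (nhds 0) := by
  have hlim : Tendsto (fun n => ENNReal.ofReal (Real.pi / √(lam n)) * ENNReal.ofReal r)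
      atTop (nhds 0) := by
    have h1 : Tendsto (fun n => Real.pi / √(lam n)) atTop (nhds 0) :=
      (Real.tendsto_sqrt_atTop.comp hlam).const_div_atTop Real.pi
    have h2 := ENNReal.Tendsto.mul_const (b := ENNReal.ofReal r) (ENNReal.tendsto_ofReal h1)
      (Or.inr ENNReal.ofReal_ne_top)
    simpa using h2
  refine tendsto_of_tendsto_of_tendsto_of_le_of_le' tendsto_const_nhds hlim
    (Eventually.of_forall fun _ => zero_le) ?_
  filter_upwards [hlam.eventually_gt_atTop 0] with n hn
  have := set_bound r hr (u n) (hu n) (√(lam n)) (Real.sqrt_pos.2 hn)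
  rwa [Real.sq_sqrt hn.le] at this
end

section
/- Let r > 0, let u_n : (0,r) → ℝ be a sequence of continuous functions, let λ_n be real numbers with λ_n → +∞, set Δ_r = {(s,t) ∈ ℝ² : 0 < s < t < r} and E_n = {(s,t) ∈ Δ_r : u_n(t) − u_n(s) > ∫_s^t u_n(ξ)² dξ + λ_n (t − s)}. Let ε_n^+ = {t ∈ (0,r) : u_n(t) > 0} (an open subset of ℝ), and for t ∈ ε_n^+ let a_n(t) = inf of the connected component of ε_n^+ containing t. Define E_n^* = {(s,t) ∈ E_n : t ∈ ε_n^+ and (s, a_n(t)) ∈ E_n}. Then mes₂(E_n^*) → 0 as n → ∞. -/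
open MeasureTheory Metric Filter

lemma slice_bound (r : ℝ) (v : ℝ → ℝ) (hv : ContinuousOn v (Set.Ioo 0 r)) (L b : ℝ)
    (hL : 0 < L) (hbr : b < r) :
    volume {s : ℝ | s ∈ Set.Ioo 0 b ∧ (∫ ξ in s..b, (v ξ) ^ 2) + L * (b - s) < - v s}
      ≤ ENNReal.ofReal (Real.pi / Real.sqrt L) := by
  set F : ℝ → ℝ := fun s => (∫ ξ in s..b, (v ξ) ^ 2) + L * (b - s) with hF
  set T := {s : ℝ | s ∈ Set.Ioo 0 b ∧ F s < - v s} with hT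
  have hq : 0 < Real.sqrt L := Real.sqrt_pos.2 hL
  have hsq : Real.sqrt L ^ 2 = L := Real.sq_sqrt hL.le
  set q := Real.sqrt L with hqdef
  have hv2 : ContinuousOn (fun ξ => (v ξ) ^ 2) (Set.Ioo 0 r) := hv.pow 2
  have hFd : ∀ s ∈ Set.Ioo 0 b, HasDerivAt F (-(v s ^ 2 + L)) s := by
    intro s hs
    have hsr : s ∈ Set.Ioo 0 r := ⟨hs.1, hs.2.trans hbr⟩
    have h1 : HasDerivAt (fun s => ∫ ξ in s..b, (v ξ) ^ 2) (-(v s ^ 2)) s := by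
      apply intervalIntegral.integral_hasDerivAt_left
      · apply ContinuousOn.intervalIntegrable
        apply hv2.mono
        rw [Set.uIcc_of_le hs.2.le]
        intro x hx
        exact ⟨hs.1.trans_le hx.1, hx.2.trans_lt hbr⟩
      · exact hv2.stronglyMeasurableAtFilter isOpen_Ioo s hsr
      · exact hv2.continuousAt (isOpen_Ioo.mem_nhds hsr)
    have h2 : HasDerivAt (fun s => L * (b - s)) (L * (-1)) s :=
      ((hasDerivAt_id s).const_sub b).const_mul L
    exact (h1.add h2).congr_deriv (by ring)
  have hF0 : ∀ s ∈ Set.Ioo 0 b, 0 ≤ F s := by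
    intro s hs
    have : 0 ≤ ∫ ξ in s..b, (v ξ) ^ 2 :=
      intervalIntegral.integral_nonneg hs.2.le (fun x _ => sq_nonneg _)
    have h2 : 0 ≤ L * (b - s) := mul_nonneg hL.le (by linarith [hs.2])
    simp only [hF]; linarith
  set G : ℝ → ℝ := fun s => - (Real.arctan (F s / q) / q) with hG
  set G' : ℝ → ℝ := fun s => (v s ^ 2 + L) / (F s ^ 2 + L) with hG'
  have hGd : ∀ s ∈ Set.Ioo 0 b, HasDerivAt G (G' s) s := by
    intro s hs
    have := ((((hFd s hs).div_const q).arctan).div_const q).neg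
    refine HasDerivAt.congr_deriv this ?_
    have : 0 < F s ^ 2 + L := by positivity
    have h3 : 0 < q ^ 2 + F s ^ 2 := by positivity
    simp only [hG']
    rw [← hsq]
    field_simp
    ring
  have hmono : StrictMonoOn G (Set.Ioo 0 b) := by
    apply strictMonoOn_of_deriv_pos (convex_Ioo 0 b)
    · intro s hs
      exact (hGd s hs).continuousAt.continuousWithinAt
    · intro s hs
      rw [interior_Ioo] at hs
      rw [(hGd s hs).deriv]
      simp only [hG']
      positivity
  have hTsub : T ⊆ Set.Ioo 0 b := fun s hs => hs.1
  have hTm : MeasurableSet T := by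
    have hc : ContinuousOn (fun s => F s + v s) (Set.Ioo 0 b) := by
      apply ContinuousOn.add
      · intro s hs
        exact (hFd s hs).continuousAt.continuousWithinAt
      · exact hv.mono (Set.Ioo_subset_Ioo_right hbr.le)
    have := hc.isOpen_inter_preimage isOpen_Ioo (isOpen_Iio (a := (0:ℝ)))
    convert this.measurableSet using 1
    ext s
    simp only [hT, Set.mem_setOf_eq, Set.mem_inter_iff, Set.mem_preimage, Set.mem_Iio]
    constructor
    · rintro ⟨h, h'⟩; exact ⟨h, by linarith⟩
    · rintro ⟨h, h'⟩; exact ⟨h, by linarith⟩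
  have key := lintegral_abs_det_fderiv_eq_addHaar_image volume hTm
    (fun s hs => ((hGd s (hTsub hs)).hasDerivWithinAt (s := T)).hasFDerivWithinAt)
    (hmono.injOn.mono hTsub)
  calc volume T = ∫⁻ s in T, 1 := by simp
    _ ≤ _ := by
      refine setLIntegral_mono' hTm ?_
      intro s hs
      have h1 : 1 ≤ G' s := by
        have h0 := hF0 s hs.1
        have h2 := hs.2
        simp only [hG']
        rw [one_le_div (by positivity)]
        nlinarith
      show (1 : ENNReal) ≤ ENNReal.ofReal |(ContinuousLinearMap.toSpanSingleton ℝ (G' s)).det|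
      simp only [ContinuousLinearMap.det_toSpanSingleton]
      rw [← ENNReal.ofReal_one]
      exact ENNReal.ofReal_le_ofReal (h1.trans (le_abs_self _))
    _ = volume (G '' T) := key
    _ ≤ volume (Set.Icc (-(Real.pi / 2 / q)) (Real.pi / 2 / q)) := by
      apply measure_mono
      rintro _ ⟨s, hs, rfl⟩
      have h1 := (Real.arctan_lt_pi_div_two (F s / q)).le
      have h2 := (Real.neg_pi_div_two_lt_arctan (F s / q)).le
      simp only [hG]
      constructor
      · apply neg_le_neg
        gcongr
      · rw [← neg_div]
        apply div_le_div_of_nonneg_right _ hq.le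
        linarith
    _ = ENNReal.ofReal (Real.pi / q) := by
      rw [Real.volume_Icc]; congr 1; ring

lemma inf_nonpos (r : ℝ) (v : ℝ → ℝ) (hv : ContinuousOn v (Set.Ioo 0 r)) (t : ℝ)
    (P : Set ℝ) (hP : P = {t ∈ Set.Ioo 0 r | 0 < v t}) (hPo : IsOpen P) (ht : t ∈ P)
    (hb : sInf (connectedComponentIn P t) ∈ Set.Ioo 0 r) :
    v (sInf (connectedComponentIn P t)) ≤ 0 := by
  by_contra! hpos
  set C := connectedComponentIn P t with hC
  set b := sInf C with hbdef
  have hbP : b ∈ P := by rw [hP]; exact ⟨hb, hpos⟩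
  have hne : C.Nonempty := ⟨t, mem_connectedComponentIn ht⟩
  have hCP : C ⊆ P := connectedComponentIn_subset P t
  have hbdd : BddBelow C := ⟨0, fun x hx => by
    have := hCP hx; rw [hP] at this; exact this.1.1.le⟩
  have hcl : b ∈ closure C := csInf_mem_closure hne hbdd
  have hCo : IsOpen (connectedComponentIn P b) := hPo.connectedComponentIn
  obtain ⟨x, hx1, hx2⟩ := mem_closure_iff.1 hcl _ hCo (mem_connectedComponentIn hbP)
  have e1 := connectedComponentIn_eq hx1
  have e2 := connectedComponentIn_eq hx2
  have hbC : b ∈ C := by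
    rw [hC, e2, ← e1]; exact mem_connectedComponentIn hbP
  have hCo' : IsOpen C := hPo.connectedComponentIn
  obtain ⟨ε, hε, hball⟩ := Metric.isOpen_iff.1 hCo' b hbC
  have : b - ε / 2 ∈ C := hball (by
    rw [Metric.mem_ball, Real.dist_eq, abs_lt]; constructor <;> linarith)
  have := csInf_le hbdd this
  linarith

theorem statement16 (r : ℝ) (hr : 0 < r) (u : ℕ → ℝ → ℝ)
    (hu : ∀ n, ContinuousOn (u n) (Set.Ioo 0 r))
    (lam : ℕ → ℝ) (hlam : Tendsto lam atTop atTop)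
    (E : ℕ → Set (ℝ × ℝ))
    (hE : ∀ n, E n = {p : ℝ × ℝ | 0 < p.1 ∧ p.1 < p.2 ∧ p.2 < r ∧
      (∫ ξ in p.1..p.2, (u n ξ) ^ 2) + lam n * (p.2 - p.1) < u n p.2 - u n p.1})
    (εp : ℕ → Set ℝ) (hεp : ∀ n, εp n = {t ∈ Set.Ioo 0 r | 0 < u n t})
    (a : ℕ → ℝ → ℝ) (ha : ∀ n, ∀ t ∈ εp n, a n t = sInf (connectedComponentIn (εp n) t)) :
    Tendsto (fun n => volume {p : ℝ × ℝ | p ∈ E n ∧ p.2 ∈ εp n ∧ (p.1, a n p.2) ∈ E n})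
      atTop (nhds 0) := by
  have hlim : Tendsto (fun n => ENNReal.ofReal (Real.pi / Real.sqrt (lam n)) * ENNReal.ofReal r)
      atTop (nhds 0) := by
    have h1 : Tendsto (fun n => Real.pi / Real.sqrt (lam n)) atTop (nhds 0) :=
      (Real.tendsto_sqrt_atTop.comp hlam).const_div_atTop Real.pi
    have h2 := ENNReal.tendsto_ofReal h1
    have h3 := ENNReal.Tendsto.mul_const (b := ENNReal.ofReal r) h2 (Or.inr ENNReal.ofReal_ne_top)
    simpa using h3
  refine tendsto_of_tendsto_of_tendsto_of_le_of_le' tendsto_const_nhds hlim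
    (Eventually.of_forall fun n => zero_le) ?_
  filter_upwards [hlam.eventually_gt_atTop 0] with n hn
  have hPo : IsOpen (εp n) := by
    have := (hu n).isOpen_inter_preimage isOpen_Ioo (isOpen_Ioi (a := (0:ℝ)))
    rw [hεp n]
    exact this
  set K := ENNReal.ofReal (Real.pi / Real.sqrt (lam n)) with hK
  set 𝒞 : Set (Set ℝ) := {C | ∃ t ∈ εp n, C = connectedComponentIn (εp n) t} with h𝒞
  have hdisj : 𝒞.PairwiseDisjoint id := by
    rintro _ ⟨t, ht, rfl⟩ _ ⟨t', ht', rfl⟩ hne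
    rw [Function.onFun, Set.disjoint_left]
    intro x hx hx'
    exact hne ((connectedComponentIn_eq hx).trans (connectedComponentIn_eq hx').symm)
  have hopen : ∀ C ∈ 𝒞, IsOpen C := by
    rintro _ ⟨t, ht, rfl⟩
    exact hPo.connectedComponentIn
  have hcount : 𝒞.Countable := by
    refine hdisj.countable_of_isOpen hopen ?_
    rintro _ ⟨t, ht, rfl⟩
    exact ⟨t, mem_connectedComponentIn ht⟩
  set S : Set ℝ → Set ℝ := fun C => {s | (s, sInf C) ∈ E n} with hS
  have hSK : ∀ C ∈ 𝒞, volume (S C) ≤ K := by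
    rintro _ ⟨t, ht, rfl⟩
    by_cases hbr : sInf (connectedComponentIn (εp n) t) ∈ Set.Ioo 0 r
    · refine le_trans (measure_mono ?_) (slice_bound r (u n) (hu n) (lam n) _ hn hbr.2)
      intro s hs
      have h0 := inf_nonpos r (u n) (hu n) t (εp n) (hεp n) hPo ht hbr
      simp only [hS, hE n, Set.mem_setOf_eq] at hs
      obtain ⟨h1, h2, h3, h4⟩ := hs
      exact ⟨⟨h1, h2⟩, by linarith⟩
    · have : S (connectedComponentIn (εp n) t) = ∅ := by
        ext s
        simp only [hS, hE n, Set.mem_setOf_eq, Set.mem_empty_iff_false, iff_false]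
        rintro ⟨h1, h2, h3, -⟩
        exact hbr ⟨h1.trans h2, h3⟩
      rw [this]; simp
  calc volume {p : ℝ × ℝ | p ∈ E n ∧ p.2 ∈ εp n ∧ (p.1, a n p.2) ∈ E n}
      ≤ volume (⋃ C ∈ 𝒞, S C ×ˢ C) := by
        apply measure_mono
        rintro ⟨s, t⟩ ⟨-, ht, hst⟩
        simp only at ht hst
        rw [ha n t ht] at hst
        exact Set.mem_biUnion (show connectedComponentIn (εp n) t ∈ 𝒞 from ⟨t, ht, rfl⟩)
          ⟨hst, mem_connectedComponentIn ht⟩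
    _ ≤ ∑' C : 𝒞, volume (S C ×ˢ (C : Set ℝ)) := measure_biUnion_le volume hcount _
    _ ≤ ∑' C : 𝒞, K * volume (C : Set ℝ) := by
        refine ENNReal.tsum_le_tsum fun C => ?_
        rw [Measure.volume_eq_prod, Measure.prod_prod]
        gcongr
        exact hSK C C.2
    _ = K * ∑' C : 𝒞, volume (C : Set ℝ) := ENNReal.tsum_mul_left
    _ = K * volume (⋃ C ∈ 𝒞, id C) := by
        rw [measure_biUnion hcount hdisj (fun C hC => (hopen C hC).measurableSet)]
        rfl
    _ ≤ K * ENNReal.ofReal r := by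
        gcongr
        calc volume (⋃ C ∈ 𝒞, id C) ≤ volume (Set.Ioo 0 r) := by
              apply measure_mono
              apply Set.iUnion₂_subset
              rintro _ ⟨t, ht, rfl⟩
              refine (connectedComponentIn_subset _ _).trans ?_
              rw [hεp n]
              exact fun x hx => hx.1
          _ = ENNReal.ofReal r := by rw [Real.volume_Ioo]; simp
end
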